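/- arXiv:2510.26827 — 10 statements merged into one kernel-verified Lean document; each statement's English description precedes it below -/
import Mathlib

section
/- If X is a weak Asplund real Banach space and Y is a finite-dimensional real normed space, then the product space X × Y (with a product norm) is a weak Asplund space. -/
open Filter Topology

/-- `φ` is Gâteaux differentiable at `p`: there is a continuous linear functional `L`
such that for every direction `v`, `(φ (p + t • v) - φ p) / t → L v` as `t → 0`. -/
def GateauxDiffAt {X : Type*} [NormedAddCommGroup X] [NormedSpace ℝ X]
    (φ : X → ℝ) (p : X) : Prop :=
  ∃ L : X →L[ℝ] ℝ, ∀ v : X,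
    Tendsto (fun t : ℝ => (φ (p + t • v) - φ p) / t) (𝓝[≠] (0 : ℝ)) (𝓝 (L v))

/-- A real normed space `X` is weak Asplund if for every nonempty open convex subset `O`
and every continuous convex function `φ : O → ℝ`, there is a subset `G` of `O` which is
dense in `O`, is a countable intersection of open sets with `O` (a Gδ subset of `O`),
and such that `φ` is Gâteaux differentiable at every point of `G`. -/
def IsWeakAsplund (X : Type*) [NormedAddCommGroup X] [NormedSpace ℝ X] : Prop :=
  ∀ O : Set X, IsOpen O → Convex ℝ O → O.Nonempty →
    ∀ φ : X → ℝ, ContinuousOn φ O → ConvexOn ℝ O φ →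
      ∃ G : Set X, G ⊆ O ∧ O ⊆ closure G ∧
        (∃ U : ℕ → Set X, (∀ n, IsOpen (U n)) ∧ G = O ∩ ⋂ n, U n) ∧
        ∀ p ∈ G, GateauxDiffAt φ p


theorem wa_game {P St : Type*} [TopologicalSpace P] (W : St → Set P) (hW : ∀ σ, IsOpen (W σ))
    (R : ℕ → St → St → Prop)
    (h : ∀ k σ V, IsOpen V → V.Nonempty → V ⊆ W σ → ∃ τ, R k σ τ ∧ (W τ).Nonempty ∧ W τ ⊆ V)
    (σ0 : St) :
    ∃ U : ℕ → Set P, (∀ k, IsOpen (U k)) ∧ (∀ k, W σ0 ⊆ closure (U k)) ∧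
      ∀ p, (∀ k, p ∈ U k) → ∃ s : ℕ → St, s 0 = σ0 ∧ ∀ k, R k (s k) (s (k+1)) ∧ p ∈ W (s k) := by
  classical
  have key : ∀ k σ, ∃ M : Set St, (∀ τ ∈ M, R k σ τ ∧ W τ ⊆ W σ) ∧ M.PairwiseDisjoint W ∧
      W σ ⊆ closure (⋃ τ ∈ M, W τ) := by
    intro k σ
    obtain ⟨M, hM⟩ := zorn_subset
      {M : Set St | (∀ τ ∈ M, R k σ τ ∧ (W τ).Nonempty ∧ W τ ⊆ W σ) ∧ M.PairwiseDisjoint W} (by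
        intro c hc hchain
        refine ⟨⋃₀ c, ⟨?_, ?_⟩, fun s hs => Set.subset_sUnion_of_mem hs⟩
        · rintro τ ⟨s, hs, hτ⟩
          exact (hc hs).1 τ hτ
        · exact (Set.pairwiseDisjoint_sUnion hchain.directedOn).2 fun s hs => (hc hs).2)
    have hMp := hM.prop
    refine ⟨M, fun τ hτ => ⟨(hMp.1 τ hτ).1, (hMp.1 τ hτ).2.2⟩, hMp.2, ?_⟩
    by_contra hcon
    rw [Set.not_subset] at hcon
    obtain ⟨p, hp, hpc⟩ := hcon
    obtain ⟨τ, hR, hne, hsub⟩ := h k σ (W σ ∩ (closure (⋃ τ ∈ M, W τ))ᶜ)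
      ((hW σ).inter isClosed_closure.isOpen_compl) ⟨p, hp, hpc⟩ Set.inter_subset_left
    have hdisj : ∀ τ' ∈ M, Disjoint (W τ) (W τ') := by
      intro τ' hτ'
      rw [Set.disjoint_left]
      intro q hq hq'
      exact (hsub hq).2 (subset_closure (Set.mem_biUnion hτ' hq'))
    have hins : insert τ M ∈ {M : Set St | (∀ τ ∈ M, R k σ τ ∧ (W τ).Nonempty ∧ W τ ⊆ W σ) ∧
        M.PairwiseDisjoint W} := by
      refine ⟨?_, ?_⟩
      · rintro τ' (rfl | hτ')
        · exact ⟨hR, hne, hsub.trans Set.inter_subset_left⟩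
        · exact hMp.1 τ' hτ'
      · exact hMp.2.insert fun τ' hτ' _ => hdisj τ' hτ'
    have hmem : τ ∈ M := hM.le_of_ge hins (Set.subset_insert τ M) (Set.mem_insert τ M)
    obtain ⟨q, hq⟩ := hne
    exact Set.disjoint_left.1 (hdisj τ hmem) hq hq
  choose M hM1 hM2 hM3 using key
  let F : ℕ → Set St := fun k => Nat.rec {σ0} (fun k Fk => {τ | ∃ σ ∈ Fk, τ ∈ M k σ}) k
  have F0 : F 0 = {σ0} := rfl
  have FS : ∀ k, F (k+1) = {τ | ∃ σ ∈ F k, τ ∈ M k σ} := fun k => rfl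
  have hdis : ∀ k, (F k).PairwiseDisjoint W := by
    intro k
    induction k with
    | zero => rw [F0]; exact Set.pairwiseDisjoint_singleton _ _
    | succ k ih =>
      rw [FS]
      rintro τ ⟨σ, hσ, hτ⟩ τ' ⟨σ', hσ', hτ'⟩ hne
      by_cases hs : σ = σ'
      · subst hs
        exact hM2 k σ hτ hτ' hne
      · exact (ih hσ hσ' hs).mono (hM1 k σ τ hτ).2 (hM1 k σ' τ' hτ').2
  refine ⟨fun k => ⋃ σ ∈ F k, W σ, fun k => isOpen_biUnion fun σ _ => hW σ, ?_, ?_⟩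
  · intro k
    induction k with
    | zero =>
      show W σ0 ⊆ closure (⋃ σ ∈ F 0, W σ)
      rw [F0]; simp only [Set.mem_singleton_iff, Set.iUnion_iUnion_eq_left]
      exact subset_closure
    | succ k ih =>
      refine ih.trans (closure_minimal ?_ isClosed_closure)
      refine Set.iUnion₂_subset fun σ hσ => (hM3 k σ).trans (closure_mono ?_)
      refine Set.iUnion₂_subset fun τ hτ => ?_
      exact Set.subset_biUnion_of_mem (u := W) (show τ ∈ F (k+1) from ⟨σ, hσ, hτ⟩)
  · intro p hp
    have : ∀ k, ∃ σ ∈ F k, p ∈ W σ := by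
      intro k
      have := hp k
      simpa using this
    choose s hs hps using this
    refine ⟨s, by simpa [F0] using hs 0, fun k => ⟨?_, hps k⟩⟩
    obtain ⟨σ, hσ, hτ⟩ := hs (k+1)
    have : s k = σ := by
      by_contra hne
      exact Set.disjoint_left.1 (hdis k (hs k) hσ hne) (hps k) ((hM1 k σ _ hτ).2 (hps (k+1)))
    rw [this]
    exact (hM1 k σ _ hτ).1

theorem wa_exists_seq {α : Type*} (Good : α → Prop) (Q : ℕ → (ℕ → α) → α → Prop) (x0 : α)
    (h0 : Good x0)
    (hQ : ∀ n g, (∀ i ≤ n, Good (g i)) → ∃ y, Good y ∧ Q n g y)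
    (hc : ∀ n g g' y, (∀ i ≤ n, g i = g' i) → Q n g y → Q n g' y) :
    ∃ g : ℕ → α, g 0 = x0 ∧ (∀ n, Good (g n)) ∧ ∀ n, Q n g (g (n+1)) := by
  classical
  have hQ' : ∀ n g, ∃ y, (∀ i ≤ n, Good (g i)) → Good y ∧ Q n g y := by
    intro n g
    by_cases h : ∀ i ≤ n, Good (g i)
    · obtain ⟨y, hy⟩ := hQ n g h
      exact ⟨y, fun _ => hy⟩
    · exact ⟨x0, fun h' => absurd h' h⟩
  choose nx hnx using hQ'
  let G : ℕ → ℕ → α := fun n =>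
    Nat.rec (fun _ => x0) (fun n Gn => Function.update Gn (n+1) (nx n Gn)) n
  have GS : ∀ n, G (n+1) = Function.update (G n) (n+1) (nx n (G n)) := fun n => rfl
  have hst : ∀ n i, i ≤ n → G n i = G i i := by
    intro n
    induction n with
    | zero => intro i hi; obtain rfl : i = 0 := by omega
              rfl
    | succ n ih =>
      intro i hi
      rcases Nat.lt_or_ge n i with h | h
      · obtain rfl : i = n+1 := by omega
        rfl
      · rw [GS, Function.update_of_ne (by omega), ih i h]
  have hgood : ∀ n, ∀ i ≤ n, Good (G n i) := by
    intro n
    induction n with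
    | zero => intro i _; exact h0
    | succ n ih =>
      intro i hi
      rw [GS]
      rcases Nat.lt_or_ge n i with h | h
      · obtain rfl : i = n+1 := by omega
        rw [Function.update_self]
        exact (hnx n (G n) ih).1
      · rw [Function.update_of_ne (by omega)]
        exact ih i h
  refine ⟨fun n => G n n, rfl, fun n => hgood n n le_rfl, fun n => ?_⟩
  have h1 := (hnx n (G n) (hgood n)).2
  have h2 : G (n+1) (n+1) = nx n (G n) := by rw [GS, Function.update_self]
  show Q n (fun n => G n n) (G (n+1) (n+1))
  rw [h2]
  exact hc n _ _ _ (fun i hi => hst n i hi) h1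


def WaLip {E : Type*} [NormedAddCommGroup E] (L : ℝ) (f : E → ℝ) : Prop :=
  ∀ p q, f p - f q ≤ L * ‖p - q‖

def WaSD {E : Type*} [NormedAddCommGroup E] [NormedSpace ℝ E] (f : E → ℝ) (p v : E) : Prop :=
  ∀ ε > 0, ∃ τ : ℝ, 0 < τ ∧ f (p + τ • v) + f (p - τ • v) - 2 * f p ≤ ε * τ

section
variable {E : Type*} [NormedAddCommGroup E] [NormedSpace ℝ E]

theorem wa_cvx_line {f : E → ℝ} (hf : ConvexOn ℝ Set.univ f) (p v : E) {τ σ : ℝ} (h0 : 0 ≤ τ)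
    (h1 : τ ≤ σ) (h2 : 0 < σ) :
    σ * (f (p + τ • v) - f p) ≤ τ * (f (p + σ • v) - f p) := by
  have h := hf.2 (Set.mem_univ p) (Set.mem_univ (p + σ • v)) 
    (show (0:ℝ) ≤ 1 - τ / σ by rw [sub_nonneg, div_le_one h2]; exact h1)
    (show (0:ℝ) ≤ τ / σ by positivity) (by ring)
  have e : (1 - τ / σ) • p + (τ / σ) • (p + σ • v) = p + τ • v := by
    rw [smul_add, smul_smul, div_mul_cancel₀ _ h2.ne', ← add_assoc, ← add_smul]
    simp
  rw [e] at h
  simp only [smul_eq_mul] at h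
  have h3 : σ * f (p + τ • v) ≤ σ * ((1 - τ / σ) * f p + τ / σ * f (p + σ • v)) :=
    mul_le_mul_of_nonneg_left h h2.le
  have h4 : σ * ((1 - τ / σ) * f p + τ / σ * f (p + σ • v)) =
    (σ - τ) * f p + τ * f (p + σ • v) := by field_simp
  rw [h4] at h3
  linarith

theorem wa_cvx_mid {f : E → ℝ} (hf : ConvexOn ℝ Set.univ f) (p q r : E) (h : r + r = p + q) :
    2 * f r ≤ f p + f q := by
  have h' := hf.2 (Set.mem_univ p) (Set.mem_univ q) 
    (show (0:ℝ) ≤ 1/2 by norm_num) (show (0:ℝ) ≤ 1/2 by norm_num) (by norm_num)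
  have e : (1/2 : ℝ) • p + (1/2 : ℝ) • q = r := by
    rw [← smul_add, ← h, ← two_smul ℝ r, smul_smul]; norm_num
  rw [e] at h'
  simp only [smul_eq_mul] at h'
  linarith

theorem wa_sd_mono {f : E → ℝ} (hf : ConvexOn ℝ Set.univ f) (p v : E) {τ σ : ℝ} (h0 : 0 ≤ τ)
    (h1 : τ ≤ σ) (h2 : 0 < σ) :
    σ * (f (p + τ • v) + f (p - τ • v) - 2 * f p) ≤
      τ * (f (p + σ • v) + f (p - σ • v) - 2 * f p) := by
  have a := wa_cvx_line hf p v h0 h1 h2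
  have b := wa_cvx_line hf p (-v) h0 h1 h2
  simp only [smul_neg, ← sub_eq_add_neg] at b
  linarith

theorem wa_sd_small {f : E → ℝ} (hf : ConvexOn ℝ Set.univ f) {p v : E} (h : WaSD f p v)
    {ε : ℝ} (hε : 0 < ε) : ∃ τ0 > 0, ∀ τ, 0 < τ → τ ≤ τ0 →
      f (p + τ • v) + f (p - τ • v) - 2 * f p ≤ ε * τ := by
  obtain ⟨σ, hσ, h1⟩ := h ε hε
  refine ⟨σ, hσ, fun τ h0 h2 => ?_⟩
  have h3 := wa_sd_mono hf p v h0.le h2 hσ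
  have h4 : σ * (f (p + τ • v) + f (p - τ • v) - 2 * f p) ≤ σ * (ε * τ) := by
    refine h3.trans ((mul_le_mul_of_nonneg_left h1 h0.le).trans (le_of_eq (by ring)))
  exact le_of_mul_le_mul_left h4 hσ

theorem wa_sd_of_gateaux {f : E → ℝ} {p : E} (h : GateauxDiffAt f p) (v : E) : WaSD f p v := by
  intro ε hε
  obtain ⟨D, hD⟩ := h
  have h1 := hD v
  have h2 := hD (-v)
  have h3 := (h1.add h2).mono_left (nhdsGT_le_nhdsNE (0:ℝ))
  rw [map_neg, add_neg_cancel] at h3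
  have h4 := (h3.eventually (gt_mem_nhds hε)).and self_mem_nhdsWithin
  obtain ⟨τ, h5, h6⟩ := h4.exists
  have h6 : 0 < τ := h6
  refine ⟨τ, h6, ?_⟩
  rw [← add_div, div_lt_iff₀ h6, smul_neg, ← sub_eq_add_neg] at h5
  linarith

theorem wa_gateaux_of_sd {f : E → ℝ} {L : ℝ} (hf : ConvexOn ℝ Set.univ f) (hL : WaLip L f) {p : E}
    (h : ∀ v, WaSD f p v) : GateauxDiffAt f p := by
  let q : E → ℝ → ℝ := fun v τ => (f (p + τ • v) - f p) / τ
  have qdef : ∀ v τ, q v τ = (f (p + τ • v) - f p) / τ := fun _ _ => rfl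
  let D : E → ℝ := fun v => sInf (q v '' Set.Ioi 0)
  have hlow : ∀ v τ, 0 < τ → -(L * ‖v‖) ≤ q v τ := by
    intro v τ hτ
    rw [qdef, le_div_iff₀ hτ]
    have := hL p (p + τ • v)
    rw [show p - (p + τ • v) = -(τ • v) by abel, norm_neg, norm_smul, Real.norm_of_nonneg hτ.le]
      at this
    linarith
  have hup : ∀ v τ, 0 < τ → q v τ ≤ L * ‖v‖ := by
    intro v τ hτ
    rw [qdef, div_le_iff₀ hτ]
    have := hL (p + τ • v) p
    rw [show (p + τ • v) - p = (τ • v) by abel, norm_smul, Real.norm_of_nonneg hτ.le]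
      at this
    linarith
  have hbdd : ∀ v, BddBelow (q v '' Set.Ioi 0) := by
    intro v
    refine ⟨-(L * ‖v‖), ?_⟩
    rintro _ ⟨τ, hτ, rfl⟩
    exact hlow v τ hτ
  have hne : ∀ v, (q v '' Set.Ioi 0).Nonempty := fun v => ⟨_, 1, by simp, rfl⟩
  have hDle : ∀ v τ, 0 < τ → D v ≤ q v τ := fun v τ hτ => csInf_le (hbdd v) ⟨τ, hτ, rfl⟩
  have hmono : ∀ v τ σ, 0 < τ → τ ≤ σ → q v τ ≤ q v σ := by
    intro v τ σ h0 h1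
    have h2 := h0.trans_le h1
    rw [qdef, qdef, div_le_div_iff₀ h0 h2]
    have := wa_cvx_line hf p v h0.le h1 h2
    linarith
  have happ : ∀ v ε, 0 < ε → ∃ τ0 > 0, ∀ τ, 0 < τ → τ ≤ τ0 → q v τ < D v + ε := by
    intro v ε hε
    obtain ⟨_, ⟨σ, hσ, rfl⟩, h2⟩ := exists_lt_of_csInf_lt (hne v) (lt_add_of_pos_right (D v) hε)
    exact ⟨σ, hσ, fun τ h3 h4 => (hmono v τ σ h3 h4).trans_lt h2⟩
  have hsub : ∀ v w, D (v + w) ≤ D v + D w := by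
    intro v w
    refine le_of_forall_pos_le_add fun ε hε => ?_
    obtain ⟨a, ha, h1⟩ := happ v (ε/2) (by positivity)
    obtain ⟨b, hb, h2⟩ := happ w (ε/2) (by positivity)
    have hm : 0 < min a b := lt_min ha hb
    have h3 := h1 _ hm (min_le_left _ _)
    have h4 := h2 _ hm (min_le_right _ _)
    set τ := min a b
    have h5 := hDle (v + w) (τ / 2) (by positivity)
    have h6 : q (v + w) (τ / 2) ≤ q v τ + q w τ := by
      have := wa_cvx_mid hf (p + τ • v) (p + τ • w) (p + (τ/2) • (v + w)) (by
        have : (τ / 2) • (v + w) + (τ / 2) • (v + w) = τ • v + τ • w := by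
          rw [← add_smul, ← smul_add]; ring_nf
        rw [show p + (τ/2) • (v + w) + (p + (τ/2) • (v + w)) =
          p + p + ((τ / 2) • (v + w) + (τ / 2) • (v + w)) by abel, this]; abel)
      rw [qdef, qdef, qdef, ← add_div, div_le_div_iff₀ (by positivity) hm]
      nlinarith
    linarith
  have hhom : ∀ c v, 0 < c → D (c • v) ≤ c * D v := by
    intro c v hc
    refine le_of_forall_pos_le_add fun ε hε => ?_
    obtain ⟨a, ha, h1⟩ := happ v (ε/c) (by positivity)
    have h3 := h1 a ha le_rfl
    have h4 := hDle (c • v) (a / c) (by positivity)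
    rw [qdef, smul_smul, div_mul_cancel₀ _ hc.ne'] at h4
    rw [qdef, div_lt_iff₀ ha] at h3
    rw [le_div_iff₀ (by positivity)] at h4
    have e : (D v + ε / c) * a = (c * D v + ε) * (a / c) := by field_simp
    rw [e] at h3
    exact (lt_of_mul_lt_mul_right (h4.trans_lt h3) (by positivity)).le
  have h0 : D 0 = 0 := by
    refine le_antisymm ((hDle 0 1 one_pos).trans ?_) (le_csInf (hne 0) ?_)
    · simp [qdef]
    · rintro _ ⟨τ, hτ, rfl⟩
      simp [qdef]
  have hodd : ∀ v, D (-v) = - D v := by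
    intro v
    have h1 := hsub v (-v)
    rw [add_neg_cancel, h0] at h1
    have h2 : D v + D (-v) ≤ 0 := by
      refine le_of_forall_pos_le_add fun ε hε => ?_
      obtain ⟨τ, hτ, h2⟩ := h v ε hε
      have h3 := hDle v τ hτ
      have h4 := hDle (-v) τ hτ
      rw [qdef, le_div_iff₀ hτ] at h3 h4
      rw [smul_neg, ← sub_eq_add_neg] at h4
      have : (D v + D (-v)) * τ ≤ (0 + ε) * τ := by linarith
      exact le_of_mul_le_mul_right this hτ
    linarith
  have hadd : ∀ v w, D (v + w) = D v + D w := by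
    intro v w
    have h1 := hsub v w
    have h2 := hsub (-v) (-w)
    rw [← neg_add, hodd, hodd, hodd] at h2
    linarith
  have hhom' : ∀ c v, 0 < c → D (c • v) = c * D v := by
    intro c v hc
    refine le_antisymm (hhom c v hc) ?_
    have := hhom c (-v) hc
    rw [smul_neg, hodd, hodd] at this
    linarith
  have hsmul : ∀ (c : ℝ) v, D (c • v) = c * D v := by
    intro c v
    rcases lt_trichotomy c 0 with hc | rfl | hc
    · have := hhom' (-c) v (by linarith)
      rw [neg_smul, hodd] at this
      linarith
    · simp [h0]
    · exact hhom' c v hc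
  let Dl : E →ₗ[ℝ] ℝ := { toFun := D, map_add' := hadd, map_smul' := fun c v => hsmul c v }
  have hbd : ∀ v, ‖Dl v‖ ≤ L * ‖v‖ := by
    intro v
    change |D v| ≤ _
    rw [abs_le]
    refine ⟨le_csInf (hne v) ?_, (hDle v 1 one_pos).trans (hup v 1 one_pos)⟩
    rintro _ ⟨τ, hτ, rfl⟩
    exact hlow v τ hτ
  refine ⟨Dl.mkContinuous L hbd, fun v => ?_⟩
  change Tendsto _ _ (𝓝 (D v))
  rw [Metric.tendsto_nhds]
  intro ε hε
  obtain ⟨a, ha, h1⟩ := happ v ε hε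
  obtain ⟨b, hb, h2⟩ := happ (-v) ε hε
  have hm : 0 < min a b := lt_min ha hb
  rw [eventually_nhdsWithin_iff]
  filter_upwards [Metric.ball_mem_nhds (0:ℝ) hm] with t ht ht0
  rw [Metric.mem_ball, dist_zero_right, Real.norm_eq_abs] at ht
  have ht0 : t ≠ 0 := ht0
  rw [Real.dist_eq, abs_lt]
  rcases lt_or_gt_of_ne ht0 with h | h
  · rw [abs_of_neg h] at ht
    have h3 := h2 (-t) (by linarith) (ht.le.trans (min_le_right _ _))
    have h4 := hDle (-v) (-t) (by linarith)
    rw [qdef, smul_neg, neg_smul, neg_neg, div_neg, hodd] at h3 h4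
    constructor <;> linarith
  · rw [abs_of_pos h] at ht
    have h3 := h1 t h (ht.le.trans (min_le_left _ _))
    have h4 := hDle v t h
    rw [qdef] at h3 h4
    constructor <;> linarith

end

theorem wa_sd_prod {X Y : Type*} [NormedAddCommGroup X] [NormedSpace ℝ X]
    [NormedAddCommGroup Y] [NormedSpace ℝ Y] {f : X × Y → ℝ} (hf : ConvexOn ℝ Set.univ f)
    {p : X × Y} (h1 : ∀ v : X, WaSD f p (v, 0)) (h2 : ∀ w : Y, WaSD f p (0, w)) (u : X × Y) :
    WaSD f p u := by
  intro ε hε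
  obtain ⟨a, ha, h3⟩ := wa_sd_small hf (h1 u.1) (half_pos hε)
  obtain ⟨b, hb, h4⟩ := wa_sd_small hf (h2 u.2) (half_pos hε)
  have hm : 0 < min a b := lt_min ha hb
  have h5 := h3 _ hm (min_le_left _ _)
  have h6 := h4 _ hm (min_le_right _ _)
  set τ := min a b
  refine ⟨τ/2, by positivity, ?_⟩
  have e : (τ/2) • u + (τ/2) • u = τ • ((u.1, 0) : X × Y) + τ • (0, u.2) := by
    rw [← add_smul, ← smul_add]; simp
  have h7 := wa_cvx_mid hf (p + τ • (u.1, 0)) (p + τ • (0, u.2)) (p + (τ/2) • u) (by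
    rw [show p + (τ/2) • u + (p + (τ/2) • u) = p + p + ((τ/2) • u + (τ/2) • u) by abel, e]; abel)
  have h8 := wa_cvx_mid hf (p - τ • (u.1, 0)) (p - τ • (0, u.2)) (p - (τ/2) • u) (by
    rw [show p - (τ/2) • u + (p - (τ/2) • u) = p + p - ((τ/2) • u + (τ/2) • u) by abel, e]; abel)
  linarith


theorem wa_extend {Z : Type*} [NormedAddCommGroup Z] [NormedSpace ℝ Z] {O : Set Z}
    (hO : Convex ℝ O) {φ : Z → ℝ} (hφ : ConvexOn ℝ O φ) {L : ℝ} (hL : 0 < L)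
    {S : Set Z} (hSO : S ⊆ O) (hSne : S.Nonempty)
    (hS : ∀ a ∈ S, ∀ q ∈ O, φ a - L * ‖a - q‖ ≤ φ q) :
    ∃ ψ : Z → ℝ, ConvexOn ℝ Set.univ ψ ∧ WaLip L ψ ∧ ∀ a ∈ S, ψ a = φ a := by
  obtain ⟨a0, ha0⟩ := hSne
  have hne : Nonempty O := ⟨⟨a0, hSO ha0⟩⟩
  let ψ : Z → ℝ := fun p => ⨅ q : O, (φ q + L * ‖p - q‖)
  have hlow : ∀ a ∈ S, ∀ p : Z, ∀ q : O, φ a - L * ‖p - a‖ ≤ φ q + L * ‖p - q‖ := by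
    intro a ha p q
    have h1 := hS a ha q q.2
    have h2 : ‖a - q‖ ≤ ‖p - a‖ + ‖p - q‖ := by
      rw [norm_sub_rev p a]; exact norm_sub_le_norm_sub_add_norm_sub a p q
    nlinarith
  have hb : ∀ p : Z, BddBelow (Set.range fun q : O => φ q + L * ‖p - q‖) := by
    intro p
    refine ⟨φ a0 - L * ‖p - a0‖, ?_⟩
    rintro _ ⟨q, rfl⟩
    exact hlow a0 ha0 p q
  have hle : ∀ (p : Z) (q : O), ψ p ≤ φ q + L * ‖p - q‖ := fun p q => ciInf_le (hb p) q
  have happ : ∀ (p : Z) (ε : ℝ), 0 < ε → ∃ q : O, φ q + L * ‖p - q‖ < ψ p + ε := by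
    intro p ε hε
    exact exists_lt_of_ciInf_lt (lt_add_of_pos_right (ψ p) hε)
  refine ⟨ψ, ⟨convex_univ, ?_⟩, ?_, ?_⟩
  · intro x _ y _ a b ha hb hab
    refine le_of_forall_pos_le_add fun ε hε => ?_
    obtain ⟨q, hq⟩ := happ x ε hε
    obtain ⟨q', hq'⟩ := happ y ε hε
    have h1 := hle (a • x + b • y) ⟨a • (q:Z) + b • q', hO q.2 q'.2 ha hb hab⟩
    have h2 := hφ.2 q.2 q'.2 ha hb hab
    have h3 : ‖a • x + b • y - (a • (q:Z) + b • q')‖ ≤ a * ‖x - q‖ + b * ‖y - q'‖ := by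
      rw [show a • x + b • y - (a • (q:Z) + b • (q':Z)) = a • (x - q) + b • (y - q') by
        rw [smul_sub, smul_sub]; abel]
      refine (norm_add_le _ _).trans (le_of_eq ?_)
      rw [norm_smul, norm_smul, Real.norm_of_nonneg ha, Real.norm_of_nonneg hb]
    simp only [smul_eq_mul] at h2 ⊢
    have h4 := mul_le_mul_of_nonneg_left h3 hL.le
    have h5 := mul_le_mul_of_nonneg_left hq.le ha
    have h6 := mul_le_mul_of_nonneg_left hq'.le hb
    have h7 : a * ε + b * ε = ε := by rw [← add_mul, hab, one_mul]
    simp only at h1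
    linarith
  · intro p p'
    rw [sub_le_iff_le_add']
    refine le_of_forall_pos_le_add fun ε hε => ?_
    obtain ⟨q, hq⟩ := happ p' ε hε
    have h1 := hle p q
    have h2 : ‖p - q‖ ≤ ‖p - p'‖ + ‖p' - q‖ := norm_sub_le_norm_sub_add_norm_sub p p' q
    nlinarith
  · intro a ha
    refine le_antisymm ?_ (le_ciInf fun q => ?_)
    · simpa using hle a ⟨a, hSO ha⟩
    · simpa using hlow a ha a q

theorem wa_gateaux_congr {Z : Type*} [NormedAddCommGroup Z] [NormedSpace ℝ Z] {φ ψ : Z → ℝ}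
    {S : Set Z} (hS : IsOpen S) (h : ∀ a ∈ S, ψ a = φ a) {p : Z} (hp : p ∈ S)
    (hg : GateauxDiffAt ψ p) : GateauxDiffAt φ p := by
  obtain ⟨D, hD⟩ := hg
  refine ⟨D, fun v => (hD v).congr' ?_⟩
  have hc : Tendsto (fun t : ℝ => p + t • v) (𝓝[≠] 0) (𝓝 p) := by
    have : Continuous (fun t : ℝ => p + t • v) := by fun_prop
    have := this.tendsto 0
    simp only [zero_smul, add_zero] at this
    exact this.mono_left nhdsWithin_le_nhds
  filter_upwards [hc.eventually (hS.mem_nhds hp)] with t ht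
  rw [h _ ht, h _ hp]

theorem wa_reduction {Z : Type*} [NormedAddCommGroup Z] [NormedSpace ℝ Z] [CompleteSpace Z]
    (H : ∀ (φ : Z → ℝ) (L : ℝ), 0 < L → ConvexOn ℝ Set.univ φ → WaLip L φ →
      ∃ U : ℕ → Set Z, (∀ k, IsOpen (U k)) ∧ (∀ k, Dense (U k)) ∧
        ∀ p, (∀ k, p ∈ U k) → GateauxDiffAt φ p) : IsWeakAsplund Z := by
  intro O hOo hOc _ φ hφc hφ
  let S : ℕ → Set Z := fun n => {p | ∃ r > 0, Metric.ball p r ⊆ O ∧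
    ∀ q ∈ Metric.ball p r, ∀ q' ∈ Metric.ball p r, φ q - φ q' ≤ ((n:ℝ) + 1) * ‖q - q'‖}
  have hSO : ∀ n, S n ⊆ O := by
    rintro n p ⟨r, hr, h1, _⟩
    exact h1 (Metric.mem_ball_self hr)
  have hSo : ∀ n, IsOpen (S n) := by
    intro n
    rw [Metric.isOpen_iff]
    rintro p ⟨r, hr, h1, h2⟩
    refine ⟨r, hr, fun p' hp' => ?_⟩
    have hs : Metric.ball p' (r - dist p' p) ⊆ Metric.ball p r :=
      Metric.ball_subset_ball' (by linarith)
    exact ⟨r - dist p' p, sub_pos.2 hp', hs.trans h1,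
      fun q hq q' hq' => h2 q (hs hq) q' (hs hq')⟩
  have hSU : ∀ p ∈ O, ∃ n, p ∈ S n := by
    intro p hp
    have hl := (hφ.locallyLipschitzOn_iff_continuousOn hOo).2 hφc
    obtain ⟨K, t, ht, hK⟩ := hl hp
    rw [hOo.nhdsWithin_eq hp] at ht
    obtain ⟨r, hr, hrt⟩ := Metric.mem_nhds_iff.1 (Filter.inter_mem ht (hOo.mem_nhds hp))
    obtain ⟨n, hn⟩ := exists_nat_ge (K : ℝ)
    refine ⟨n, r, hr, hrt.trans Set.inter_subset_right, fun q hq q' hq' => ?_⟩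
    have h1 := hK.dist_le_mul q (hrt hq).1 q' (hrt hq').1
    rw [Real.dist_eq, dist_eq_norm] at h1
    have h2 := (le_abs_self _).trans h1
    refine h2.trans (mul_le_mul_of_nonneg_right (by linarith) (norm_nonneg _))
  have key : ∀ n, ∃ U : ℕ → Set Z, (∀ k, IsOpen (U k)) ∧ (∀ k, Dense (U k)) ∧
        ∀ p ∈ S n, (∀ k, p ∈ U k) → GateauxDiffAt φ p := by
    intro n
    rcases (S n).eq_empty_or_nonempty with he | hne
    · exact ⟨fun _ => Set.univ, fun _ => isOpen_univ, fun _ => dense_univ, by simp [he]⟩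
    obtain ⟨ψ, h1, h2, h3⟩ := wa_extend hOc hφ (L := (n:ℝ) + 1) (by positivity) (hSO n) hne (by
      rintro a ⟨r, hr, h1, h2⟩ q hq
      rcases eq_or_ne a q with rfl | hne
      · simp
      have hd : 0 < ‖q - a‖ := norm_pos_iff.2 (sub_ne_zero.2 hne.symm)
      set τ := min 1 (r / (2 * ‖q - a‖)) with hτ
      have hτ0 : 0 < τ := by positivity
      have hτ1 : τ ≤ 1 := min_le_left _ _
      have hτr : τ * ‖q - a‖ < r := by
        have : τ ≤ r / (2 * ‖q - a‖) := min_le_right _ _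
        rw [le_div_iff₀ (by positivity)] at this
        linarith
      have h4 := hφ.2 (hSO n ⟨r, hr, h1, h2⟩) hq (sub_nonneg.2 hτ1) hτ0.le (by ring)
      have e : (1 - τ) • a + τ • q - a = τ • (q - a) := by
        rw [sub_smul, smul_sub, one_smul]; abel
      have e2 : ‖(1 - τ) • a + τ • q - a‖ = τ * ‖q - a‖ := by
        rw [e, norm_smul, Real.norm_of_nonneg hτ0.le]
      have h5 := h2 a (Metric.mem_ball_self hr) ((1 - τ) • a + τ • q) (by
        rw [Metric.mem_ball, dist_eq_norm, e2]; exact hτr)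
      rw [norm_sub_rev, e2] at h5
      simp only [smul_eq_mul] at h4
      rw [norm_sub_rev a q]
      have : τ * (φ a - ((n:ℝ)+1) * ‖q - a‖) ≤ τ * φ q := by linarith
      exact le_of_mul_le_mul_left this hτ0)
    obtain ⟨U, hU1, hU2, hU3⟩ := H ψ (n+1) (by positivity) h1 h2
    exact ⟨U, hU1, hU2, fun p hp hpU => wa_gateaux_congr (hSo n) h3 hp (hU3 p hpU)⟩
  choose U hU1 hU2 hU3 using key
  refine ⟨O ∩ ⋂ m : ℕ, U (Nat.unpair m).1 (Nat.unpair m).2, Set.inter_subset_left, ?_,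
    ⟨fun m => U (Nat.unpair m).1 (Nat.unpair m).2, fun m => hU1 _ _, rfl⟩, ?_⟩
  · exact (dense_iInter_of_isOpen (fun m => hU1 _ _) fun m => hU2 _ _).open_subset_closure_inter hOo
  · rintro p ⟨hp, hpU⟩
    obtain ⟨n, hn⟩ := hSU p hp
    refine hU3 n p hn fun k => ?_
    have := Set.mem_iInter.1 hpU (Nat.pair n k)
    simpa using this


theorem WaLip.continuous {E : Type*} [NormedAddCommGroup E] {L : ℝ} {f : E → ℝ}
    (h : WaLip L f) (hL : 0 < L) : Continuous f := by
  have : LipschitzWith L.toNNReal f := by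
    refine LipschitzWith.of_dist_le_mul fun x y => ?_
    rw [Real.coe_toNNReal _ hL.le, Real.dist_eq, dist_eq_norm, abs_le]
    have h1 := h x y
    have h2 := h y x
    rw [norm_sub_rev] at h2
    constructor <;> linarith
  exact this.continuous

theorem wa_line_dense {Z : Type*} [NormedAddCommGroup Z] [NormedSpace ℝ Z] {φ : Z → ℝ} {L : ℝ}
    (hL : 0 < L) (hl : WaLip L φ) (u : Z) {ε : ℝ} (hε : 0 < ε) :
    IsOpen {p | ∃ τ : ℝ, 0 < τ ∧ φ (p + τ • u) + φ (p - τ • u) - 2 * φ p < ε * τ} ∧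
    Dense {p | ∃ τ : ℝ, 0 < τ ∧ φ (p + τ • u) + φ (p - τ • u) - 2 * φ p < ε * τ} := by
  have hc := hl.continuous hL
  constructor
  · have : {p | ∃ τ : ℝ, 0 < τ ∧ φ (p + τ • u) + φ (p - τ • u) - 2 * φ p < ε * τ} =
        ⋃ τ ∈ Set.Ioi (0:ℝ), {p | φ (p + τ • u) + φ (p - τ • u) - 2 * φ p < ε * τ} := by
      ext p; simp
    rw [this]
    exact isOpen_biUnion fun τ _ => isOpen_lt (by fun_prop) continuous_const
  · rw [Metric.dense_iff]
    intro p0 r hr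
    let g : ℝ → ℝ := fun t => φ (p0 + t • u)
    have hg : LipschitzWith (L * ‖u‖).toNNReal g := by
      refine LipschitzWith.of_dist_le_mul fun x y => ?_
      rw [Real.coe_toNNReal _ (by positivity), Real.dist_eq, Real.dist_eq, abs_le]
      have h1 := hl (p0 + x • u) (p0 + y • u)
      have h2 := hl (p0 + y • u) (p0 + x • u)
      rw [norm_sub_rev] at h2
      rw [add_sub_add_left_eq_sub, ← sub_smul, norm_smul, Real.norm_eq_abs] at h1 h2
      constructor <;> simp only [g] <;> linarith
    have hd := MeasureTheory.Measure.dense_of_ae hg.ae_differentiableAt_real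
    obtain ⟨t, ht, htr⟩ := (Metric.dense_iff.1 hd) 0 (r / (‖u‖ + 1)) (by positivity)
    have hgd : GateauxDiffAt g t := by
      refine ⟨fderiv ℝ g t, fun v => ?_⟩
      have h1 := (htr.hasFDerivAt.hasLineDerivAt v).tendsto_slope_zero
      refine h1.congr fun s => ?_
      rw [smul_eq_mul, inv_mul_eq_div]
    obtain ⟨τ, hτ, h⟩ := wa_sd_of_gateaux hgd 1 (ε/2) (by positivity)
    refine ⟨p0 + t • u, ?_, τ, hτ, ?_⟩
    · rw [Metric.mem_ball, dist_eq_norm, add_sub_cancel_left, norm_smul]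
      rw [Metric.mem_ball, dist_zero_right, lt_div_iff₀ (by positivity)] at ht
      refine lt_of_le_of_lt ?_ ht
      exact mul_le_mul_of_nonneg_left (by linarith) (norm_nonneg _)
    · simp only [g, smul_eq_mul, mul_one, add_smul, sub_smul] at h
      rw [add_assoc, add_sub_assoc p0]
      have : 0 < ε * τ := by positivity
      linarith

theorem wa_Ydir {X Y : Type*} [NormedAddCommGroup X] [NormedSpace ℝ X]
    [NormedAddCommGroup Y] [NormedSpace ℝ Y] [TopologicalSpace.SeparableSpace Y]
    {φ : X × Y → ℝ} {L : ℝ} (hL : 0 < L) (hl : WaLip L φ) :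
    ∃ U : ℕ → Set (X × Y), (∀ k, IsOpen (U k)) ∧ (∀ k, Dense (U k)) ∧
        ∀ p, (∀ k, p ∈ U k) → ∀ w, WaSD φ p (0, w) := by
  let D := TopologicalSpace.denseSeq Y
  have hD := TopologicalSpace.denseRange_denseSeq Y
  refine ⟨fun k => {p | ∃ τ : ℝ, 0 < τ ∧ φ (p + τ • (0, D (Nat.unpair k).1)) +
    φ (p - τ • (0, D (Nat.unpair k).1)) - 2 * φ p < (1 / ((Nat.unpair k).2 + 1 : ℝ)) * τ},
    fun k => (wa_line_dense hL hl _ (by positivity)).1,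
    fun k => (wa_line_dense hL hl _ (by positivity)).2, fun p hp w ε hε => ?_⟩
  obtain ⟨m, hm⟩ := hD.exists_dist_lt w (ε := ε / (4 * L)) (by positivity)
  obtain ⟨n, hn⟩ := exists_nat_one_div_lt (half_pos hε)
  obtain ⟨τ, hτ, h⟩ := hp (Nat.pair m n)
  simp only [Nat.unpair_pair] at h
  refine ⟨τ, hτ, ?_⟩
  have h1 := hl (p + τ • (0, w)) (p + τ • (0, D m))
  have h2 := hl (p - τ • (0, w)) (p - τ • (0, D m))
  rw [add_sub_add_left_eq_sub, ← smul_sub] at h1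
  rw [sub_sub_sub_cancel_left, ← smul_sub, ← neg_sub (0, w) ((0, D m) : X × Y), smul_neg,
    norm_neg] at h2
  have h3 : ‖τ • (((0, w) : X × Y) - (0, D m))‖ ≤ τ * (ε / (4 * L)) := by
    rw [norm_smul, Real.norm_of_nonneg hτ.le]
    refine mul_le_mul_of_nonneg_left ?_ hτ.le
    rw [dist_eq_norm] at hm
    simpa [Prod.norm_def] using hm.le
  have h4 := mul_le_mul_of_nonneg_left h3 hL.le
  have h5 : L * (τ * (ε / (4 * L))) = τ * ε / 4 := by field_simp
  have h6 := mul_le_mul_of_nonneg_right hn.le hτ.le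
  nlinarith

theorem wa_FL_case {X Y : Type*} [NormedAddCommGroup X] [NormedSpace ℝ X]
    [NormedAddCommGroup Y] [NormedSpace ℝ Y]
    (hFL : ∀ f : X → ℝ, ConvexOn ℝ Set.univ f → WaLip 1 f → ∀ (x0 : X) (r ε : ℝ), 0 < r → 0 < ε →
      ∃ x ∈ Metric.ball x0 r, ∃ δ > 0, ∀ v, ‖v‖ ≤ δ → f (x + v) + f (x - v) - 2 * f x ≤ ε * δ)
    {φ : X × Y → ℝ} {L : ℝ} (hL : 0 < L) (hφ : ConvexOn ℝ Set.univ φ) (hl : WaLip L φ) :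
    ∃ U : ℕ → Set (X × Y), (∀ k, IsOpen (U k)) ∧ (∀ k, Dense (U k)) ∧
        ∀ p, (∀ k, p ∈ U k) → ∀ v, WaSD φ p (v, 0) := by
  let T : ℕ → Set (X × Y) := fun k => {p | ∃ δ > 0, ∀ v : X, ‖v‖ ≤ δ →
    φ (p + (v, 0)) + φ (p - (v, 0)) - 2 * φ p ≤ 1 / (k + 1 : ℝ) * δ}
  refine ⟨fun k => interior (T k), fun k => isOpen_interior, fun k => ?_, ?_⟩
  · rw [Metric.dense_iff]
    rintro ⟨x0, s⟩ r hr
    have hlift : ∀ x y : X, ‖((x, s) : X × Y) - (y, s)‖ = ‖x - y‖ := by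
      intro x y; simp [Prod.norm_def]
    obtain ⟨x, hx, δ, hδ, h⟩ := hFL (fun x => L⁻¹ * φ (x, s)) (by
      refine ⟨convex_univ, fun x _ y _ a b ha hb hab => ?_⟩
      have := hφ.2 (Set.mem_univ (x, s)) (Set.mem_univ (y, s)) ha hb hab
      have e : a • ((x, s) : X × Y) + b • (y, s) = (a • x + b • y, s) := by
        ext <;> simp [← add_smul, hab]
      rw [e] at this
      have := mul_le_mul_of_nonneg_left this (inv_pos.2 hL).le
      simp only [smul_eq_mul] at this ⊢
      linarith) (by
      intro x y
      have := hl (x, s) (y, s)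
      rw [hlift] at this
      rw [← mul_sub, inv_mul_le_iff₀ hL, one_mul]
      exact this) x0 r (L⁻¹ * (1 / (2 * (k + 1 : ℝ)))) hr (by positivity)
    refine ⟨(x, s), ?_, ?_⟩
    · rw [Metric.mem_ball, dist_eq_norm, hlift, ← dist_eq_norm]; exact hx
    rw [mem_interior_iff_mem_nhds, Metric.mem_nhds_iff]
    refine ⟨δ / (8 * L * (k + 1)), by positivity, fun p hp => ⟨δ, hδ, fun v hv => ?_⟩⟩
    have h0 : L⁻¹ * (φ (x + v, s) + φ (x - v, s) - 2 * φ (x, s)) ≤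
      L⁻¹ * (1 / (2 * (k + 1 : ℝ)) * δ) := by have := h v hv; linarith
    have h0 := le_of_mul_le_mul_left h0 (inv_pos.2 hL)
    have e1 : ((x, s) : X × Y) + (v, 0) = (x + v, s) := by simp
    have e2 : ((x, s) : X × Y) - (v, 0) = (x - v, s) := by simp
    rw [← e1, ← e2] at h0
    have h1 := hl (p + (v, 0)) ((x, s) + (v, 0))
    have h2 := hl (p - (v, 0)) ((x, s) - (v, 0))
    have h3 := hl (x, s) p
    rw [add_sub_add_right_eq_sub] at h1
    rw [sub_sub_sub_cancel_right] at h2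
    rw [norm_sub_rev] at h3
    rw [Metric.mem_ball, dist_eq_norm] at hp
    have h4 := mul_le_mul_of_nonneg_left hp.le hL.le
    have e3 : 1 / (2 * (k + 1 : ℝ)) * δ + 4 * (L * (δ / (8 * L * (k + 1)))) =
      1 / (k + 1 : ℝ) * δ := by field_simp; ring
    linarith
  · intro p hp v ε hε
    obtain ⟨k, hk⟩ := exists_nat_one_div_lt (show 0 < ε / (‖v‖ + 1) by positivity)
    obtain ⟨δ, hδ, h⟩ := interior_subset (hp k)
    refine ⟨δ / (‖v‖ + 1), by positivity, ?_⟩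
    have h1 := h ((δ / (‖v‖ + 1)) • v) (by
      rw [norm_smul, Real.norm_of_nonneg (by positivity), div_mul_eq_mul_div,
        div_le_iff₀ (by positivity)]
      exact mul_le_mul_of_nonneg_left (by linarith) hδ.le)
    have e : (δ / (‖v‖ + 1)) • ((v, 0) : X × Y) = ((δ / (‖v‖ + 1)) • v, 0) := by simp
    rw [e]
    have h2 := mul_le_mul_of_nonneg_right hk.le hδ.le
    have e2 : ε / (‖v‖ + 1) * δ = ε * (δ / (‖v‖ + 1)) := by ring
    linarith


theorem wa_subgrad {X : Type*} [NormedAddCommGroup X] [NormedSpace ℝ X] {f : X → ℝ} {L : ℝ}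
    (hf : ConvexOn ℝ Set.univ f) (hL : WaLip L f) {z : X} (h : GateauxDiffAt f z) :
    ∃ ξ : X →L[ℝ] ℝ, (∀ v, |ξ v| ≤ L * ‖v‖) ∧ (∀ v, ξ v ≤ f (z + v) - f z) ∧
      ∀ u η, 0 < η → ∃ τ > 0, f (z + τ • u) - f z ≤ τ * (ξ u + η) := by
  obtain ⟨ξ, hξ⟩ := h
  have hsub : ∀ v, ξ v ≤ f (z + v) - f z := by
    intro v
    refine le_of_tendsto ((hξ v).mono_left (nhdsGT_le_nhdsNE (0:ℝ))) ?_
    filter_upwards [Ioc_mem_nhdsGT (show (0:ℝ) < 1 by norm_num)] with t ht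
    rw [div_le_iff₀ ht.1]
    have := wa_cvx_line hf z v ht.1.le ht.2 one_pos
    rw [one_smul, one_mul] at this
    linarith
  have hb : ∀ v, ξ v ≤ L * ‖v‖ := by
    intro v
    refine (hsub v).trans ((hL _ _).trans ?_)
    rw [add_sub_cancel_left]
  refine ⟨ξ, fun v => ?_, hsub, fun u η hη => ?_⟩
  · rw [abs_le]
    have := hb (-v)
    rw [map_neg, norm_neg] at this
    exact ⟨by linarith, hb v⟩
  · have h3 := (hξ u).mono_left (nhdsGT_le_nhdsNE (0:ℝ))
    have h4 := (h3.eventually (gt_mem_nhds (lt_add_of_pos_right (ξ u) hη))).and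
      self_mem_nhdsWithin
    obtain ⟨τ, h5, h6⟩ := h4.exists
    have h6 : 0 < τ := h6
    refine ⟨τ, h6, ?_⟩
    rw [div_lt_iff₀ h6] at h5
    linarith

section
variable {X : Type*} [NormedAddCommGroup X] [NormedSpace ℝ X] {f : X → ℝ}
  {D : Set X} {ξ : X → X →L[ℝ] ℝ}

theorem wa_lemC (hL : WaLip 1 f)
    (hsub : ∀ z ∈ D, ∀ v, ξ z v ≤ f (z + v) - f z)
    (hder : ∀ z ∈ D, ∀ u η, 0 < η → ∃ τ > 0, f (z + τ • u) - f z ≤ τ * (ξ z u + η))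
    {z : X} (hz : z ∈ D) (u : X) {η : ℝ} (hη : 0 < η) :
    ∃ ρ > 0, ∀ z' ∈ D, ‖z' - z‖ ≤ ρ → |ξ z' u - ξ z u| ≤ η := by
  have key : ∀ u : X, ∃ ρ > 0, ∀ z' ∈ D, ‖z' - z‖ ≤ ρ → ξ z' u ≤ ξ z u + η := by
    intro u
    obtain ⟨τ, hτ, h⟩ := hder z hz u (η/2) (by positivity)
    refine ⟨τ * η / 4, by positivity, fun z' hz' hd => ?_⟩
    have h1 := hsub z' hz' (τ • u)
    rw [map_smul, smul_eq_mul] at h1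
    have h2 := hL (z' + τ • u) (z + τ • u)
    have h3 := hL z z'
    rw [add_sub_add_right_eq_sub] at h2
    rw [norm_sub_rev] at h3
    have : τ * ξ z' u ≤ τ * (ξ z u + η) := by linarith
    exact le_of_mul_le_mul_left this hτ
  obtain ⟨a, ha, h1⟩ := key u
  obtain ⟨b, hb, h2⟩ := key (-u)
  refine ⟨min a b, lt_min ha hb, fun z' hz' hd => ?_⟩
  have h3 := h1 z' hz' (hd.trans (min_le_left _ _))
  have h4 := h2 z' hz' (hd.trans (min_le_right _ _))
  rw [map_neg, map_neg] at h4
  rw [abs_le]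
  constructor <;> linarith

theorem wa_lemC_fin (hL : WaLip 1 f)
    (hsub : ∀ z ∈ D, ∀ v, ξ z v ≤ f (z + v) - f z)
    (hder : ∀ z ∈ D, ∀ u η, 0 < η → ∃ τ > 0, f (z + τ • u) - f z ≤ τ * (ξ z u + η))
    {z : X} (hz : z ∈ D) (u : ℕ → X) {η : ℝ} (hη : 0 < η) (n : ℕ) :
    ∃ ρ > 0, ∀ z' ∈ D, ‖z' - z‖ ≤ ρ → ∀ j ≤ n, |ξ z' (u j) - ξ z (u j)| ≤ η := by
  induction n with
  | zero =>
    obtain ⟨ρ, hρ, h⟩ := wa_lemC hL hsub hder hz (u 0) hη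
    refine ⟨ρ, hρ, fun z' hz' hd j hj => ?_⟩
    obtain rfl : j = 0 := by omega
    exact h z' hz' hd
  | succ n ih =>
    obtain ⟨ρ, hρ, h⟩ := wa_lemC hL hsub hder hz (u (n+1)) hη
    obtain ⟨ρ', hρ', h'⟩ := ih
    refine ⟨min ρ ρ', lt_min hρ hρ', fun z' hz' hd j hj => ?_⟩
    rcases Nat.lt_or_ge n j with hj' | hj'
    · obtain rfl : j = n+1 := by omega
      exact h z' hz' (hd.trans (min_le_left _ _))
    · exact h' z' hz' (hd.trans (min_le_right _ _)) j hj'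

theorem wa_lemR0 (hL : WaLip 1 f) (hD : Dense D)
    (hb : ∀ z ∈ D, ∀ v, |ξ z v| ≤ ‖v‖)
    (hsub : ∀ z ∈ D, ∀ v, ξ z v ≤ f (z + v) - f z) {ε0 : ℝ} (hε0 : 0 < ε0) {z : X}
    (hrough : ∀ δ > 0, ∃ v, ‖v‖ ≤ δ ∧ ε0 * δ < f (z + v) + f (z - v) - 2 * f z)
    {δ : ℝ} (hδ : 0 < δ) :
    ∃ z' ∈ D, ‖z' - z‖ ≤ 2 * δ ∧ ∃ u, ‖u‖ ≤ 1 ∧ ε0 / 4 ≤ ξ z' u - ξ z u := by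
  obtain ⟨w, hw, h⟩ : ∃ w, ‖w‖ ≤ δ ∧ ε0 * δ / 2 < f (z + w) - f z - ξ z w := by
    obtain ⟨v, hv, h⟩ := hrough δ hδ
    by_cases h1 : ε0 * δ / 2 < f (z + v) - f z - ξ z v
    · exact ⟨v, hv, h1⟩
    · refine ⟨-v, by rwa [norm_neg], ?_⟩
      rw [map_neg, ← sub_eq_add_neg]
      linarith
  have hκ : 0 < min (ε0 * δ / 8) δ := by positivity
  obtain ⟨z', hz', hd⟩ := hD.exists_dist_lt (z + w) hκ
  rw [dist_eq_norm] at hd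
  have hd1 := hd.le.trans (min_le_left _ _)
  have hd2 := hd.le.trans (min_le_right _ _)
  refine ⟨z', hz', ?_, δ⁻¹ • w, ?_, ?_⟩
  · have : z' - z = w - (z + w - z') := by abel
    rw [this]
    refine (norm_sub_le _ _).trans (by linarith)
  · rw [norm_smul, norm_inv, Real.norm_of_nonneg hδ.le, inv_mul_le_iff₀ hδ]
    simpa using hw
  · have h1 := hsub z' hz' (z - z')
    rw [add_sub_cancel] at h1
    have h2 := hL (z + w) z'
    have h3 := hb z' hz' (z + w - z')
    rw [abs_le] at h3
    have h4 : ξ z' (z + w - z') = ξ z' w + ξ z' (z - z') := by rw [← map_add]; congr 1; abel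
    rw [map_smul, map_smul, smul_eq_mul, smul_eq_mul, ← mul_sub, ← div_eq_inv_mul,
      le_div_iff₀ hδ]
    linarith [h3.1]

theorem wa_lemR (hL : WaLip 1 f) (hD : Dense D)
    (hb : ∀ z ∈ D, ∀ v, |ξ z v| ≤ ‖v‖)
    (hsub : ∀ z ∈ D, ∀ v, ξ z v ≤ f (z + v) - f z)
    (hder : ∀ z ∈ D, ∀ u η, 0 < η → ∃ τ > 0, f (z + τ • u) - f z ≤ τ * (ξ z u + η))
    {ε0 : ℝ} (hε0 : 0 < ε0) {z : X} (hz : z ∈ D)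
    (hrough : ∀ δ > 0, ∃ v, ‖v‖ ≤ δ ∧ ε0 * δ < f (z + v) + f (z - v) - 2 * f z)
    (n : ℕ) (g : ℕ → X →L[ℝ] ℝ) {ρ η : ℝ} (hρ : 0 < ρ) (hη : 0 < η) :
    ∃ z' ∈ D, ‖z' - z‖ ≤ ρ ∧ ∃ e, ‖e‖ ≤ 1 ∧ ε0 / 16 ≤ ξ z' e - ξ z e ∧ ∀ j ≤ n, |g j e| ≤ η := by
  have h0 := fun k : ℕ => wa_lemR0 hL hD hb hsub hε0 hrough (δ := ρ / 2 * (1/2)^k) (by positivity)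
  choose zz hzz hd u hu hinc using h0
  let G : ℕ → Fin (n+1) → ℝ := fun k i => g i (u k)
  have hbd : Bornology.IsBounded (Set.range G) := by
    rw [Bornology.forall_isBounded_image_eval_iff.symm]
    intro i
    refine (Metric.isBounded_closedBall (x := (0:ℝ)) (r := ‖g i‖)).subset ?_
    rintro _ ⟨_, ⟨k, rfl⟩, rfl⟩
    rw [mem_closedBall_zero_iff]
    refine ((g i).le_opNorm (u k)).trans ?_
    exact mul_le_of_le_one_right (norm_nonneg _) (hu k)
  obtain ⟨A, _, ψ, hψ, hA⟩ := tendsto_subseq_of_bounded hbd (fun k => Set.mem_range_self k)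
  have hcau := hA.cauchySeq
  obtain ⟨N, hN⟩ := Metric.cauchySeq_iff.1 hcau (2 * η) (by positivity)
  obtain ⟨ρ', hρ', hC⟩ := wa_lemC hL hsub hder hz (u (ψ N)) (η := ε0 / 8) (by positivity)
  have hlim : Tendsto (fun M : ℕ => 2 * (ρ / 2 * (1/2 : ℝ)^(ψ M))) atTop (𝓝 0) := by
    have := (tendsto_pow_atTop_nhds_zero_of_lt_one (r := (1/2 : ℝ)) (by norm_num)
      (by norm_num)).comp hψ.tendsto_atTop
    have := (this.const_mul (ρ / 2)).const_mul 2
    simpa using this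
  obtain ⟨M, hM1, hM2⟩ := ((hlim.eventually (gt_mem_nhds hρ')).and (eventually_ge_atTop N)).exists
  refine ⟨zz (ψ M), hzz _, (hd _).trans ?_, (1/2 : ℝ) • (u (ψ M) - u (ψ N)), ?_, ?_, ?_⟩
  · have : (1/2 : ℝ)^(ψ M) ≤ 1 := pow_le_one₀ (by norm_num) (by norm_num)
    nlinarith
  · rw [norm_smul]
    have := norm_sub_le (u (ψ M)) (u (ψ N))
    have h1 := hu (ψ M)
    have h2 := hu (ψ N)
    norm_num
    linarith
  · have h1 := hC _ (hzz (ψ M)) ((hd _).trans hM1.le)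
    have h2 := hinc (ψ M)
    rw [abs_le] at h1
    simp only [map_smul, map_sub, smul_eq_mul]
    linarith [h1.2]
  · intro j hj
    have h1 := hN M hM2 N le_rfl
    rw [dist_pi_lt_iff (by positivity)] at h1
    have h2 := h1 ⟨j, by omega⟩
    simp only [Function.comp, G, Real.dist_eq] at h2
    rw [map_smul, map_sub, smul_eq_mul, abs_mul, abs_of_pos (by norm_num : (0:ℝ) < 1/2)]
    linarith

end

def waPar (n : ℕ) : ℕ := (Nat.unpair n).1

theorem waPar_le (n : ℕ) : waPar n ≤ n := Nat.unpair_left_le n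

inductive WaDesc (i : ℕ) : ℕ → Prop
  | refl : WaDesc i i
  | step (n : ℕ) : WaDesc i (waPar n) → WaDesc i (n + 1)

theorem WaDesc.le {i j : ℕ} (h : WaDesc i j) : i ≤ j := by
  induction h with
  | refl => exact le_rfl
  | step n _ ih => have := waPar_le n; omega

theorem WaDesc.trans {i j k : ℕ} (h : WaDesc i j) (h' : WaDesc j k) : WaDesc i k := by
  induction h' with
  | refl => exact h
  | step n _ ih => exact WaDesc.step n ih

theorem WaDesc.zero (j : ℕ) : WaDesc 0 j := by
  induction j using Nat.strong_induction_on with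
  | _ j ih =>
    cases j with
    | zero => exact WaDesc.refl
    | succ j => exact WaDesc.step j (ih _ (by have := waPar_le j; omega))

theorem wa_half_par (m : ℕ) : 2 * (1/2 : ℝ)^(m+1) ≤ (1/2 : ℝ)^(waPar m) := by
  have : (1/2 : ℝ)^m ≤ (1/2 : ℝ)^(waPar m) :=
    pow_le_pow_of_le_one (by norm_num) (by norm_num) (waPar_le m)
  rw [pow_succ]; linarith

theorem wa_desc_sum {c : ℝ} (hc : 0 ≤ c) (q : ℕ → ℕ → ℝ) (i : ℕ) (hr : q i i ≤ 0)
    (hs : ∀ m, i ≤ m → q i (m+1) ≤ q i (waPar m) + c * (1/2)^(m+1)) {j : ℕ} (h : WaDesc i j) :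
    q i j ≤ c * ((1/2)^i - (1/2)^j) := by
  induction h with
  | refl => simpa using hr
  | step m hm ih =>
    have h1 := hs m (hm.le.trans (waPar_le m))
    have h2 := mul_le_mul_of_nonneg_left (wa_half_par m) hc
    linarith

theorem wa_tree {X : Type*} [NormedAddCommGroup X] [NormedSpace ℝ X] {f : X → ℝ}
    {D : Set X} {ξ : X → X →L[ℝ] ℝ} (hL : WaLip 1 f) (hD : Dense D)
    (hb : ∀ z ∈ D, ∀ v, |ξ z v| ≤ ‖v‖)
    (hsub : ∀ z ∈ D, ∀ v, ξ z v ≤ f (z + v) - f z)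
    (hder : ∀ z ∈ D, ∀ u η, 0 < η → ∃ τ > 0, f (z + τ • u) - f z ≤ τ * (ξ z u + η))
    {ε0 : ℝ} (hε0 : 0 < ε0) {x0 : X} {r0 : ℝ} (hr0 : 0 < r0)
    (hrough : ∀ z ∈ Metric.ball x0 r0, ∀ δ > 0, ∃ v, ‖v‖ ≤ δ ∧
      ε0 * δ < f (z + v) + f (z - v) - 2 * f z) :
    ∃ (a : ℝ) (ζ : ℕ → X →L[ℝ] ℝ) (e : ℕ → X), 0 < a ∧ (∀ n v, |ζ n v| ≤ ‖v‖) ∧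
      (∀ n, ‖e n‖ ≤ 1) ∧ (∀ n, a ≤ ζ (n+1) (e (n+1))) ∧
      (∀ n j, WaDesc n j → |ζ j (e n) - ζ n (e n)| ≤ (1/2)^n) ∧
      (∀ n j, ¬ WaDesc (n+1) j → |ζ j (e (n+1))| ≤ a / 8) ∧
      (∀ x i η, 0 < η → ∃ N, ∀ n ≥ N, waPar n = i → ∀ j, WaDesc (n+1) j →
        |ζ j x - ζ i x| ≤ η) := by
  set a := ε0 / 32 with ha
  have ha0 : 0 < a := by positivity
  obtain ⟨z0, hz0⟩ := hD.inter_open_nonempty _ Metric.isOpen_ball ⟨x0, Metric.mem_ball_self hr0⟩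
  obtain ⟨g, -, hg, hQ⟩ := wa_exists_seq (α := X × X)
    (fun y => y.1 ∈ D ∧ y.1 ∈ Metric.ball x0 r0 ∧ ‖y.2‖ ≤ 1)
    (fun n g y => ‖y.1 - (g (waPar n)).1‖ ≤ (1/2)^(n+1) ∧
      (∀ j ≤ n, |ξ y.1 (g j).2 - ξ (g (waPar n)).1 (g j).2| ≤ a / 16 * (1/2)^(n+1)) ∧
      a ≤ ξ y.1 y.2 ∧ ∀ j ≤ n, |ξ (g j).1 y.2| ≤ a / 16)
    (z0, 0) ⟨hz0.2, hz0.1, by simp⟩ (by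
      intro n g hg
      obtain ⟨hz, hzB, -⟩ := hg (waPar n) (waPar_le n)
      obtain ⟨ρ1, hρ1, h1⟩ := wa_lemC_fin hL hsub hder hz (fun j => (g j).2)
        (η := a / 16 * (1/2)^(n+1)) (by positivity) n
      obtain ⟨ρ2, hρ2, h2⟩ := Metric.isOpen_iff.1 Metric.isOpen_ball _ hzB
      obtain ⟨z', hz', hd, e, he, hinc, hsm⟩ := wa_lemR hL hD hb hsub hder hε0 hz
        (hrough _ hzB) n (fun j => ξ (g j).1) (ρ := min ((1/2)^(n+1)) (min ρ1 (ρ2/2)))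
        (η := a / 16) (by positivity) (by positivity)
      have hd1 := hd.trans (min_le_left _ _)
      have hd2 := (hd.trans (min_le_right _ _)).trans (min_le_left _ _)
      have hd3 := (hd.trans (min_le_right _ _)).trans (min_le_right _ _)
      refine ⟨(z', e), ⟨hz', h2 ?_, he⟩, hd1, h1 z' hz' hd2, ?_, hsm⟩
      · rw [Metric.mem_ball, dist_eq_norm]; simp only; linarith
      · have := hsm (waPar n) (waPar_le n)
        rw [abs_le] at this
        simp only at this ⊢
        linarith [this.1]) (by
      intro n g g' y h h'
      rw [← h _ (waPar_le n)]
      refine ⟨h'.1, fun j hj => ?_, h'.2.2.1, fun j hj => ?_⟩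
      · rw [← h j hj]; exact h'.2.1 j hj
      · rw [← h j hj]; exact h'.2.2.2 j hj)
  have ha1 : a ≤ 1 := by
    have h1 := (hQ 0).2.2.1
    have h2 := hb _ (hg 1).1 (g 1).2
    have h3 := (hg 1).2.2
    exact h1.trans ((le_abs_self _).trans (h2.trans h3))
  refine ⟨a, fun n => ξ (g n).1, fun n => (g n).2, ha0, fun n v => hb _ (hg n).1 v,
    fun n => (hg n).2.2, fun n => (hQ n).2.2.1, ?_, ?_, ?_⟩
  · intro n j h
    have := wa_desc_sum (c := a/16) (by positivity)
      (fun i j => |ξ (g j).1 (g i).2 - ξ (g i).1 (g i).2|) n (by simp) (by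
        intro m hm
        have h1 := (hQ m).2.1 n hm
        have h2 := abs_sub_le (ξ (g (m+1)).1 (g n).2) (ξ (g (waPar m)).1 (g n).2)
          (ξ (g n).1 (g n).2)
        linarith) h
    have h3 : (0:ℝ) < (1/2)^n := by positivity
    have h4 : (0:ℝ) < (1/2)^j := by positivity
    nlinarith
  · intro n j
    suffices h : ¬ WaDesc (n+1) j → |ξ (g j).1 (g (n+1)).2| ≤ a / 16 + a / 16 * (1 - (1/2)^j) by
      intro h'
      have := h h'
      have h4 : (0:ℝ) < (1/2)^j := by positivity
      simp only
      nlinarith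
    induction j using Nat.strong_induction_on with
    | _ j ih =>
      intro h
      rcases Nat.lt_or_ge n j with hj | hj
      · obtain ⟨m, rfl⟩ : ∃ m, j = m + 1 := ⟨j - 1, by omega⟩
        have hmn : n + 1 ≤ m := by
          rcases Nat.lt_or_ge n m with h1 | h1
          · exact h1
          · obtain rfl : n = m := by omega
            exact absurd WaDesc.refl h
        have h1 := ih (waPar m) (by have := waPar_le m; omega) fun h' => h (WaDesc.step m h')
        have h2 := (hQ m).2.1 (n+1) hmn
        have h3 := abs_sub_abs_le_abs_sub (ξ (g (m+1)).1 (g (n+1)).2)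
          (ξ (g (waPar m)).1 (g (n+1)).2)
        have h4 := mul_le_mul_of_nonneg_left (wa_half_par m) (show 0 ≤ a / 16 by positivity)
        linarith
      · have h1 := (hQ n).2.2.2 j hj
        have h4 : (1/2 : ℝ)^j ≤ 1 := pow_le_one₀ (by norm_num) (by norm_num)
        nlinarith
  · intro x i η hη
    obtain ⟨ρ, hρ, h⟩ := wa_lemC hL hsub hder (hg i).1 x hη
    obtain ⟨N, hN⟩ := exists_pow_lt_of_lt_one hρ (show (1/2 : ℝ) < 1 by norm_num)
    refine ⟨N, fun n hn hp j hj => h _ (hg j).1 ?_⟩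
    have h1 := wa_desc_sum (c := 1) zero_le_one
      (fun i j => ‖(g j).1 - (g i).1‖) (n+1) (by simp) (by
        intro m hm
        have h1 := (hQ m).1
        have h2 := norm_sub_le_norm_sub_add_norm_sub (g (m+1)).1 (g (waPar m)).1 (g (n+1)).1
        linarith) hj
    have h2 := (hQ n).1
    rw [hp] at h2
    have h3 := norm_sub_le_norm_sub_add_norm_sub (g j).1 (g (n+1)).1 (g i).1
    have h4 : (0:ℝ) < (1/2)^j := by positivity
    have h5 : (1/2 : ℝ)^n ≤ (1/2)^N := pow_le_pow_of_le_one (by norm_num) (by norm_num) hn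
    rw [pow_succ] at h2
    simp only [pow_succ] at h1
    linarith


theorem wa_labels {X Y : Type*} [NormedAddCommGroup X] [NormedSpace ℝ X]
    [NormedAddCommGroup Y] (D : ℕ → Y) (e : ℕ → X) (he : ∀ n, ‖e n‖ ≤ 1)
    (a : ℝ) {B0 : ℝ} (hB0 : 0 < B0) :
    ∃ (β d : ℕ → ℝ) (b : ℕ → X) (s : ℕ → Y), β 0 = B0 ∧ d 0 = 0 ∧ b 0 = 0 ∧ s 0 = 0 ∧
      (∀ n, 0 < β n) ∧
      (∀ n, ∃ τ, 0 < τ ∧ τ ≤ β (waPar n) ∧ 2 * β (n+1) ≤ τ ∧ ‖b (n+1) - b (waPar n)‖ ≤ τ ∧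
        ‖s (n+1) - s (waPar n)‖ ≤ τ ∧ d (n+1) = d (waPar n) + τ * (a / 2)) ∧
      (∀ i k l m N0, ∃ n ≥ N0, waPar n = i ∧ b (n+1) = b i + (β i * (1/2)^k) • e (n+1) ∧
        ‖s (n+1) - s i‖ ≤ β i * (1/2)^k ∧
        (‖D m‖ ≤ β i * (1/2)^k → s (n+1) = s i + D m) ∧
        d (n+1) = d i + β i * (1/2)^k * (a / 2) ∧
        β (n+1) = β i * (1/2)^k * (1/2)^(l+1)) := by
  classical
  let kk : ℕ → ℕ := fun n => (Nat.unpair (Nat.unpair (Nat.unpair n).2).1).1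
  let ll : ℕ → ℕ := fun n => (Nat.unpair (Nat.unpair (Nat.unpair (Nat.unpair n).2).1).2).1
  let mm : ℕ → ℕ := fun n => (Nat.unpair (Nat.unpair (Nat.unpair (Nat.unpair n).2).1).2).2
  let T : ℕ → ℝ → ℝ := fun n β => β * (1/2)^(kk n)
  let sg : ℕ → ℝ → Y := fun n β => if ‖D (mm n)‖ ≤ T n β then D (mm n) else 0
  let nx : ℕ → (ℝ × ℝ) × (X × Y) → (ℝ × ℝ) × (X × Y) := fun n y =>
    ((T n y.1.1 * (1/2)^(ll n + 1), y.1.2 + T n y.1.1 * (a/2)),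
      (y.2.1 + T n y.1.1 • e (n+1), y.2.2 + sg n y.1.1))
  obtain ⟨g, hg0, hg, hQ⟩ := wa_exists_seq (α := (ℝ × ℝ) × (X × Y)) (fun y => 0 < y.1.1)
    (fun n g y => y = nx n (g (waPar n))) ((B0, 0), (0, 0)) hB0 (by
      intro n g hg
      refine ⟨_, ?_, rfl⟩
      have := hg (waPar n) (waPar_le n)
      simp only [nx, T]
      positivity) (by
      intro n g g' y h h'
      rw [← h _ (waPar_le n)]; exact h')
  have hT : ∀ n, 0 < T n (g (waPar n)).1.1 := fun n => mul_pos (hg _) (by positivity)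
  have hsg : ∀ n, ‖sg n (g (waPar n)).1.1‖ ≤ T n (g (waPar n)).1.1 := by
    intro n
    simp only [sg]
    split_ifs with h
    · exact h
    · rw [norm_zero]; exact (hT n).le
  refine ⟨fun n => (g n).1.1, fun n => (g n).1.2, fun n => (g n).2.1, fun n => (g n).2.2,
    by simp only [hg0], by simp only [hg0], by simp only [hg0], by simp only [hg0], hg, fun n => ?_, ?_⟩
  · refine ⟨T n (g (waPar n)).1.1, hT n, ?_, ?_, ?_, ?_, ?_⟩
    · exact mul_le_of_le_one_right (hg _).le (pow_le_one₀ (by norm_num) (by norm_num))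
    · simp only [hQ n, nx]
      have : (1/2 : ℝ)^(ll n) ≤ 1 := pow_le_one₀ (by norm_num) (by norm_num)
      rw [pow_succ]
      nlinarith [hT n]
    · simp only [hQ n, nx]
      rw [add_sub_cancel_left, norm_smul, Real.norm_of_nonneg (hT n).le]
      exact mul_le_of_le_one_right (hT n).le (he _)
    · simp only [hQ n, nx]
      rw [add_sub_cancel_left]
      exact hsg n
    · simp only [hQ n, nx]
  · intro i k l m N0
    let n := Nat.pair i (Nat.pair (Nat.pair k (Nat.pair l m)) N0)
    have hp : waPar n = i := by simp [waPar, n]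
    have hk : kk n = k := by simp [kk, n]
    have hl : ll n = l := by simp [ll, n]
    have hm : mm n = m := by simp [mm, n]
    refine ⟨n, ?_, hp, ?_, ?_, ?_, ?_, ?_⟩
    · exact (Nat.right_le_pair _ _).trans (Nat.right_le_pair _ _)
    · simp only [hQ n, nx, T, hp, hk]
    · simp only [hQ n, nx]
      rw [hp, add_sub_cancel_left]
      have := hsg n
      simpa only [T, hk, hp] using this
    · intro h
      simp only [hQ n, nx, sg, T, hp, hk, hm]
      rw [if_pos h]
    · simp only [hQ n, nx, T, hp, hk]
    · simp only [hQ n, nx, T, hp, hk, hl]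

structure WaSys {X Y : Type*} [NormedAddCommGroup X] [NormedSpace ℝ X]
    [NormedAddCommGroup Y] [NormedSpace ℝ Y] (φ : X × Y → ℝ) (D : ℕ → Y) where
  L : ℝ
  a : ℝ
  ζ : ℕ → X →L[ℝ] ℝ
  e : ℕ → X
  β : ℕ → ℝ
  d : ℕ → ℝ
  b : ℕ → X
  s : ℕ → Y
  hL : 0 < L
  ha : 0 < a
  hφ : ConvexOn ℝ Set.univ φ
  hl : ∀ x x' t t', φ (x, t) - φ (x', t') ≤ L * (‖x - x'‖ + ‖t - t'‖)
  hζ : ∀ n v, |ζ n v| ≤ ‖v‖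
  he : ∀ n, ‖e n‖ ≤ 1
  hinc : ∀ n, a ≤ ζ (n+1) (e (n+1))
  hdesc : ∀ n j, WaDesc n j → |ζ j (e n) - ζ n (e n)| ≤ (1/2)^n
  hnon : ∀ n j, ¬ WaDesc (n+1) j → |ζ j (e (n+1))| ≤ a / 8
  hlim : ∀ x i η, 0 < η → ∃ N, ∀ n ≥ N, waPar n = i → ∀ j, WaDesc (n+1) j →
        |ζ j x - ζ i x| ≤ η
  d0 : d 0 = 0
  b0 : b 0 = 0
  s0 : s 0 = 0
  hβ : ∀ n, 0 < β n
  hpar : ∀ n, ∃ τ, 0 < τ ∧ τ ≤ β (waPar n) ∧ 2 * β (n+1) ≤ τ ∧ ‖b (n+1) - b (waPar n)‖ ≤ τ ∧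
        ‖s (n+1) - s (waPar n)‖ ≤ τ ∧ d (n+1) = d (waPar n) + τ * (a / 2)
  hchild : ∀ i k l m N0, ∃ n ≥ N0, waPar n = i ∧ b (n+1) = b i + (β i * (1/2)^k) • e (n+1) ∧
        ‖s (n+1) - s i‖ ≤ β i * (1/2)^k ∧
        (‖D m‖ ≤ β i * (1/2)^k → s (n+1) = s i + D m) ∧
        d (n+1) = d i + β i * (1/2)^k * (a / 2) ∧
        β (n+1) = β i * (1/2)^k * (1/2)^(l+1)

namespace WaSys
variable {X Y : Type*} [NormedAddCommGroup X] [NormedSpace ℝ X]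
    [NormedAddCommGroup Y] [NormedSpace ℝ Y] {φ : X × Y → ℝ} {D : ℕ → Y} (S : WaSys φ D)

noncomputable def C : ℝ := 16 * S.L / S.a

noncomputable def G (j : ℕ) (x : X) : ℝ := φ (x - S.b j, S.s j) + S.C * (S.ζ j x - S.d j)

noncomputable def F (x : X) : ℝ := ⨆ j, S.G j x

theorem C_pos : 0 < S.C := by
  have := S.hL; have := S.ha; unfold C; positivity

theorem C_a : S.C * S.a = 16 * S.L := by
  have := S.ha; unfold C; field_simp

theorem desc_bd {i j : ℕ} (h : WaDesc i j) :
    ‖S.b j - S.b i‖ ≤ 2 * (S.β i - S.β j) ∧ ‖S.s j - S.s i‖ ≤ 2 * (S.β i - S.β j) := by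
  induction h with
  | refl => simp
  | step m _ ih =>
    obtain ⟨τ, h1, h2, h3, h4, h5, h6⟩ := S.hpar m
    have a1 := norm_sub_le_norm_sub_add_norm_sub (S.b (m+1)) (S.b (waPar m)) (S.b i)
    have a2 := norm_sub_le_norm_sub_add_norm_sub (S.s (m+1)) (S.s (waPar m)) (S.s i)
    constructor <;> linarith [ih.1, ih.2]

theorem desc_first {i j : ℕ} (h : WaDesc i j) : j = i ∨ ∃ τ, 0 < τ ∧ τ ≤ S.β i ∧
    ‖S.b j - S.b i‖ ≤ 2 * τ - 2 * S.β j ∧ ‖S.s j - S.s i‖ ≤ 2 * τ - 2 * S.β j ∧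
    S.d i + τ * (S.a / 2) ≤ S.d j := by
  induction h with
  | refl => exact Or.inl rfl
  | step m _ ih =>
    right
    obtain ⟨τ, h1, h2, h3, h4, h5, h6⟩ := S.hpar m
    rcases ih with ih | ⟨τ', g1, g2, g3, g4, g5⟩
    · rw [ih] at h2 h4 h5 h6
      exact ⟨τ, h1, h2, by linarith, by linarith, h6.ge⟩
    · refine ⟨τ', g1, g2, ?_, ?_, ?_⟩
      · have a1 := norm_sub_le_norm_sub_add_norm_sub (S.b (m+1)) (S.b (waPar m)) (S.b i)
        linarith
      · have a2 := norm_sub_le_norm_sub_add_norm_sub (S.s (m+1)) (S.s (waPar m)) (S.s i)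
        linarith
      · have := mul_pos h1 (half_pos S.ha)
        linarith

theorem d_nonneg (j : ℕ) : 0 ≤ S.d j := by
  rcases S.desc_first (WaDesc.zero j) with h | ⟨τ, h1, -, -, -, h5⟩
  · rw [h, S.d0]
  · rw [S.d0] at h5
    have := mul_pos h1 (half_pos S.ha)
    linarith

theorem G_lip (j : ℕ) : WaLip (S.L + S.C) (S.G j) := by
  intro x x'
  unfold G
  have h1 := S.hl (x - S.b j) (x' - S.b j) (S.s j) (S.s j)
  rw [sub_sub_sub_cancel_right, sub_self, norm_zero, add_zero] at h1
  have h2 := S.hζ j (x - x')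
  rw [map_sub] at h2
  have h3 := mul_le_mul_of_nonneg_left ((le_abs_self _).trans h2) S.C_pos.le
  linarith

theorem G_bdd (x : X) : BddAbove (Set.range fun j => S.G j x) := by
  refine ⟨φ (0, 0) + S.L * (‖x‖ + 2 * S.β 0 + 2 * S.β 0) + S.C * ‖x‖, ?_⟩
  rintro _ ⟨j, rfl⟩
  simp only [G]
  obtain ⟨h1, h2⟩ := S.desc_bd (WaDesc.zero j)
  rw [S.b0, sub_zero] at h1
  rw [S.s0, sub_zero] at h2
  have hβ := S.hβ j
  have h3 := S.hl (x - S.b j) 0 (S.s j) 0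
  rw [sub_zero, sub_zero] at h3
  have h4 := norm_sub_le x (S.b j)
  have h5 := (le_abs_self _).trans (S.hζ j x)
  have h6 := S.d_nonneg j
  have h7 : S.C * (S.ζ j x - S.d j) ≤ S.C * ‖x‖ :=
    mul_le_mul_of_nonneg_left (by linarith) S.C_pos.le
  have h8 : S.L * (‖x - S.b j‖ + ‖S.s j‖) ≤ S.L * (‖x‖ + 2 * S.β 0 + 2 * S.β 0) :=
    mul_le_mul_of_nonneg_left (by linarith) S.hL.le
  linarith

theorem G_le_F (j : ℕ) (x : X) : S.G j x ≤ S.F x := le_ciSup (S.G_bdd x) j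

theorem exists_near (x : X) {κ : ℝ} (hκ : 0 < κ) : ∃ j, S.F x - κ < S.G j x :=
  exists_lt_of_lt_ciSup (sub_lt_self (S.F x) hκ)

theorem F_lip : WaLip (S.L + S.C) S.F := by
  intro x x'
  rw [sub_le_iff_le_add']
  refine ciSup_le fun j => ?_
  have h1 := S.G_lip j x x'
  have h2 := S.G_le_F j x'
  linarith

theorem G_cvx (j : ℕ) : ConvexOn ℝ Set.univ (S.G j) := by
  refine ⟨convex_univ, fun x _ y _ α γ hα hγ hab => ?_⟩
  have h1 := S.hφ.2 (Set.mem_univ (x - S.b j, S.s j)) (Set.mem_univ (y - S.b j, S.s j)) hα hγ hab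
  have e : α • ((x - S.b j, S.s j) : X × Y) + γ • (y - S.b j, S.s j) =
      (α • x + γ • y - S.b j, S.s j) := by
    ext
    · have : S.b j = α • S.b j + γ • S.b j := by rw [← add_smul, hab, one_smul]
      simp only [Prod.smul_mk, Prod.mk_add_mk, smul_sub]
      conv_rhs => rw [this]
      abel
    · simp [← add_smul, hab]
  rw [e] at h1
  unfold G
  simp only [smul_eq_mul, map_add, map_smul] at h1 ⊢
  have h2 : S.C * S.d j = α * (S.C * S.d j) + γ * (S.C * S.d j) := by rw [← add_mul, hab, one_mul]
  nlinarith

theorem F_cvx : ConvexOn ℝ Set.univ S.F := by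
  refine ⟨convex_univ, fun x _ y _ α γ hα hγ hab => ?_⟩
  refine ciSup_le fun j => ?_
  have h1 := (S.G_cvx j).2 (Set.mem_univ x) (Set.mem_univ y) hα hγ hab
  have h2 := mul_le_mul_of_nonneg_left (S.G_le_F j x) hα
  have h3 := mul_le_mul_of_nonneg_left (S.G_le_F j y) hγ
  simp only [smul_eq_mul] at h1 ⊢
  linarith

theorem select {i : ℕ} {x : X} {κ h ε : ℝ} (hgap : ∀ j, S.G j x ≤ S.G i x + κ) (k l m : ℕ)
    (hh : 0 < h) (hτ : S.β i * (1/2)^k ≤ h) (hκ : κ ≤ S.L * h) (hε : 0 < ε) :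
    ∃ n, waPar n = i ∧ S.b (n+1) = S.b i + (S.β i * (1/2)^k) • S.e (n+1) ∧
      (‖D m‖ ≤ S.β i * (1/2)^k → S.s (n+1) = S.s i + D m) ∧
      S.β (n+1) = S.β i * (1/2)^k * (1/2)^(l+1) ∧
      (∀ j, ¬ WaDesc (n+1) j → S.G j (x + h • S.e (n+1)) ≤
        S.G (n+1) (x + h • S.e (n+1)) - 2 * S.L * h) ∧
      (∀ j, WaDesc (n+1) j → S.G j (x + h • S.e (n+1)) ≤ S.G (n+1) (x + h • S.e (n+1)) + ε) := by
  have hC := S.C_pos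
  have hL := S.hL
  have hCa := S.C_a
  set η := min (S.L * h / S.C) (ε / (4 * S.C)) with hηd
  have hη : 0 < η := by positivity
  have hη1 : S.C * η ≤ S.L * h := by
    have : η ≤ S.L * h / S.C := min_le_left _ _
    rw [le_div_iff₀ hC] at this; linarith
  have hη2 : S.C * η ≤ ε / 4 := by
    have : η ≤ ε / (4 * S.C) := min_le_right _ _
    rw [le_div_iff₀ (by positivity)] at this; linarith
  obtain ⟨N1, hN1⟩ := S.hlim x i η hη
  obtain ⟨N2, hN2⟩ := exists_pow_lt_of_lt_one (show 0 < ε / (2 * S.C * h) by positivity)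
    (show (1/2 : ℝ) < 1 by norm_num)
  obtain ⟨n, hn, hp, hb, hs, hsD, hd, hβ⟩ := S.hchild i k l m (max N1 N2)
  have hlimn := hN1 n ((le_max_left _ _).trans hn) hp
  have hpw : S.C * (h * (1/2)^(n+1)) ≤ ε / 2 := by
    have : (1/2 : ℝ)^(n+1) ≤ (1/2)^N2 :=
      pow_le_pow_of_le_one (by norm_num) (by norm_num) (by have := le_max_right N1 N2; omega)
    have := this.trans hN2.le
    rw [le_div_iff₀ (by positivity)] at this
    linarith
  refine ⟨n, hp, hb, hsD, hβ, ?_, ?_⟩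
  · intro j hj
    set τ := S.β i * (1/2)^k with hτd
    have hτ0 : 0 < τ := mul_pos (S.hβ i) (by positivity)
    have hlow : S.G i x + 7 * S.L * h - S.C * η ≤ S.G (n+1) (x + h • S.e (n+1)) := by
      unfold G
      have h1 := S.hl (x - S.b i) (x + h • S.e (n+1) - S.b (n+1)) (S.s i) (S.s (n+1))
      have e1 : x - S.b i - (x + h • S.e (n+1) - S.b (n+1)) = -((h - τ) • S.e (n+1)) := by
        rw [hb, sub_smul]; abel
      rw [e1, norm_neg, norm_smul, Real.norm_of_nonneg (by linarith), norm_sub_rev (S.s i)] at h1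
      have h2 : (h - τ) * ‖S.e (n+1)‖ ≤ h - τ :=
        mul_le_of_le_one_right (by linarith) (S.he _)
      have h3 : S.L * ((h - τ) * ‖S.e (n+1)‖ + ‖S.s (n+1) - S.s i‖) ≤ S.L * h :=
        mul_le_mul_of_nonneg_left (by linarith) hL.le
      have h4 := hlimn (n+1) WaDesc.refl
      rw [abs_le] at h4
      have h5 := mul_le_mul_of_nonneg_left (S.hinc n) hh.le
      have h6 : τ * (S.a / 2) ≤ h * (S.a / 2) :=
        mul_le_mul_of_nonneg_right hτ (half_pos S.ha).le
      have h7 : S.ζ i x - S.d i + h * (S.a / 2) - η ≤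
          S.ζ (n+1) (x + h • S.e (n+1)) - S.d (n+1) := by
        rw [map_add, map_smul, smul_eq_mul, hd]
        linarith [h4.1]
      have h8 := mul_le_mul_of_nonneg_left h7 hC.le
      have h9 : S.C * (h * (S.a / 2)) = 8 * S.L * h := by
        rw [show S.C * (h * (S.a / 2)) = S.C * S.a * h / 2 by ring, hCa]; ring
      linarith
    have hup : S.G j (x + h • S.e (n+1)) ≤ S.G j x + 3 * S.L * h := by
      unfold G
      have h1 := S.hl (x + h • S.e (n+1) - S.b j) (x - S.b j) (S.s j) (S.s j)
      rw [sub_sub_sub_cancel_right, add_sub_cancel_left, sub_self, norm_zero, add_zero, norm_smul,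
        Real.norm_of_nonneg hh.le] at h1
      have h2 : S.L * (h * ‖S.e (n+1)‖) ≤ S.L * h :=
        mul_le_mul_of_nonneg_left (mul_le_of_le_one_right hh.le (S.he _)) hL.le
      have h3 := (le_abs_self _).trans (S.hnon n j hj)
      have h4 : S.C * (h * S.ζ j (S.e (n+1))) ≤ S.C * (h * (S.a / 8)) :=
        mul_le_mul_of_nonneg_left (mul_le_mul_of_nonneg_left h3 hh.le) hC.le
      have h9 : S.C * (h * (S.a / 8)) = 2 * S.L * h := by
        rw [show S.C * (h * (S.a / 8)) = S.C * S.a * h / 8 by ring, hCa]; ring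
      rw [map_add, map_smul, smul_eq_mul]
      linarith
    have := hgap j
    linarith
  · intro j hj
    rcases S.desc_first hj with h0 | ⟨τ, h1, h2, h3, h4, h5⟩
    · rw [h0]; linarith
    · unfold G
      have g1 := S.hl (x + h • S.e (n+1) - S.b j) (x + h • S.e (n+1) - S.b (n+1)) (S.s j)
        (S.s (n+1))
      rw [sub_sub_sub_cancel_left, norm_sub_rev] at g1
      have hβj := S.hβ j
      have g2 : S.L * (‖S.b j - S.b (n+1)‖ + ‖S.s j - S.s (n+1)‖) ≤ S.L * (4 * τ) :=
        mul_le_mul_of_nonneg_left (by linarith) hL.le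
      have g3 := hlimn (n+1) WaDesc.refl
      have g4 := hlimn j hj
      have g5 := (le_abs_self _).trans (S.hdesc (n+1) j hj)
      rw [abs_le] at g3 g4
      have g6 := mul_le_mul_of_nonneg_left g5 hh.le
      have g7 : S.ζ j (x + h • S.e (n+1)) - S.d j ≤
          S.ζ (n+1) (x + h • S.e (n+1)) - S.d (n+1) + 2 * η + h * (1/2)^(n+1)
            - τ * (S.a / 2) := by
        simp only [map_add, map_smul, smul_eq_mul]
        linarith [g3.1, g4.2]
      have g8 := mul_le_mul_of_nonneg_left g7 hC.le
      have g9 : S.C * (τ * (S.a / 2)) = 8 * S.L * τ := by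
        rw [show S.C * (τ * (S.a / 2)) = S.C * S.a * τ / 2 by ring, hCa]; ring
      have g10 : 0 < S.L * τ := by positivity
      linarith

end WaSys


theorem wa_small_pow {c t : ℝ} (hc : 0 < c) (ht : 0 < t) : ∃ k : ℕ, c * (1/2)^k ≤ t := by
  obtain ⟨k, hk⟩ := exists_pow_lt_of_lt_one (show 0 < t / c by positivity)
    (show (1/2 : ℝ) < 1 by norm_num)
  refine ⟨k, ?_⟩
  rw [lt_div_iff₀ hc] at hk
  linarith

namespace WaSys
variable {X Y : Type*} [NormedAddCommGroup X] [NormedSpace ℝ X]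
    [NormedAddCommGroup Y] [NormedSpace ℝ Y] {φ : X × Y → ℝ} {D : ℕ → Y} (S : WaSys φ D)

noncomputable def om : ℝ := S.L / (4 * (S.L + S.C))

theorem om_pos : 0 < S.om := by
  have := S.hL; have := S.C_pos; unfold om; positivity

theorem om_eq : (S.L + S.C) * S.om = S.L / 4 := by
  have := S.hL; have := S.C_pos; unfold om; field_simp

theorem om_le : S.om ≤ 1/4 := by
  have h1 := S.hL; have h2 := S.C_pos; unfold om
  rw [div_le_div_iff₀ (by positivity) (by norm_num)]; linarith

theorem round (hD : DenseRange D) {n : ℕ} {xs : X}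
    (hst : ∀ j, S.G j xs ≤ S.G n xs + S.L / 2 * S.β n) {V : Set (X × Y)} (hV : IsOpen V)
    (hne : V.Nonempty) (hVW : V ⊆ Metric.ball (xs - S.b n, S.s n) (S.om * S.β n))
    {O : Set X} (hO : IsOpen O) (hOd : Dense O) {ε : ℝ} (hε : 0 < ε) :
    ∃ n' x', (∀ j, S.G j x' ≤ S.G n' x' + S.L / 2 * S.β n') ∧
      Metric.ball (x' - S.b n', S.s n') (S.om * S.β n') ⊆ V ∧
      Metric.closedBall x' (8 * S.β n') ⊆ O ∧
      Metric.closedBall x' (8 * S.β n') ⊆ Metric.closedBall xs (8 * S.β n) ∧ S.β n' ≤ ε := by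
  have hL := S.hL
  have hC := S.C_pos
  have hom := S.om_pos
  have homL := S.om_eq
  have hom4 := S.om_le
  have hβn := S.hβ n
  obtain ⟨⟨y, t⟩, hyt⟩ := hne
  obtain ⟨w, hw, hwV⟩ := Metric.isOpen_iff.1 hV _ hyt
  have hmem := hVW hyt
  rw [Metric.mem_ball, Prod.dist_eq, max_lt_iff, dist_eq_norm, dist_eq_norm] at hmem
  obtain ⟨hy, ht⟩ := hmem
  simp only at hy ht
  have hombn : S.om * S.β n ≤ S.β n / 4 := by nlinarith
  -- first selection
  have hxd : ‖(y + S.b n) - xs‖ ≤ S.om * S.β n := by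
    rw [show y + S.b n - xs = y - (xs - S.b n) by abel]; exact hy.le
  have hgap1 : ∀ j, S.G j (y + S.b n) ≤ S.G n (y + S.b n) + S.L * S.β n := by
    intro j
    have h1 := S.G_lip j (y + S.b n) xs
    have h2 := S.G_lip n xs (y + S.b n)
    rw [norm_sub_rev] at h2
    have h3 : (S.L + S.C) * ‖y + S.b n - xs‖ ≤ (S.L + S.C) * (S.om * S.β n) :=
      mul_le_mul_of_nonneg_left hxd (by positivity)
    rw [← mul_assoc, homL] at h3
    have h4 := hst j
    linarith
  obtain ⟨m, hm⟩ := hD.exists_dist_lt (t - S.s n)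
    (show 0 < min (w/4) (S.β n - ‖t - S.s n‖) from lt_min (by positivity) (by linarith))
  rw [dist_eq_norm] at hm
  have hm1 := hm.le.trans (min_le_left _ _)
  have hm2 := hm.le.trans (min_le_right _ _)
  have hDm : ‖D m‖ ≤ S.β n := by
    have : D m = (t - S.s n) - (t - S.s n - D m) := by abel
    rw [this]
    refine (norm_sub_le _ _).trans (by linarith)
  obtain ⟨l, hl⟩ := wa_small_pow hβn (show 0 < w / 16 by positivity)
  obtain ⟨n1, hp1, hb1, hs1, hβ1, hnon1, -⟩ := S.select hgap1 0 l m hβn (by simp) le_rfl one_pos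
  simp only [pow_zero, mul_one] at hb1 hs1 hβ1
  have hs1 := hs1 hDm
  have hβ1w : S.β (n1+1) ≤ w / 16 := by
    rw [hβ1, pow_succ]
    have : 0 < S.β n * (1/2)^l := by positivity
    linarith
  set M := n1 + 1 with hM
  set xm := y + S.b n + S.β n • S.e M with hxm
  have hxmb : xm - S.b M = y := by rw [hxm, hb1]; abel
  -- move into O
  obtain ⟨x', hx'O, hx'd⟩ := hOd.exists_dist_lt xm
    (show 0 < min (w/8) (S.om * S.β n) by positivity)
  rw [dist_eq_norm] at hx'd
  have hd1 := hx'd.le.trans (min_le_left _ _)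
  have hd2 := hx'd.le.trans (min_le_right _ _)
  obtain ⟨r, hr, hrO⟩ := Metric.isOpen_iff.1 hO _ hx'O
  set h := min (r/4) (min (w/16) (S.β n)) with hh
  have hh0 : 0 < h := by positivity
  have hhr : h ≤ r/4 := min_le_left _ _
  have hhw : h ≤ w/16 := (min_le_right _ _).trans (min_le_left _ _)
  have hhb : h ≤ S.β n := (min_le_right _ _).trans (min_le_right _ _)
  obtain ⟨i, hi⟩ := S.exists_near x' (show 0 < S.L * h by positivity)
  have hdi : WaDesc M i := by
    by_contra hcon
    have h1 := hnon1 i hcon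
    have h2 := S.G_lip i x' xm
    have h3 := S.G_lip M xm x'
    rw [norm_sub_rev] at h2
    have h4 : (S.L + S.C) * ‖xm - x'‖ ≤ (S.L + S.C) * (S.om * S.β n) :=
      mul_le_mul_of_nonneg_left hd2 (by positivity)
    rw [← mul_assoc, homL] at h4
    have h5 := S.G_le_F M x'
    have h6 : S.L * h ≤ S.L * S.β n := mul_le_mul_of_nonneg_left hhb hL.le
    have h7 : 0 < S.L * S.β n := by positivity
    linarith
  have hgap2 : ∀ j, S.G j x' ≤ S.G i x' + S.L * h := fun j => by
    have := S.G_le_F j x'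
    linarith
  obtain ⟨k, hk⟩ := wa_small_pow (S.hβ i) hh0
  have hβik : 0 < S.β i * (1/2)^k := mul_pos (S.hβ i) (by positivity)
  have htgt : 0 < min ε (min (r/16) (min (w/64) (S.β n/16))) := by positivity
  obtain ⟨l2, hl2⟩ := wa_small_pow hβik htgt
  obtain ⟨n2, hp2, hb2, -, hβ2, hnon2, hds2⟩ := S.select hgap2 k l2 0 hh0 hk le_rfl
    (ε := S.L / 2 * (S.β i * (1/2)^k * (1/2)^(l2+1))) (by positivity)
  rw [← hβ2] at hds2
  have hβ2' : S.β (n2+1) ≤ min ε (min (r/16) (min (w/64) (S.β n/16))) := by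
    rw [hβ2, pow_succ]
    have : 0 < S.β i * (1/2)^k * (1/2)^l2 := by positivity
    linarith
  have hdM : WaDesc M (n2+1) := WaDesc.step n2 (by rw [hp2]; exact hdi)
  have hβ20 := S.hβ (n2+1)
  set M2 := n2 + 1 with hM2
  have t1 := hβ2'.trans (min_le_left _ _)
  have t2 := (hβ2'.trans (min_le_right _ _)).trans (min_le_left _ _)
  have t3 := ((hβ2'.trans (min_le_right _ _)).trans (min_le_right _ _)).trans (min_le_left _ _)
  have t4 := ((hβ2'.trans (min_le_right _ _)).trans (min_le_right _ _)).trans (min_le_right _ _)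
  have hhe : ‖h • S.e M2‖ ≤ h := by
    rw [norm_smul, Real.norm_of_nonneg hh0.le]
    exact mul_le_of_le_one_right hh0.le (S.he _)
  obtain ⟨hbM, hsM⟩ := S.desc_bd hdM
  refine ⟨M2, x' + h • S.e M2, ?_, ?_, ?_, ?_, t1⟩
  · intro j
    by_cases hj : WaDesc M2 j
    · exact hds2 j hj
    · have h1 := hnon2 j hj
      have h2 : 0 < S.L * h := by positivity
      have h3 : 0 < S.L * S.β M2 := by positivity
      linarith
  · refine Set.Subset.trans (Metric.ball_subset_ball' ?_) hwV
    have g1 : ‖x' + h • S.e M2 - S.b M2 - y‖ ≤ 5 * w / 16 := by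
      have : x' + h • S.e M2 - S.b M2 - y = h • S.e M2 - (xm - x') - (S.b M2 - S.b M) := by
        rw [← hxmb]; abel
      rw [this]
      have a1 := norm_sub_le (h • S.e M2 - (xm - x')) (S.b M2 - S.b M)
      have a2 := norm_sub_le (h • S.e M2) (xm - x')
      linarith
    have g2 : ‖S.s M2 - t‖ ≤ 3 * w / 8 := by
      have : S.s M2 - t = (S.s M2 - S.s M) - (t - S.s n - D m) := by rw [hs1]; abel
      rw [this]
      have a1 := norm_sub_le (S.s M2 - S.s M) (t - S.s n - D m)
      linarith
    have g3 : dist ((x' + h • S.e M2 - S.b M2, S.s M2) : X × Y) (y, t) ≤ 3 * w / 8 := by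
      rw [Prod.dist_eq, dist_eq_norm, dist_eq_norm]
      exact max_le (by simp only; linarith) g2
    have g4 : S.om * S.β M2 ≤ 1/4 * S.β M2 := mul_le_mul_of_nonneg_right hom4 hβ20.le
    linarith
  · refine Set.Subset.trans ?_ hrO
    intro q hq
    rw [Metric.mem_closedBall, dist_eq_norm] at hq
    rw [Metric.mem_ball, dist_eq_norm]
    have : q - x' = (q - (x' + h • S.e M2)) + h • S.e M2 := by abel
    rw [this]
    have a1 := norm_add_le (q - (x' + h • S.e M2)) (h • S.e M2)
    linarith
  · refine Metric.closedBall_subset_closedBall' ?_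
    rw [dist_eq_norm]
    have : x' + h • S.e M2 - xs = h • S.e M2 - (xm - x') + (y + S.b n - xs) + S.β n • S.e M := by
      rw [hxm]; abel
    rw [this]
    have a1 := norm_add_le (h • S.e M2 - (xm - x') + (y + S.b n - xs)) (S.β n • S.e M)
    have a2 := norm_add_le (h • S.e M2 - (xm - x')) (y + S.b n - xs)
    have a3 := norm_sub_le (h • S.e M2) (xm - x')
    have a4 : ‖S.β n • S.e M‖ ≤ S.β n := by
      rw [norm_smul, Real.norm_of_nonneg hβn.le]
      exact mul_le_of_le_one_right hβn.le (S.he _)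
    linarith

theorem root_state (j : ℕ) : S.G j 0 ≤ S.G 0 0 + S.L / 2 * S.β 0 := by
  have hL := S.hL
  have hβ := S.hβ 0
  have hp : 0 < S.L * S.β 0 := by positivity
  rcases S.desc_first (WaDesc.zero j) with h | ⟨τ, h1, h2, h3, h4, h5⟩
  · rw [h]; linarith
  · unfold G
    rw [S.b0, sub_zero] at h3
    rw [S.s0, sub_zero] at h4
    have hβj := S.hβ j
    have g := S.hl (0 - S.b j) 0 (S.s j) 0
    simp only [zero_sub, sub_zero, norm_neg] at g
    have g2 : S.L * (‖S.b j‖ + ‖S.s j‖) ≤ S.L * (4 * τ) :=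
      mul_le_mul_of_nonneg_left (by linarith) hL.le
    have g8 := mul_le_mul_of_nonneg_left h5 S.C_pos.le
    have g9 : S.C * (τ * (S.a / 2)) = 8 * S.L * τ := by
      rw [show S.C * (τ * (S.a / 2)) = S.C * S.a * τ / 2 by ring, S.C_a]; ring
    have g10 : 0 < S.L * τ := by positivity
    simp only [map_zero, S.b0, S.s0, S.d0, zero_sub, sub_zero, neg_zero] at *
    linarith

theorem concl [CompleteSpace X] (hD : DenseRange D) {O : ℕ → Set X} (hO : ∀ k, IsOpen (O k))
    (hOd : ∀ k, Dense (O k)) (hF : ∀ x, (∀ k, x ∈ O k) → ∀ v, WaSD S.F x v) :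
    ∃ U : ℕ → Set (X × Y), (∀ k, IsOpen (U k)) ∧
      (∀ k, Metric.ball 0 (S.om * S.β 0) ⊆ closure (U k)) ∧
      ∀ p, (∀ k, p ∈ U k) → ∀ v, WaSD φ p (v, 0) := by
  have hL := S.hL
  have hC := S.C_pos
  let St := {σ : ℕ × X // ∀ j, S.G j σ.2 ≤ S.G σ.1 σ.2 + S.L / 2 * S.β σ.1}
  let W : St → Set (X × Y) := fun σ =>
    Metric.ball (σ.1.2 - S.b σ.1.1, S.s σ.1.1) (S.om * S.β σ.1.1)
  let R : ℕ → St → St → Prop := fun k σ τ =>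
    Metric.closedBall τ.1.2 (8 * S.β τ.1.1) ⊆ O k ∧
    Metric.closedBall τ.1.2 (8 * S.β τ.1.1) ⊆ Metric.closedBall σ.1.2 (8 * S.β σ.1.1) ∧
    S.β τ.1.1 ≤ 1 / ((k : ℝ) + 1)
  obtain ⟨U, hU1, hU2, hU3⟩ := wa_game W (fun σ => Metric.isOpen_ball) R (by
    intro k σ V hV hne hVW
    obtain ⟨n', x', h1, h2, h3, h4, h5⟩ := S.round hD σ.2 hV hne hVW (hO k) (hOd k)
      (show 0 < 1 / ((k : ℝ) + 1) by positivity)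
    exact ⟨⟨(n', x'), h1⟩, ⟨h3, h4, h5⟩,
      Metric.nonempty_ball.2 (mul_pos S.om_pos (S.hβ _)), h2⟩) ⟨(0, 0), S.root_state⟩
  refine ⟨U, hU1, fun k => ?_, fun p hp v ε hε => ?_⟩
  · have := hU2 k
    simp only [W, S.b0, S.s0, sub_zero] at this
    exact this
  obtain ⟨s, -, hs⟩ := hU3 p hp
  let x : ℕ → X := fun k => (s k).1.2
  let n : ℕ → ℕ := fun k => (s k).1.1
  have hanti : Antitone fun k => Metric.closedBall (x k) (8 * S.β (n k)) :=
    antitone_nat_of_succ_le fun k => (hs k).1.2.1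
  have hβ0 : Tendsto (fun k => S.β (n k)) atTop (𝓝 0) := by
    rw [← tendsto_add_atTop_iff_nat 1]
    exact squeeze_zero (fun k => (S.hβ _).le) (fun k => (hs k).1.2.2)
      tendsto_one_div_add_atTop_nhds_zero_nat
  have hmem : ∀ k m, k ≤ m → x m ∈ Metric.closedBall (x k) (8 * S.β (n k)) := fun k m hkm =>
    hanti hkm (Metric.mem_closedBall_self (by have := S.hβ (n m); positivity))
  have hcau : CauchySeq x := by
    refine cauchySeq_of_le_tendsto_0 (fun k => 8 * S.β (n k) + 8 * S.β (n k)) ?_ ?_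
    · intro a b N ha hb
      exact (dist_triangle_right _ _ (x N)).trans (add_le_add (hmem N a ha) (hmem N b hb))
    · have := (hβ0.const_mul 8).add (hβ0.const_mul 8)
      simpa using this
  obtain ⟨xl, hxl⟩ := cauchySeq_tendsto_of_complete hcau
  have hxlm : ∀ k, xl ∈ Metric.closedBall (x k) (8 * S.β (n k)) := fun k =>
    Metric.isClosed_closedBall.mem_of_tendsto hxl
      ((eventually_ge_atTop k).mono fun m hm => hmem k m hm)
  obtain ⟨τ, hτ, hτF⟩ := hF xl (fun k => (hs k).1.1 (hxlm (k+1))) v (ε/2) (by positivity)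
  have hK : Tendsto (fun k => (S.L + 32 * (S.L + S.C) + 40 * S.L) * S.β (n k)) atTop (𝓝 0) := by
    simpa using hβ0.const_mul (S.L + 32 * (S.L + S.C) + 40 * S.L)
  obtain ⟨k, hk⟩ := (hK.eventually (gt_mem_nhds (show 0 < ε / 2 * τ by positivity))).exists
  refine ⟨τ, hτ, ?_⟩
  have hβk := S.hβ (n k)
  have hxd : ‖xl - x k‖ ≤ 8 * S.β (n k) := by rw [← dist_eq_norm]; exact hxlm k
  have hFx : S.F xl ≤ S.G (n k) xl + (S.L / 2 + 16 * (S.L + S.C)) * S.β (n k) := by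
    have h1 := S.F_lip xl (x k)
    have h2 := S.G_lip (n k) (x k) xl
    rw [norm_sub_rev] at h2
    have h3 : S.F (x k) ≤ S.G (n k) (x k) + S.L / 2 * S.β (n k) := ciSup_le (s k).2
    have h4 : (S.L + S.C) * ‖xl - x k‖ ≤ (S.L + S.C) * (8 * S.β (n k)) :=
      mul_le_mul_of_nonneg_left hxd (by positivity)
    linarith
  have hG1 := S.G_le_F (n k) (xl + τ • v)
  have hG2 := S.G_le_F (n k) (xl - τ • v)
  obtain ⟨y, t⟩ := p
  have hpW := (hs k).2
  simp only [W] at hpW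
  rw [Metric.mem_ball, Prod.dist_eq, max_lt_iff, dist_eq_norm, dist_eq_norm] at hpW
  obtain ⟨hy, ht⟩ := hpW
  have hy : ‖y - (x k - S.b (n k))‖ < S.om * S.β (n k) := hy
  have ht : ‖t - S.s (n k)‖ < S.om * S.β (n k) := ht
  have hom : S.om * S.β (n k) ≤ 1/4 * S.β (n k) := mul_le_mul_of_nonneg_right S.om_le hβk.le
  have hd : ‖y - (xl - S.b (n k))‖ ≤ 9 * S.β (n k) := by
    have : y - (xl - S.b (n k)) = (y - (x k - S.b (n k))) - (xl - x k) := by abel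
    rw [this]
    have := norm_sub_le (y - (x k - S.b (n k))) (xl - x k)
    linarith
  have hsum : S.L * (‖y - (xl - S.b (n k))‖ + ‖t - S.s (n k)‖) ≤ S.L * (10 * S.β (n k)) :=
    mul_le_mul_of_nonneg_left (by linarith) hL.le
  have f1 := S.hl (y + τ • v) (xl + τ • v - S.b (n k)) t (S.s (n k))
  have f2 := S.hl (y - τ • v) (xl - τ • v - S.b (n k)) t (S.s (n k))
  have f3 := S.hl (xl - S.b (n k)) y (S.s (n k)) t
  rw [show y + τ • v - (xl + τ • v - S.b (n k)) = y - (xl - S.b (n k)) by abel] at f1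
  rw [show y - τ • v - (xl - τ • v - S.b (n k)) = y - (xl - S.b (n k)) by abel] at f2
  rw [norm_sub_rev, norm_sub_rev (S.s (n k))] at f3
  have e1 : ((y, t) : X × Y) + τ • (v, 0) = (y + τ • v, t) := by simp
  have e2 : ((y, t) : X × Y) - τ • (v, 0) = (y - τ • v, t) := by simp
  rw [e1, e2]
  unfold G at hG1 hG2 hFx
  simp only [map_add, map_sub, map_smul] at hG1 hG2
  linarith

end WaSys


theorem wa_use {X : Type*} [NormedAddCommGroup X] [NormedSpace ℝ X] (hX : IsWeakAsplund X)
    {f : X → ℝ} {L : ℝ} (hL : 0 < L) (hf : ConvexOn ℝ Set.univ f) (hl : WaLip L f) :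
    ∃ U : ℕ → Set X, (∀ k, IsOpen (U k)) ∧ (∀ k, Dense (U k)) ∧ Dense (⋂ k, U k) ∧
      ∀ p, (∀ k, p ∈ U k) → GateauxDiffAt f p := by
  obtain ⟨G, -, hG, ⟨U, hU, rfl⟩, hd⟩ := hX Set.univ isOpen_univ convex_univ ⟨0, trivial⟩ f
    (hl.continuous hL).continuousOn hf
  rw [Set.univ_inter] at hG hd
  have hGd : Dense (⋂ k, U k) := fun x => hG trivial
  exact ⟨U, hU, fun k => hGd.mono (Set.iInter_subset _ k), hGd,
    fun p hp => hd p (Set.mem_iInter.2 hp)⟩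

theorem wa_rough_case {X Y : Type*} [NormedAddCommGroup X] [NormedSpace ℝ X] [CompleteSpace X]
    [NormedAddCommGroup Y] [NormedSpace ℝ Y] [TopologicalSpace.SeparableSpace Y]
    (hX : IsWeakAsplund X) {f : X → ℝ} (hf : ConvexOn ℝ Set.univ f) (hf1 : WaLip 1 f)
    {ε0 : ℝ} (hε0 : 0 < ε0) {x0 : X} {r0 : ℝ} (hr0 : 0 < r0)
    (hrough : ∀ z ∈ Metric.ball x0 r0, ∀ δ > 0, ∃ v, ‖v‖ ≤ δ ∧
      ε0 * δ < f (z + v) + f (z - v) - 2 * f z)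
    {φ : X × Y → ℝ} {L : ℝ} (hL : 0 < L) (hφ : ConvexOn ℝ Set.univ φ) (hl : WaLip L φ) :
    ∃ U : ℕ → Set (X × Y), (∀ k, IsOpen (U k)) ∧ (∀ k, Dense (U k)) ∧
        ∀ p, (∀ k, p ∈ U k) → ∀ v, WaSD φ p (v, 0) := by
  obtain ⟨U0, -, -, hU0, hU0'⟩ := wa_use hX one_pos hf hf1
  have hsg : ∀ z : X, z ∈ ⋂ k, U0 k → _ := fun z hz =>
    wa_subgrad hf hf1 (hU0' z (Set.mem_iInter.1 hz))
  choose! ξ hξ1 hξ2 hξ3 using hsg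
  obtain ⟨a, ζ, e, ha, hζ, he, hinc, hdesc, hnon, hlim⟩ := wa_tree hf1 hU0
    (fun z hz v => by simpa using hξ1 z hz v) hξ2 hξ3 hε0 hr0 hrough
  have hl' : ∀ x x' t t', φ (x, t) - φ (x', t') ≤ L * (‖x - x'‖ + ‖t - t'‖) := by
    intro x x' t t'
    refine (hl (x, t) (x', t')).trans (mul_le_mul_of_nonneg_left ?_ hL.le)
    rw [Prod.mk_sub_mk, Prod.norm_def]
    exact max_le (by simp) (by simp)
  let om : ℝ := L / (4 * (L + 16 * L / a))
  have hom : 0 < om := by positivity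
  have key : ∀ N : ℕ, ∃ U : ℕ → Set (X × Y), (∀ k, IsOpen (U k)) ∧
      (∀ k, Metric.ball 0 (om * (N + 1)) ⊆ closure (U k)) ∧
      ∀ p, (∀ k, p ∈ U k) → ∀ v, WaSD φ p (v, 0) := by
    intro N
    obtain ⟨β, d, b, s, hB, d0, b0, s0, hβ, hpar, hchild⟩ :=
      wa_labels (TopologicalSpace.denseSeq Y) e he a (B0 := (N : ℝ) + 1) (by positivity)
    let S : WaSys φ (TopologicalSpace.denseSeq Y) :=
      ⟨L, a, ζ, e, β, d, b, s, hL, ha, hφ, hl', hζ, he, hinc, hdesc, hnon, hlim, d0, b0, s0,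
        hβ, hpar, hchild⟩
    obtain ⟨O, hO, hOd, -, hOF⟩ := wa_use hX (add_pos S.hL S.C_pos) S.F_cvx S.F_lip
    obtain ⟨U, h1, h2, h3⟩ := S.concl (TopologicalSpace.denseRange_denseSeq Y) hO hOd
      (fun x hx v => wa_sd_of_gateaux (hOF x hx) v)
    refine ⟨U, h1, fun k => ?_, h3⟩
    have := h2 k
    rw [← hB]
    exact this
  choose U h1 h2 h3 using key
  refine ⟨fun k => U k.unpair.1 k.unpair.2 ∪ (closure (Metric.ball 0 (om * (k.unpair.1 + 1))))ᶜ,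
    fun k => (h1 _ _).union isClosed_closure.isOpen_compl, fun k => ?_, fun p hp => ?_⟩
  · intro x
    rw [closure_union]
    by_cases hx : x ∈ closure (Metric.ball (0 : X × Y) (om * (k.unpair.1 + 1)))
    · exact Or.inl (closure_minimal (h2 _ _) isClosed_closure hx)
    · exact Or.inr (subset_closure hx)
  · obtain ⟨N, hN⟩ := exists_nat_gt (‖p‖ / om)
    refine h3 N p fun k => ?_
    have := hp (Nat.pair N k)
    simp only [Nat.unpair_pair] at this
    rcases this with h | h
    · exact h
    · refine absurd (subset_closure ?_) h
      rw [mem_ball_zero_iff]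
      rw [div_lt_iff₀ hom] at hN
      nlinarith

theorem wa_main (X Y : Type*)
    [NormedAddCommGroup X] [NormedSpace ℝ X] [CompleteSpace X]
    [NormedAddCommGroup Y] [NormedSpace ℝ Y] [FiniteDimensional ℝ Y]
    (hX : IsWeakAsplund X) : IsWeakAsplund (X × Y) := by
  haveI : CompleteSpace Y := FiniteDimensional.complete ℝ Y
  haveI : ProperSpace Y := FiniteDimensional.proper ℝ Y
  refine wa_reduction fun φ L hL hφ hl => ?_
  have hXd : ∃ U : ℕ → Set (X × Y), (∀ k, IsOpen (U k)) ∧ (∀ k, Dense (U k)) ∧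
        ∀ p, (∀ k, p ∈ U k) → ∀ v, WaSD φ p (v, 0) := by
    by_cases hFL : ∀ f : X → ℝ, ConvexOn ℝ Set.univ f → WaLip 1 f → ∀ (x0 : X) (r ε : ℝ),
      0 < r → 0 < ε →
      ∃ x ∈ Metric.ball x0 r, ∃ δ > 0, ∀ v, ‖v‖ ≤ δ → f (x + v) + f (x - v) - 2 * f x ≤ ε * δ
    · exact wa_FL_case hFL hL hφ hl
    · push Not at hFL
      obtain ⟨f, hf, hf1, x0, r, ε, hr, hε, h⟩ := hFL
      exact wa_rough_case hX hf hf1 hε hr h hL hφ hl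
  obtain ⟨U, hU1, hU2, hU3⟩ := hXd
  obtain ⟨V, hV1, hV2, hV3⟩ := wa_Ydir hL hl
  refine ⟨fun k => U k ∩ V k, fun k => (hU1 k).inter (hV1 k),
    fun k => (hU2 k).inter_of_isOpen_left (hV2 k) (hU1 k), fun p hp => ?_⟩
  exact wa_gateaux_of_sd hφ hl (wa_sd_prod hφ (hU3 p fun k => (hp k).1) (hV3 p fun k => (hp k).2))

/-- If `X` is a weak Asplund real Banach space and `Y` is a finite-dimensional real
normed space, then `X × Y` (with the sup product norm) is a weak Asplund space. -/
theorem weakAsplund_prod_finiteDimensional (X Y : Type*)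
    [NormedAddCommGroup X] [NormedSpace ℝ X] [CompleteSpace X]
    [NormedAddCommGroup Y] [NormedSpace ℝ Y] [FiniteDimensional ℝ Y]
    (hX : IsWeakAsplund X) : IsWeakAsplund (X × Y) := by
  exact wa_main X Y hX
end

section
/- The function f(x) = inf {r ∈ ℝ : (x,r) ∈ closure C} is convex on the open set T C and continuous at every point of T C. -/
/-- Let `C` be a bounded open convex subset of `X × ℝ` containing `(0,0)`, and let
`T : X × ℝ → X` be the projection `T (x, r) = x`. Then the function
`f x = inf {r : (x, r) ∈ closure C}` is convex on `T C` and continuous at every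
point of `T C`. -/
theorem lowerBoundary_convexOn_continuousAt
    (X : Type*) [NormedAddCommGroup X] [NormedSpace ℝ X] [CompleteSpace X]
    (C : Set (X × ℝ)) (hCbdd : Bornology.IsBounded C) (hCopen : IsOpen C)
    (hCconv : Convex ℝ C) (hC0 : ((0, 0) : X × ℝ) ∈ C)
    (f : X → ℝ) (hf : ∀ x : X, f x = sInf {r : ℝ | (x, r) ∈ closure C}) :
    ConvexOn ℝ (Prod.fst '' C) f ∧ ∀ x ∈ Prod.fst '' C, ContinuousAt f x := by
  obtain ⟨R, hR⟩ := hCbdd.closure.exists_norm_le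
  have hbdd : ∀ x : X, BddBelow {r : ℝ | (x, r) ∈ closure C} := fun x => by
    refine ⟨-R, fun r hr => ?_⟩
    have h1 : ‖r‖ ≤ R := (norm_snd_le (x, r)).trans (hR _ hr)
    exact (abs_le.1 h1).1
  have hle : ∀ (x : X) (r : ℝ), (x, r) ∈ closure C → f x ≤ r := fun x r h => by
    rw [hf x]; exact csInf_le (hbdd x) h
  have hmem : ∀ x ∈ Prod.fst '' C, (x, f x) ∈ closure C := by
    rintro x ⟨⟨y, r⟩, hp, rfl⟩
    have hcl : IsClosed {r : ℝ | (y, r) ∈ closure C} :=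
      isClosed_closure.preimage (by fun_prop : Continuous fun r : ℝ => (y, r))
    have := hcl.csInf_mem ⟨r, subset_closure hp⟩ (hbdd y)
    rw [← hf y] at this
    exact this
  have hopen : IsOpen (Prod.fst '' C) := isOpenMap_fst C hCopen
  have hconv : ConvexOn ℝ (Prod.fst '' C) f := by
    refine ⟨hCconv.linear_image (LinearMap.fst ℝ X ℝ), ?_⟩
    intro x hx y hy a b ha hb hab
    exact hle _ _ (hCconv.closure (hmem x hx) (hmem y hy) ha hb hab)
  have h0 : (0 : X) ∈ Prod.fst '' C := ⟨_, hC0, rfl⟩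
  refine ⟨hconv, fun x hx => ?_⟩
  have hcont : ContinuousOn f (Prod.fst '' C) := by
    have key := (hconv.continuousOn_tfae hopen ⟨0, h0⟩).out 3 1
    refine key.1 ⟨0, h0, 0, ?_⟩
    have hc : Continuous fun x : X => (x, (0 : ℝ)) := by fun_prop
    have := (hCopen.preimage hc).mem_nhds (show (0 : X) ∈ _ from hC0)
    rw [Filter.eventually_map]
    filter_upwards [this] with z hz
    exact hle _ _ (subset_closure hz)
  exact hcont.continuousAt (hopen.mem_nhds hx)
end

section
/- The epigraph epi f = {(x,r) ∈ X × ℝ : x ∈ T (closure C) and f(x) ≤ r} is a closed convex subset of X × ℝ. -/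
/-- Let `C` be a bounded open convex subset of `X × ℝ` containing `(0,0)`, let
`T : X × ℝ → X` be the projection `T (x, r) = x`, and let
`f x = inf {r : (x, r) ∈ closure C}` on `T (closure C)`. Then the epigraph
`epi f = {(x, r) : x ∈ T (closure C) ∧ f x ≤ r}` is a closed convex subset of `X × ℝ`. -/
theorem epigraph_isClosed_convex
    (X : Type*) [NormedAddCommGroup X] [NormedSpace ℝ X] [CompleteSpace X]
    (C : Set (X × ℝ)) (hCbdd : Bornology.IsBounded C) (hCopen : IsOpen C)
    (hCconv : Convex ℝ C) (hC0 : ((0, 0) : X × ℝ) ∈ C)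
    (f : X → ℝ) (hf : ∀ x : X, f x = sInf {r : ℝ | (x, r) ∈ closure C}) :
    IsClosed {p : X × ℝ | p.1 ∈ Prod.fst '' closure C ∧ f p.1 ≤ p.2} ∧
      Convex ℝ {p : X × ℝ | p.1 ∈ Prod.fst '' closure C ∧ f p.1 ≤ p.2} := by
  obtain ⟨R, hR⟩ := hCbdd.closure.subset_closedBall (0 : X × ℝ)
  have hb : ∀ x r, ((x, r) : X × ℝ) ∈ closure C → r ∈ Set.Icc (-R) R := by
    intro x r h
    have h1 := hR h
    rw [mem_closedBall_zero_iff] at h1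
    have h2 : ‖r‖ ≤ R := le_trans (norm_snd_le (x, r)) h1
    exact abs_le.mp h2
  have key : {p : X × ℝ | p.1 ∈ Prod.fst '' closure C ∧ f p.1 ≤ p.2}
      = {p : X × ℝ | ∃ s, s ≤ p.2 ∧ (p.1, s) ∈ closure C} := by
    ext ⟨x, r⟩
    simp only [Set.mem_ofPred_eq]
    have hbd : BddBelow {r : ℝ | (x, r) ∈ closure C} := ⟨-R, fun s hs => (hb x s hs).1⟩
    constructor
    · rintro ⟨⟨⟨y, t⟩, hy, rfl⟩, h2⟩
      refine ⟨f y, h2, ?_⟩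
      have hcl : IsClosed {r : ℝ | (y, r) ∈ closure C} :=
        isClosed_closure.preimage (by fun_prop : Continuous fun r : ℝ => (y, r))
      have := hcl.csInf_mem ⟨t, hy⟩ hbd
      rw [← hf] at this
      exact this
    · rintro ⟨s, hs, h⟩
      refine ⟨⟨(x, s), h, rfl⟩, ?_⟩
      rw [hf]
      exact (csInf_le hbd h).trans hs
  rw [key]
  constructor
  · have hcl : IsClosed {q : (X × ℝ) × Set.Icc (-R) R |
        (q.2 : ℝ) ≤ q.1.2 ∧ (q.1.1, (q.2 : ℝ)) ∈ closure C} := by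
      have e1 : IsClosed {q : (X × ℝ) × Set.Icc (-R) R | (q.2 : ℝ) ≤ q.1.2} :=
        isClosed_le (by fun_prop) (by fun_prop)
      have e2 : IsClosed {q : (X × ℝ) × Set.Icc (-R) R | (q.1.1, (q.2 : ℝ)) ∈ closure C} :=
        isClosed_closure.preimage (by fun_prop :
          Continuous fun q : (X × ℝ) × Set.Icc (-R) R => (q.1.1, (q.2 : ℝ)))
      exact e1.inter e2
    have h2 := isClosedMap_fst_of_compactSpace _ hcl
    convert h2 using 1
    ext p
    constructor
    · rintro ⟨s, hs, h⟩
      exact ⟨(p, ⟨s, hb _ _ h⟩), ⟨hs, h⟩, rfl⟩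
    · rintro ⟨⟨q, s⟩, ⟨hs, h⟩, rfl⟩
      exact ⟨s, hs, h⟩
  · rintro ⟨x, r⟩ ⟨s, hs, h⟩ ⟨y, r'⟩ ⟨s', hs', h'⟩ a b ha hb' hab
    refine ⟨a * s + b * s', ?_, ?_⟩
    · exact add_le_add (mul_le_mul_of_nonneg_left hs ha) (mul_le_mul_of_nonneg_left hs' hb')
    · exact hCconv.closure h h' ha hb' hab
end

section
/- For every x₀ ∈ T C, the function f is Gâteaux differentiable at x₀ if and only if the Minkowski gauge μ of closure C is Gâteaux differentiable at the point (x₀, f(x₀)). -/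
open Filter Topology

lemma gd_squeeze {X : Type*} [NormedAddCommGroup X] [NormedSpace ℝ X]
    (h : X → ℝ) (p : X) (L : X →L[ℝ] ℝ)
    (lower : ∀ v, ∀ᶠ t in 𝓝[>] (0:ℝ), h p + t * L v ≤ h (p + t • v))
    (upper : ∀ v, ∀ β, L v < β → ∀ᶠ t in 𝓝[>] (0:ℝ), h (p + t • v) ≤ h p + t * β) :
    GateauxDiffAt h p := by
  have right : ∀ v, Tendsto (fun t : ℝ => (h (p + t • v) - h p) / t) (𝓝[>] (0 : ℝ))
      (𝓝 (L v)) := by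
    intro v
    rw [tendsto_order]
    constructor
    · intro a ha
      filter_upwards [lower v, self_mem_nhdsWithin] with t ht ht0
      have ht0 : 0 < t := ht0
      rw [lt_div_iff₀ ht0]
      nlinarith
    · intro a ha
      filter_upwards [upper v ((L v + a) / 2) (by linarith), self_mem_nhdsWithin] with t ht ht0
      have ht0 : 0 < t := ht0
      rw [div_lt_iff₀ ht0]
      nlinarith
  refine ⟨L, fun v => ?_⟩
  rw [← Set.Iio_union_Ioi, nhdsWithin_union, tendsto_sup]
  refine ⟨?_, right v⟩
  have hneg : Tendsto (fun t : ℝ => -t) (𝓝[<] (0:ℝ)) (𝓝[>] (0:ℝ)) := by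
    simpa using tendsto_neg_nhdsLT (a := (0:ℝ))
  have := ((right (-v)).comp hneg).neg
  simp only [map_neg, neg_neg] at this
  refine this.congr fun t => ?_
  simp [div_neg]

lemma gd_subgrad {X : Type*} [NormedAddCommGroup X] [NormedSpace ℝ X]
    (h : X → ℝ) (S : Set X) (hS : ConvexOn ℝ S h) (p q : X) (hp : p ∈ S) (hq : q ∈ S)
    (l : ℝ)
    (hl : Tendsto (fun t : ℝ => (h (p + t • (q - p)) - h p) / t) (𝓝[≠] (0 : ℝ)) (𝓝 l)) :
    h p + l ≤ h q := by
  have hl' := hl.mono_left (nhdsWithin_mono (0:ℝ) (s := Set.Ioi 0)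
    (fun x (hx : 0 < x) => ne_of_gt hx))
  have : l ≤ h q - h p := by
    refine le_of_tendsto hl' ?_
    filter_upwards [Ioo_mem_nhdsGT (zero_lt_one' ℝ)] with t ht
    have h1 := hS.2 hp hq (sub_nonneg.2 ht.2.le) ht.1.le (by ring)
    have e : (1 - t) • p + t • q = p + t • (q - p) := by module
    rw [e] at h1
    simp only [smul_eq_mul] at h1
    rw [div_le_iff₀ ht.1]
    linarith
  linarith

lemma gd_path {E : Type*} [NormedAddCommGroup E] [NormedSpace ℝ E] (p v : E) {s : Set E}
    (hs : s ∈ 𝓝 p) : ∀ᶠ t in 𝓝[>] (0:ℝ), p + t • v ∈ s := by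
  have : Tendsto (fun t : ℝ => p + t • v) (𝓝 0) (𝓝 p) := by
    have : Continuous (fun t : ℝ => p + t • v) := by fun_prop
    simpa using this.tendsto 0
  exact (this.mono_left nhdsWithin_le_nhds) hs

lemma gd_right {E : Type*} [NormedAddCommGroup E] [NormedSpace ℝ E] {h : E → ℝ} {p v : E}
    {l β : ℝ} (hl : Tendsto (fun t : ℝ => (h (p + t • v) - h p) / t) (𝓝[≠] (0 : ℝ)) (𝓝 l))
    (hβ : l < β) : ∀ᶠ t in 𝓝[>] (0:ℝ), h (p + t • v) < h p + t * β := by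
  have hl' := hl.mono_left (nhdsWithin_mono (0:ℝ) (s := Set.Ioi 0)
    (fun x (hx : 0 < x) => ne_of_gt hx))
  filter_upwards [hl'.eventually (gt_mem_nhds hβ), self_mem_nhdsWithin] with t ht ht0
  have ht0 : 0 < t := ht0
  rw [div_lt_iff₀ ht0] at ht
  linarith

/-- Let `C` be a bounded open convex subset of `X × ℝ` containing `(0,0)`, let
`T : X × ℝ → X` be the projection, let `f x = inf {r : (x, r) ∈ closure C}` and let
`μ = gauge (closure C)` be the Minkowski gauge of `closure C`. For every `x₀ ∈ T C`,
`f` is Gâteaux differentiable at `x₀` iff `μ` is Gâteaux differentiable at `(x₀, f x₀)`. -/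
theorem gateaux_lowerBoundary_iff_gauge
    (X : Type*) [NormedAddCommGroup X] [NormedSpace ℝ X] [CompleteSpace X]
    (C : Set (X × ℝ)) (hCbdd : Bornology.IsBounded C) (hCopen : IsOpen C)
    (hCconv : Convex ℝ C) (hC0 : ((0, 0) : X × ℝ) ∈ C)
    (f : X → ℝ) (hf : ∀ x : X, f x = sInf {r : ℝ | (x, r) ∈ closure C})
    (x₀ : X) (hx₀ : x₀ ∈ Prod.fst '' C) :
    GateauxDiffAt f x₀ ↔ GateauxDiffAt (gauge (closure C)) (x₀, f x₀) := by
  set K := closure C with hK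
  have hCK : C ⊆ K := subset_closure
  have hKconv : Convex ℝ K := hCconv.closure
  have hKcl : IsClosed K := isClosed_closure
  have hCn : C ∈ 𝓝 (0 : X × ℝ) := hCopen.mem_nhds hC0
  have hKn : K ∈ 𝓝 (0 : X × ℝ) := mem_of_superset hCn hCK
  have hKabs : Absorbent ℝ K := absorbent_nhds_zero hKn
  have hKbdd : Bornology.IsBounded K := hCbdd.closure
  have hμc : Continuous (gauge K) := continuous_gauge hKconv hKn
  have hbb : ∀ x, BddBelow {r : ℝ | (x, r) ∈ K} := by
    intro x
    obtain ⟨R, hR⟩ := hKbdd.exists_norm_le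
    refine ⟨-R, fun r hr => ?_⟩
    have h1 := hR _ hr
    have h2 : ‖r‖ ≤ ‖(x, r)‖ := norm_snd_le (x, r)
    rw [Real.norm_eq_abs] at h2
    linarith [neg_abs_le r]
  have f_le : ∀ x r, (x, r) ∈ K → f x ≤ r := by
    intro x r h
    rw [hf]; exact csInf_le (hbb x) h
  have f_mem : ∀ x ∈ Prod.fst '' C, (x, f x) ∈ K := by
    rintro x ⟨⟨x', r⟩, hr, rfl⟩
    have hc : IsClosed {r : ℝ | (x', r) ∈ K} := hKcl.preimage (by fun_prop)
    have := hc.csInf_mem ⟨r, hCK hr⟩ (hbb x')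
    rw [← hf] at this
    exact this
  have mem_of_lt : ∀ p, gauge K p < 1 → p ∈ K := fun p hp =>
    setOfPred_gauge_lt_one_subset_self hKconv (hCK hC0) hKabs hp
  have μ_one : ∀ x ∈ Prod.fst '' C, gauge K (x, f x) = 1 := by
    intro x hx
    refine le_antisymm (gauge_le_one_of_mem (f_mem x hx)) ?_
    by_contra! hlt
    have := gd_path (x, f x) ((0, -1) : X × ℝ)
      ((isOpen_Iio.preimage hμc).mem_nhds (show (x, f x) ∈ gauge K ⁻¹' Set.Iio 1 from hlt))
    obtain ⟨t, ht, ht0⟩ := (this.and self_mem_nhdsWithin).exists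
    have ht0 : 0 < t := ht0
    have h1 := mem_of_lt _ ht
    have h2 := f_le (x + t • 0) (f x + t • (-1)) h1
    simp at h2
    linarith
  have μ_lt : ∀ p ∈ C, gauge K p < 1 := fun p hp =>
    (gauge_mono (absorbent_nhds_zero hCn) hCK p).trans_lt (gauge_lt_one_of_mem_of_isOpen hCopen hp)
  have μ_conv : ConvexOn ℝ Set.univ (gauge K) := by
    refine ⟨convex_univ, fun x _ y _ a b ha hb _ => ?_⟩
    refine (gauge_add_le hKconv hKabs _ _).trans ?_
    rw [gauge_smul_of_nonneg ha, gauge_smul_of_nonneg hb]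
  have hTopen : IsOpen (Prod.fst '' C) := isOpenMap_fst _ hCopen
  have hTconv : Convex ℝ (Prod.fst '' C) := hCconv.linear_image (LinearMap.fst ℝ X ℝ)
  have f_conv : ConvexOn ℝ (Prod.fst '' C) f := by
    refine ⟨hTconv, fun x hx y hy a b ha hb hab => ?_⟩
    exact f_le _ _ (hKconv (f_mem x hx) (f_mem y hy) ha hb hab)
  obtain ⟨r₁, hr₁⟩ : ∃ r, (x₀, r) ∈ C := by
    obtain ⟨⟨x', r⟩, hr, rfl⟩ := hx₀
    exact ⟨r, hr⟩
  have hlt : f x₀ < r₁ := by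
    refine lt_of_le_of_ne (f_le _ _ (hCK hr₁)) fun h => ?_
    have h1 := μ_lt _ hr₁
    rw [← h, μ_one x₀ hx₀] at h1
    exact lt_irrefl _ h1
  have hμ0 := μ_one x₀ hx₀
  constructor
  · rintro ⟨M, hM⟩
    have hsub : ∀ x ∈ Prod.fst '' C, f x₀ + M (x - x₀) ≤ f x := fun x hx =>
      gd_subgrad f _ f_conv x₀ x hx₀ hx _ (hM _)
    set c := M x₀ - f x₀ with hc
    have hψK : ∀ p ∈ K, M p.1 - p.2 ≤ c := by
      have hcl : IsClosed {p : X × ℝ | M p.1 - p.2 ≤ c} :=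
        isClosed_le (by fun_prop) continuous_const
      refine fun p hp => closure_minimal (fun q hq => ?_) hcl hp
      have h1 := hsub q.1 ⟨q, hq, rfl⟩
      have h2 := f_le q.1 q.2 (hCK hq)
      rw [map_sub] at h1
      show M q.1 - q.2 ≤ c
      linarith
    have hcpos : 0 < c := by
      have := gd_path (0 : X × ℝ) ((0, -1) : X × ℝ) hCn
      obtain ⟨t, ht, ht0⟩ := (this.and self_mem_nhdsWithin).exists
      have ht0 : 0 < t := ht0
      have h1 := hψK _ (hCK ht)
      simp at h1
      linarith
    let φ : X × ℝ →L[ℝ] ℝ :=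
      c⁻¹ • (M.comp (ContinuousLinearMap.fst ℝ X ℝ) - ContinuousLinearMap.snd ℝ X ℝ)
    have hφ : ∀ p, φ p = c⁻¹ * (M p.1 - p.2) := fun p => rfl
    have hφ0 : φ (x₀, f x₀) = 1 := by
      rw [hφ]; exact inv_mul_cancel₀ hcpos.ne'
    have hφμ : ∀ p, φ p ≤ gauge K p := by
      intro p
      by_contra! h
      obtain ⟨b, hb0, hb, k, hk, rfl⟩ := exists_lt_of_gauge_lt hKabs h
      have h1 : φ k ≤ 1 := by
        rw [hφ, inv_mul_le_iff₀ hcpos]; linarith [hψK k hk]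
      have h2 : φ (b • k) = b * φ k := by simp
      simp only at hb
      rw [h2] at hb
      nlinarith
    have key : ∀ u : X × ℝ, φ u < 0 → ∀ᶠ t in 𝓝[>] (0:ℝ), (x₀, f x₀) + t • u ∈ K := by
      rintro ⟨v, s⟩ hu
      have hvs : M v < s := by
        rw [hφ] at hu
        by_contra! hh
        have : 0 ≤ c⁻¹ * (M v - s) := mul_nonneg (inv_nonneg.2 hcpos.le) (by linarith)
        simp only at hu
        linarith
      have e2 := gd_path (x₀, r₁) ((v, 0) : X × ℝ) (hCopen.mem_nhds hr₁)
      have e3 := gd_path (f x₀) s (Iio_mem_nhds hlt)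
      filter_upwards [gd_right (hM v) hvs, e2, e3, self_mem_nhdsWithin] with t h1 h2 h3 ht0
      have h2' : (x₀ + t • v, r₁) ∈ C := by simpa using h2
      have h3' : f x₀ + t * s < r₁ := by simpa using h3
      have h4 := f_mem (x₀ + t • v) ⟨_, h2', rfl⟩
      have hslice : Convex ℝ {r : ℝ | (x₀ + t • v, r) ∈ K} := by
        intro a ha b hb α β hα hβ hαβ
        have := hKconv ha hb hα hβ hαβ
        rw [Prod.smul_mk, Prod.smul_mk, Prod.mk_add_mk, Convex.combo_self hαβ] at this
        exact this
      have := hslice.ordConnected.out h4 (hCK h2') ⟨h1.le, h3'.le⟩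
      simpa using this
    refine gd_squeeze _ _ φ (fun w => ?_) (fun w β hβ => ?_)
    · refine Eventually.of_forall fun t => ?_
      rw [hμ0]
      have := hφμ ((x₀, f x₀) + t • w)
      rw [map_add, map_smul, hφ0, smul_eq_mul] at this
      exact this
    · have hk := key (w - β • (x₀, f x₀)) (by
        rw [map_sub, map_smul, hφ0, smul_eq_mul]; linarith)
      have hpos0 : ∀ᶠ t in 𝓝 (0:ℝ), 0 < 1 + t * β := by
        have : Continuous (fun t : ℝ => 1 + t * β) := by fun_prop
        exact this.continuousAt.eventually (lt_mem_nhds (by simp))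
      have hpos : ∀ᶠ t in 𝓝[>] (0:ℝ), 0 < 1 + t * β := nhdsWithin_le_nhds hpos0
      have hτ : Tendsto (fun t : ℝ => t / (1 + t * β)) (𝓝[>] 0) (𝓝[>] 0) := by
        refine tendsto_nhdsWithin_iff.2 ⟨?_, ?_⟩
        · have : ContinuousAt (fun t : ℝ => t / (1 + t * β)) 0 :=
            ContinuousAt.div (by fun_prop) (by fun_prop) (by simp)
          have h2 := this.tendsto
          simp only [zero_div] at h2
          exact h2.mono_left nhdsWithin_le_nhds
        · filter_upwards [hpos, self_mem_nhdsWithin] with t h1 h2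
          exact div_pos h2 h1
      filter_upwards [hτ.eventually hk, hpos] with t h1 h2
      have e : (x₀, f x₀) + t • w = (1 + t * β) •
          ((x₀, f x₀) + (t / (1 + t * β)) • (w - β • (x₀, f x₀))) := by
        rw [smul_add, smul_smul, mul_div_cancel₀ _ h2.ne']
        module
      rw [e, gauge_smul_of_nonneg h2.le, hμ0, smul_eq_mul]
      have := gauge_le_one_of_mem h1
      nlinarith
  · rintro ⟨L, hL⟩
    have hsub : ∀ q, 1 + L (q - (x₀, f x₀)) ≤ gauge K q := fun q => by
      have := gd_subgrad _ _ μ_conv (x₀, f x₀) q trivial trivial _ (hL _)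
      rwa [hμ0] at this
    have hdec : ∀ v s, L ((v, s) : X × ℝ) = L (v, 0) + s * L (0, 1) := by
      intro v s
      rw [← smul_eq_mul, ← map_smul, ← map_add]
      simp
    set b := - L (0, 1) with hb
    have hbpos : 0 < b := by
      have h1 := hsub (x₀, r₁)
      have h2 := μ_lt _ hr₁
      rw [Prod.mk_sub_mk, hdec, sub_self, Prod.mk_zero_zero, map_zero] at h1
      by_contra! hh
      nlinarith [mul_nonneg (sub_nonneg.2 hlt.le) (show 0 ≤ L (0, 1) by linarith)]
    let N : X →L[ℝ] ℝ := b⁻¹ • L.comp (ContinuousLinearMap.inl ℝ X ℝ)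
    have hN : ∀ v, b * N v = L (v, 0) := fun v => by
      show b * (b⁻¹ * L (v, 0)) = _
      rw [mul_inv_cancel_left₀ hbpos.ne']
    refine gd_squeeze _ _ N (fun v => ?_) (fun v β hβ => ?_)
    · filter_upwards [gd_path x₀ v (hTopen.mem_nhds hx₀)] with t ht
      have h1 := hsub (x₀ + t • v, f (x₀ + t • v))
      rw [μ_one _ ht, Prod.mk_sub_mk, hdec, add_sub_cancel_left, ← hN, map_smul, smul_eq_mul] at h1
      have : b * (t * N v) ≤ b * (f (x₀ + t • v) - f x₀) := by
        rw [hb] at h1 ⊢; linarith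
      have := le_of_mul_le_mul_left this hbpos
      linarith
    · have hneg : L (v, β) < 0 := by
        rw [hdec, ← hN]
        nlinarith
      filter_upwards [gd_right (hL (v, β)) hneg] with t ht
      rw [hμ0, mul_zero, add_zero] at ht
      have := f_le (x₀ + t • v) (f x₀ + t * β) (mem_of_lt _ ht)
      exact this
end

section
/- The function −g, where g(x) = sup {r ∈ ℝ : (x,r) ∈ closure C}, is convex on the open set T C and continuous at every point of T C; moreover, for every x₀ ∈ T C, −g is Gâteaux differentiable at x₀ if and only if the Minkowski gauge μ of closure C is Gâteaux differentiable at the point (x₀, g(x₀)). -/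
open Filter Topology

theorem gd_iff {X : Type*} [NormedAddCommGroup X] [NormedSpace ℝ X]
    (φ : X → ℝ) (p : X) (L : X →L[ℝ] ℝ) :
    (∀ v : X,
    Tendsto (fun t : ℝ => (φ (p + t • v) - φ p) / t) (𝓝[≠] (0 : ℝ)) (𝓝 (L v))) ↔
    ∀ v : X, ∀ k : ℝ, (L v < k → ∀ᶠ t in 𝓝[>] (0:ℝ), φ (p + t • v) < φ p + t * k) ∧
      (k < L v → ∀ᶠ t in 𝓝[>] (0:ℝ), φ p + t * k < φ (p + t • v)) := by
  constructor
  · intro h v k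
    have h1 := (h v).mono_left (nhdsWithin_mono (0:ℝ) (s := Set.Ioi 0)
      (fun t (ht : 0 < t) => ht.ne'))
    constructor
    · intro hk
      filter_upwards [h1.eventually (gt_mem_nhds hk), self_mem_nhdsWithin] with t ht ht0
      have ht0 : 0 < t := ht0
      rw [div_lt_iff₀ ht0] at ht
      linarith
    · intro hk
      filter_upwards [h1.eventually (lt_mem_nhds hk), self_mem_nhdsWithin] with t ht ht0
      have ht0 : 0 < t := ht0
      rw [lt_div_iff₀ ht0] at ht
      linarith
  · intro h
    have key : ∀ v : X,
        Tendsto (fun t : ℝ => (φ (p + t • v) - φ p) / t) (𝓝[>] (0 : ℝ)) (𝓝 (L v)) := by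
      intro v
      refine tendsto_order.2 ⟨fun k hk => ?_, fun k hk => ?_⟩
      · filter_upwards [(h v k).2 hk, self_mem_nhdsWithin] with t ht ht0
        have ht0 : 0 < t := ht0
        rw [lt_div_iff₀ ht0]
        linarith
      · filter_upwards [(h v k).1 hk, self_mem_nhdsWithin] with t ht ht0
        have ht0 : 0 < t := ht0
        rw [div_lt_iff₀ ht0]
        linarith
    intro v
    rw [← Set.Iio_union_Ioi, nhdsWithin_union, tendsto_sup]
    refine ⟨?_, key v⟩
    have h1 := (key (-v)).neg
    have h2 : Tendsto (fun t : ℝ => -t) (𝓝[<] (0:ℝ)) (𝓝[>] (0:ℝ)) := by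
      have := tendsto_neg_nhdsLT (a := (0:ℝ))
      simpa using this
    have h3 := h1.comp h2
    simp only [map_neg, neg_neg] at h3
    refine h3.congr fun t => ?_
    simp [div_neg]

theorem gd_of_le {X : Type*} [NormedAddCommGroup X] [NormedSpace ℝ X]
    (φ : X → ℝ) (p : X) (L : X →L[ℝ] ℝ)
    (h : ∀ v : X, ∀ k : ℝ, (L v < k → ∀ᶠ t in 𝓝[>] (0:ℝ), φ (p + t • v) ≤ φ p + t * k) ∧
      (k < L v → ∀ᶠ t in 𝓝[>] (0:ℝ), φ p + t * k ≤ φ (p + t • v))) :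
    ∀ v : X,
    Tendsto (fun t : ℝ => (φ (p + t • v) - φ p) / t) (𝓝[≠] (0 : ℝ)) (𝓝 (L v)) := by
  rw [gd_iff]
  intro v k
  constructor
  · intro hk
    obtain ⟨k', h1, h2⟩ := exists_between hk
    filter_upwards [(h v k').1 h1, self_mem_nhdsWithin] with t ht ht0
    have := mul_lt_mul_of_pos_left h2 (show 0 < t from ht0)
    linarith
  · intro hk
    obtain ⟨k', h1, h2⟩ := exists_between hk
    filter_upwards [(h v k').2 h2, self_mem_nhdsWithin] with t ht ht0
    have := mul_lt_mul_of_pos_left h1 (show 0 < t from ht0)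
    linarith

theorem gd_support {X : Type*} [NormedAddCommGroup X] [NormedSpace ℝ X]
    {φ : X → ℝ} {p : X} {L : X →L[ℝ] ℝ} {s : Set X} (hφ : ConvexOn ℝ s φ)
    (h : ∀ v : X, ∀ k : ℝ, (L v < k → ∀ᶠ t in 𝓝[>] (0:ℝ), φ (p + t • v) < φ p + t * k) ∧
      (k < L v → ∀ᶠ t in 𝓝[>] (0:ℝ), φ p + t * k < φ (p + t • v)))
    (hp : p ∈ s) {q : X} (hq : q ∈ s) : L (q - p) ≤ φ q - φ p := by
  by_contra hc
  push Not at hc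
  have h1 := (h (q - p) _).2 hc
  have h2 : ∀ᶠ t in 𝓝[>] (0:ℝ), t ∈ Set.Ioo (0:ℝ) 1 := Ioo_mem_nhdsGT one_pos
  obtain ⟨t, ht, ht0, ht1⟩ := (h1.and h2).exists
  have h3 := hφ.2 hp hq (show (0:ℝ) ≤ 1 - t by linarith) ht0.le (by ring)
  have h4 : (1 - t) • p + t • q = p + t • (q - p) := by module
  rw [h4] at h3
  simp only [smul_eq_mul] at h3
  linarith

set_option maxHeartbeats 1000000 in
/-- Let `C` be a bounded open convex subset of `X × ℝ` containing `(0,0)`, let `T` be the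
projection onto `X`, and `g x = sup {r : (x, r) ∈ closure C}`. Then `-g` is convex on `T C`
and continuous at every point of `T C`; moreover for `x₀ ∈ T C`, `-g` is Gâteaux
differentiable at `x₀` iff the gauge of `closure C` is Gâteaux differentiable at
`(x₀, g x₀)`. -/
theorem upperBoundary_convexOn_continuousAt_gateaux_iff
    (X : Type*) [NormedAddCommGroup X] [NormedSpace ℝ X] [CompleteSpace X]
    (C : Set (X × ℝ)) (hCbdd : Bornology.IsBounded C) (hCopen : IsOpen C)
    (hCconv : Convex ℝ C) (hC0 : ((0, 0) : X × ℝ) ∈ C)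
    (g : X → ℝ) (hg : ∀ x : X, g x = sSup {r : ℝ | (x, r) ∈ closure C}) :
    ConvexOn ℝ (Prod.fst '' C) (fun x => -g x) ∧
    (∀ x ∈ Prod.fst '' C, ContinuousAt (fun x => -g x) x) ∧
    ∀ x₀ ∈ Prod.fst '' C,
      (GateauxDiffAt (fun x => -g x) x₀ ↔
        GateauxDiffAt (gauge (closure C)) (x₀, g x₀)) := by
  have hKconv : Convex ℝ (closure C) := hCconv.closure
  have hK0 : closure C ∈ 𝓝 (0 : X × ℝ) :=
    mem_of_superset (hCopen.mem_nhds hC0) subset_closure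
  have hbdd : ∀ x : X, BddAbove {r : ℝ | (x, r) ∈ closure C} := by
    intro x
    obtain ⟨R, hR⟩ := hCbdd.closure.exists_norm_le
    refine ⟨R, fun r hr => ?_⟩
    exact (le_abs_self r).trans ((norm_snd_le (x, r)).trans (hR _ hr))
  have hle : ∀ x r, (x, r) ∈ closure C → r ≤ g x := by
    intro x r h
    rw [hg]
    exact le_csSup (hbdd x) h
  have hclosed : ∀ x : X, IsClosed {r : ℝ | (x, r) ∈ closure C} := fun x =>
    isClosed_closure.preimage (by fun_prop : Continuous fun r : ℝ => (x, r))
  have hmem : ∀ x ∈ Prod.fst '' C, (x, g x) ∈ closure C := by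
    rintro _ ⟨⟨x, a⟩, ha, rfl⟩
    have := (hclosed x).csSup_mem ⟨a, subset_closure ha⟩ (hbdd x)
    rw [← hg] at this
    exact this
  have hlt : ∀ x a, (x, a) ∈ C → a < g x := by
    intro x a ha
    have h1 : ∀ᶠ b in 𝓝[>] a, (x, b) ∈ C := by
      have : Tendsto (fun b : ℝ => (x, b)) (𝓝 a) (𝓝 (x, a)) :=
        (by fun_prop : Continuous fun r : ℝ => (x, r)).tendsto a
      exact (this.mono_left nhdsWithin_le_nhds).eventually (hCopen.mem_nhds ha)
    obtain ⟨b, hb, hab⟩ := (h1.and self_mem_nhdsWithin).exists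
    exact lt_of_lt_of_le hab (hle x b (subset_closure hb))
  have hTopen : IsOpen (Prod.fst '' C) := isOpenMap_fst C hCopen
  have hTconv : Convex ℝ (Prod.fst '' C) := hCconv.linear_image (LinearMap.fst ℝ X ℝ)
  have hconv : ConvexOn ℝ (Prod.fst '' C) (fun x => -g x) := by
    refine ⟨hTconv, fun x hx y hy a b ha hb hab => ?_⟩
    have := hKconv (hmem x hx) (hmem y hy) ha hb hab
    have : a * g x + b * g y ≤ g (a • x + b • y) := hle _ _ this
    simp only [smul_eq_mul]
    linarith
  have hloc : ∀ x a, (x, a) ∈ C → ∀ᶠ y in 𝓝 x, (y, a) ∈ C := by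
    intro x a ha
    have : Tendsto (fun y : X => (y, a)) (𝓝 x) (𝓝 (x, a)) :=
      (by fun_prop : Continuous fun y : X => (y, a)).tendsto x
    exact this.eventually (hCopen.mem_nhds ha)
  have hkey : ∀ x ∈ Prod.fst '' C, ∀ᶠ p in 𝓝 (x, g x), p ∈ closure C ↔ p.2 ≤ g p.1 := by
    rintro _ ⟨⟨x, a⟩, ha, rfl⟩
    have h1 : ∀ᶠ p : X × ℝ in 𝓝 (x, g x), (p.1, a) ∈ C :=
      (continuous_fst.tendsto (x, g x)).eventually (hloc x a ha)
    have h2 : ∀ᶠ p : X × ℝ in 𝓝 (x, g x), a < p.2 :=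
      (continuous_snd.tendsto (x, g x)).eventually (lt_mem_nhds (hlt x a ha))
    filter_upwards [h1, h2] with ⟨y, r⟩ hy hr
    refine ⟨hle y r, fun hr2 => ?_⟩
    have hgy := hmem y ⟨_, hy, rfl⟩
    have hlin : Convex ℝ {r : ℝ | (y, r) ∈ closure C} := by
      intro r hr s hs a b ha hb hab
      have := hKconv hr hs ha hb hab
      simpa [← add_smul, hab] using this
    exact hlin.ordConnected.out (subset_closure hy) hgy ⟨hr.le, hr2⟩
  have hμle : ∀ p, gauge (closure C) p ≤ 1 ↔ p ∈ closure C := by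
    intro p
    rw [gauge_le_one_iff_mem_closure hKconv hK0, closure_closure]
  have hμconv : ConvexOn ℝ Set.univ (gauge (closure C)) := by
    refine ⟨convex_univ, fun x _ y _ a b ha hb hab => ?_⟩
    refine (gauge_add_le hKconv (absorbent_nhds_zero hK0) _ _).trans ?_
    rw [gauge_smul_of_nonneg ha, gauge_smul_of_nonneg hb]
  have hμlt : ∀ p ∈ C, gauge (closure C) p < 1 := by
    intro p hp
    rw [gauge_lt_one_iff_mem_interior hKconv hK0]
    exact interior_mono subset_closure (hCopen.interior_eq.symm ▸ hp)
  refine ⟨hconv, ?_, ?_⟩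
  · rintro _ ⟨⟨x, a⟩, ha, rfl⟩
    have : ContinuousOn (fun x => -g x) (Prod.fst '' C) := by
      have hx : x ∈ Prod.fst '' C := ⟨_, ha, rfl⟩
      have htf : (∃ y ∈ Prod.fst '' C, (𝓝 y).IsBoundedUnder (· ≤ ·) (fun x => -g x)) ↔
          ContinuousOn (fun x => -g x) (Prod.fst '' C) :=
        (hconv.continuousOn_tfae hTopen ⟨x, hx⟩).out 3 1
      refine htf.1 ⟨x, hx, -a, ?_⟩
      rw [eventually_map]
      filter_upwards [hloc x a ha] with y hy
      have := hlt _ _ hy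
      linarith
    exact this.continuousAt (hTopen.mem_nhds ⟨_, ha, rfl⟩)
  intro x₀ hx₀
  have hμ1 : gauge (closure C) (x₀, g x₀) = 1 := by
    refine le_antisymm ((hμle _).2 (hmem _ hx₀)) ?_
    by_contra hc
    push Not at hc
    rw [gauge_lt_one_iff_mem_interior hKconv hK0,
      hCconv.interior_closure_eq_interior_of_nonempty_interior
        (by rw [hCopen.interior_eq]; exact ⟨_, hC0⟩), hCopen.interior_eq] at hc
    exact lt_irrefl _ (hlt _ _ hc)
  have hline : ∀ w : X × ℝ, Tendsto (fun τ : ℝ => (x₀, g x₀) + τ • w)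
        (𝓝[>] 0) (𝓝 (x₀, g x₀)) := by
    intro w
    have := (by fun_prop : Continuous fun τ : ℝ => (x₀, g x₀) + τ • w).tendsto 0
    simp only [zero_smul, add_zero] at this
    exact this.mono_left nhdsWithin_le_nhds
  have hk0 := hkey x₀ hx₀
  constructor
  · rintro ⟨L, hL⟩
    replace hL := (gd_iff (fun x => -g x) x₀ L).1 hL
    have hm : 0 < g x₀ + L x₀ := by
      have h1 := gd_support hconv hL hx₀ (q := 0) ⟨_, hC0, rfl⟩
      have h2 := hlt _ _ hC0
      simp only [zero_sub, map_neg] at h1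
      linarith
    set m := g x₀ + L x₀ with hmdef
    refine ⟨m⁻¹ • (ContinuousLinearMap.snd ℝ X ℝ + L.comp (ContinuousLinearMap.fst ℝ X ℝ)), ?_⟩
    refine gd_of_le _ _ _ ?_
    rintro ⟨v, s⟩ k
    rw [hμ1]
    have hpos : ∀ᶠ t in 𝓝[>] (0:ℝ), 0 < 1 + t * k := by
      have : Tendsto (fun t : ℝ => 1 + t * k) (𝓝 0) (𝓝 (1 + 0 * k)) :=
        (by fun_prop : Continuous fun t : ℝ => 1 + t * k).tendsto 0
      exact (this.mono_left nhdsWithin_le_nhds).eventually (lt_mem_nhds (by simp))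
    have hτ : Tendsto (fun t : ℝ => t / (1 + t * k)) (𝓝[>] 0) (𝓝[>] 0) := by
      refine tendsto_nhdsWithin_iff.2 ⟨?_, ?_⟩
      · have : ContinuousAt (fun t : ℝ => t / (1 + t * k)) 0 :=
          ContinuousAt.div (by fun_prop) (by fun_prop) (by simp)
        have := this.tendsto
        simp only [zero_div] at this
        exact this.mono_left nhdsWithin_le_nhds
      · filter_upwards [hpos, self_mem_nhdsWithin] with t ht ht0
        exact div_pos ht0 ht
    -- membership
    have hmm : ∀ᶠ t in 𝓝[>] (0:ℝ), (gauge (closure C) ((x₀, g x₀) + t • (v, s)) ≤ 1 + t * k ↔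
        g x₀ + t / (1 + t * k) * (s - k * g x₀) ≤ g (x₀ + (t / (1 + t * k)) • (v - k • x₀))) := by
      have h1 : Tendsto (fun τ : ℝ => (x₀, g x₀) + τ • (v - k • x₀, s - k * g x₀))
          (𝓝[>] 0) (𝓝 (x₀, g x₀)) := hline _
      filter_upwards [(h1.comp hτ).eventually hk0, hpos] with t ht hp
      simp only [Function.comp_apply] at ht
      have e : (1 + t * k)⁻¹ • ((x₀, g x₀) + t • (v, s)) =
          (x₀, g x₀) + (t / (1 + t * k)) • (v - k • x₀, s - k * g x₀) := by
        ext
        · simp only [Prod.smul_fst, Prod.fst_add]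
          match_scalars <;> field_simp <;> ring
        · simp only [Prod.smul_snd, Prod.snd_add, smul_eq_mul]
          field_simp
          ring
      rw [← e, ← hμle, gauge_smul_of_nonneg (inv_pos.2 hp).le, smul_eq_mul,
        inv_mul_le_iff₀ hp, mul_one, e] at ht
      simpa using ht
    have hLe : L (v - k • x₀) = L v - k * L x₀ := by simp
    have hval : (m⁻¹ • (ContinuousLinearMap.snd ℝ X ℝ +
        L.comp (ContinuousLinearMap.fst ℝ X ℝ))) (v, s) = m⁻¹ * (s + L v) := by simp [mul_add]
    rw [hval]
    constructor
    · intro hk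
      rw [inv_mul_lt_iff₀ hm] at hk
      have h1 := (hL (v - k • x₀) (k * g x₀ - s)).1 (by rw [hLe]; linarith)
      filter_upwards [hmm, hτ.eventually h1] with t ht h2
      rw [ht]
      linarith
    · intro hk
      rw [lt_inv_mul_iff₀ hm] at hk
      have h1 := (hL (v - k • x₀) (k * g x₀ - s)).2 (by rw [hLe]; linarith)
      filter_upwards [hmm, hτ.eventually h1] with t ht h2
      refine (not_le.1 fun h => ?_).le
      have := ht.1 h
      linarith
  · rintro ⟨N, hN⟩
    replace hN := (gd_iff _ _ N).1 hN
    have hα : 0 < N (0, 1) := by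
      obtain ⟨⟨x, a⟩, ha, rfl⟩ := hx₀
      have h1 := gd_support hμconv hN (Set.mem_univ _) (q := (x, a)) (Set.mem_univ _)
      have h2 := hμlt _ ha
      have h3 := hlt _ _ ha
      have h4 : ((x, a) - (x, g x) : X × ℝ) = (a - g x) • ((0:X), (1:ℝ)) := by simp
      simp only at h1
      rw [h4, map_smul, hμ1, smul_eq_mul] at h1
      by_contra hc
      push Not at hc
      nlinarith
    refine ⟨(N (0, 1))⁻¹ • N.comp (ContinuousLinearMap.inl ℝ X ℝ), ?_⟩
    refine gd_of_le (fun x => -g x) x₀ _ ?_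
    intro v k
    have hNv : N (v, -k) = N (v, 0) - k * N (0, 1) := by
      have : ((v, -k) : X × ℝ) = (v, 0) - k • ((0:X), (1:ℝ)) := by simp
      rw [this, map_sub, map_smul, smul_eq_mul]
    have h1 : Tendsto (fun τ : ℝ => (x₀, g x₀) + τ • (v, -k))
          (𝓝[>] 0) (𝓝 (x₀, g x₀)) := hline _
    have hmm := h1.eventually hk0
    have hval : ((N (0, 1))⁻¹ • N.comp (ContinuousLinearMap.inl ℝ X ℝ)) v =
        (N (0, 1))⁻¹ * N (v, 0) := by simp
    rw [hval]
    constructor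
    · intro hk
      rw [inv_mul_lt_iff₀ hα] at hk
      have h2 := (hN (v, -k) 0).1 (by rw [hNv]; linarith)
      filter_upwards [hmm, h2] with t ht h3
      rw [hμ1, mul_zero, add_zero] at h3
      have := ht.1 ((hμle _).1 h3.le)
      simp only [Prod.smul_snd, Prod.snd_add, Prod.smul_fst, Prod.fst_add, smul_eq_mul] at this
      linarith
    · intro hk
      rw [lt_inv_mul_iff₀ hα] at hk
      have h2 := (hN (v, -k) 0).2 (by rw [hNv]; linarith)
      filter_upwards [hmm, h2] with t ht h3
      rw [hμ1, mul_zero, add_zero] at h3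
      have := mt ht.2 (fun h => h3.not_ge ((hμle _).2 h))
      simp only [Prod.smul_snd, Prod.snd_add, Prod.smul_fst, Prod.fst_add, smul_eq_mul] at this
      linarith
end

section
/- Let X be a real Banach space, let C be a bounded closed convex subset of X with 0 ∈ interior C, let x₀ ∉ C, and let H be a two-dimensional linear subspace of X with x₀ ∈ H. Let D be the closed convex hull of {x₀} ∪ C with Minkowski gauge μ_D, and let y₀ ∈ D ∩ H be a point such that the segment [x₀, y₀] equals {x : μ_D(x) = 1} ∩ {(1−λ) x₀ + λ y₀ : λ ∈ ℝ}. Further, let C₁ ⊆ C be a closed convex set with 0 ∈ interior C₁, and let D₁ be the closed convex hull of {x₀} ∪ C₁ with Minkowski gauge μ_{D₁}. Then there exists a point z₀ ∈ D₁ ∩ H such that μ_{D₁}((1−λ) x₀ + λ z₀) = 1 for every λ ∈ [0,1], and there exists a point u₀ in the segment [0, y₀] = {t y₀ : t ∈ [0,1]} with u₀ ∈ {(1−λ) x₀ + λ z₀ : λ ≥ 0}. -/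
theorem aux_gauge_conv {X : Type*} [NormedAddCommGroup X] [NormedSpace ℝ X] {D : Set X}
    (hD : Convex ℝ D) (h0 : D ∈ nhds (0:X)) (u v : X) (s t : ℝ) (hs : 0 ≤ s) (ht : 0 ≤ t) :
    gauge D (s • u + t • v) ≤ s * gauge D u + t * gauge D v := by
  refine (gauge_add_le hD (absorbent_nhds_zero h0) _ _).trans ?_
  rw [gauge_smul_of_nonneg hs, gauge_smul_of_nonneg ht]
  simp

/-- Let `X` be a real Banach space, `C` a bounded closed convex subset with
`0 ∈ interior C`, `x₀ ∉ C`, and `H` a two-dimensional subspace with `x₀ ∈ H`. Let `D` be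
the closed convex hull of `{x₀} ∪ C` and let `y₀ ∈ D ∩ H` be such that the segment
`[x₀, y₀]` equals `{x : gauge D x = 1} ∩ {(1 - λ) • x₀ + λ • y₀ : λ ∈ ℝ}`. Let `C₁ ⊆ C`
be closed convex with `0 ∈ interior C₁` and let `D₁` be the closed convex hull of
`{x₀} ∪ C₁`. Then there exists `z₀ ∈ D₁ ∩ H` with `gauge D₁ ((1 - λ) • x₀ + λ • z₀) = 1`
for every `λ ∈ [0,1]`, and a point `u₀` of the segment `[0, y₀]` lying on the ray
`{(1 - λ) • x₀ + λ • z₀ : λ ≥ 0}`. -/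
theorem exists_flat_segment_subhull
    (X : Type*) [NormedAddCommGroup X] [NormedSpace ℝ X] [CompleteSpace X]
    (C : Set X) (hCbdd : Bornology.IsBounded C) (hCclosed : IsClosed C)
    (hCconv : Convex ℝ C) (hC0 : (0 : X) ∈ interior C)
    (x₀ : X) (hx₀ : x₀ ∉ C)
    (H : Submodule ℝ X) (hH : Module.finrank ℝ H = 2) (hx₀H : x₀ ∈ H)
    (y₀ : X) (hy₀ : y₀ ∈ closure (convexHull ℝ ({x₀} ∪ C)) ∩ (H : Set X))
    (hseg : segment ℝ x₀ y₀ =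
      {x : X | gauge (closure (convexHull ℝ ({x₀} ∪ C))) x = 1} ∩
      {y : X | ∃ l : ℝ, y = (1 - l) • x₀ + l • y₀})
    (C₁ : Set X) (hC₁C : C₁ ⊆ C) (hC₁closed : IsClosed C₁) (hC₁conv : Convex ℝ C₁)
    (hC₁0 : (0 : X) ∈ interior C₁) :
    ∃ z₀ ∈ closure (convexHull ℝ ({x₀} ∪ C₁)) ∩ (H : Set X),
      (∀ l ∈ Set.Icc (0 : ℝ) 1,
        gauge (closure (convexHull ℝ ({x₀} ∪ C₁))) ((1 - l) • x₀ + l • z₀) = 1) ∧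
      ∃ u₀ ∈ segment ℝ (0 : X) y₀, ∃ l : ℝ, 0 ≤ l ∧ u₀ = (1 - l) • x₀ + l • z₀ := by
  classical
  set D := closure (convexHull ℝ ({x₀} ∪ C)) with hDdef
  have hDconv : Convex ℝ D := (convex_convexHull ℝ _).closure
  have hCD : C ⊆ D := fun x hx => subset_closure (subset_convexHull ℝ _ (Or.inr hx))
  have hD0 : D ∈ nhds (0:X) := Filter.mem_of_superset (mem_interior_iff_mem_nhds.1 hC0) hCD
  set D₁ := closure (convexHull ℝ ({x₀} ∪ C₁)) with hD₁def
  have hD₁conv : Convex ℝ D₁ := (convex_convexHull ℝ _).closure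
  have hCD₁ : C₁ ⊆ D₁ := fun x hx => subset_closure (subset_convexHull ℝ _ (Or.inr hx))
  have hx₀D₁ : x₀ ∈ D₁ := subset_closure (subset_convexHull ℝ _ (Or.inl rfl))
  have hC₁n : C₁ ∈ nhds (0:X) := mem_interior_iff_mem_nhds.1 hC₁0
  have hD₁0 : D₁ ∈ nhds (0:X) := Filter.mem_of_superset hC₁n hCD₁
  have hD₁D : D₁ ⊆ D := closure_mono (convexHull_mono (Set.union_subset_union_right _ hC₁C))
  have hseg1 : ∀ x ∈ segment ℝ x₀ y₀, gauge D x = 1 := fun x hx => by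
    rw [hseg] at hx; exact hx.1
  have gx : gauge D x₀ = 1 := hseg1 _ (left_mem_segment ℝ _ _)
  have gy : gauge D y₀ = 1 := hseg1 _ (right_mem_segment ℝ _ _)
  by_cases hxy : y₀ = x₀
  · refine ⟨x₀, ⟨hx₀D₁, hx₀H⟩, ?_, x₀, ?_, 0, le_rfl, by simp⟩
    · intro l _
      have : (1 - l) • x₀ + l • x₀ = x₀ := by rw [← add_smul]; simp
      rw [this]
      apply le_antisymm (gauge_le_one_of_mem hx₀D₁)
      rw [← gx]
      exact gauge_mono (absorbent_nhds_zero hD₁0) hD₁D x₀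
    · rw [hxy]; exact right_mem_segment ℝ _ _
  have hx0 : x₀ ≠ 0 := by
    rintro h; rw [h, gauge_zero] at gx; norm_num at gx
  have hnc : ∀ c : ℝ, y₀ ≠ c • x₀ := by
    intro c hc
    rcases le_or_gt 0 c with h | h
    · rw [hc, gauge_smul_of_nonneg h, gx] at gy
      have : c = 1 := by simpa using gy
      apply hxy; rw [hc, this, one_smul]
    · have h1 : (0:X) ∈ segment ℝ x₀ y₀ := by
        refine ⟨-c/(1-c), 1/(1-c), ?_, ?_, ?_, ?_⟩
        · exact div_nonneg (by linarith) (by linarith)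
        · exact div_nonneg (by linarith) (by linarith)
        · have : 1 - c ≠ 0 := by linarith
          field_simp; ring
        · rw [hc, smul_smul, ← add_smul]
          have : -c/(1-c) + 1/(1-c)*c = 0 := by ring
          rw [this, zero_smul]
      have := hseg1 _ h1
      rw [gauge_zero] at this; norm_num at this
  let φ : ℝ × ℝ →ₗ[ℝ] X :=
    (LinearMap.fst ℝ ℝ ℝ).smulRight x₀ + (LinearMap.snd ℝ ℝ ℝ).smulRight y₀
  have hφ : ∀ a b : ℝ, φ (a, b) = a • x₀ + b • y₀ := fun a b => by simp [φ]
  have hker : LinearMap.ker φ = ⊥ := by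
    rw [LinearMap.ker_eq_bot']
    rintro ⟨a, b⟩ h
    rw [hφ] at h
    have hb : b = 0 := by
      by_contra hb
      apply hnc (-a/b)
      have h2 : b • y₀ = (-a) • x₀ := by rw [neg_smul]; exact eq_neg_of_add_eq_zero_right h
      rw [div_eq_inv_mul, mul_smul, ← h2, smul_smul, inv_mul_cancel₀ hb, one_smul]
    subst hb
    have : a = 0 := by simpa [hx0] using h
    rw [this]; rfl
  have hinj : Function.Injective φ := LinearMap.ker_eq_bot.1 hker
  have hφH : ∀ p, φ p ∈ H := by
    rintro ⟨a, b⟩; rw [hφ]; exact H.add_mem (H.smul_mem _ hx₀H) (H.smul_mem _ hy₀.2)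
  have hφc : Continuous φ := φ.continuous_of_finiteDimensional
  -- compactness
  have hK : IsCompact (φ ⁻¹' C₁) := by
    obtain ⟨K, hK0, hK⟩ := φ.exists_antilipschitzWith hker
    exact Metric.isCompact_of_isClosed_isBounded (hC₁closed.preimage hφc)
      (hK.isBounded_preimage (hCbdd.subset hC₁C))
  -- convexity along the line
  have hline : ∀ l : ℝ, 1 ≤ gauge D (φ (1 - l, l)) := by
    intro l
    by_contra! hl
    rcases lt_or_ge l 0 with h | h
    · have h1 := aux_gauge_conv hDconv hD0 (φ (1 - l, l)) y₀ (1/(1-l)) (-l/(1-l))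
        (div_nonneg (by linarith) (by linarith)) (div_nonneg (by linarith) (by linarith))
      have hne : 1 - l ≠ 0 := by linarith
      have h2 : (1/(1-l)) • φ (1 - l, l) + (-l/(1-l)) • y₀ = x₀ := by
        have e : y₀ = φ (0, 1) := by simp [hφ]
        have e' : x₀ = φ (1, 0) := by simp [hφ]
        rw [e, e', ← map_smul, ← map_smul, ← map_add]
        congr 1
        ext
        · simp [hne]
        · simp; ring
      rw [h2, gx, gy] at h1
      have : 0 < 1/(1-l) := div_pos one_pos (by linarith)
      have h3 : 1/(1-l) + -l/(1-l) = 1 := by field_simp; ring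
      nlinarith
    rcases le_or_gt l 1 with h' | h'
    · have := hseg1 (φ (1 - l, l)) ⟨1 - l, l, by linarith, h, by ring, by rw [hφ]⟩
      linarith
    · have h1 := aux_gauge_conv hDconv hD0 (φ (1 - l, l)) x₀ (1/l) ((l-1)/l)
        (div_nonneg (by linarith) (by linarith)) (div_nonneg (by linarith) (by linarith))
      have hne : l ≠ 0 := by linarith
      have h2 : (1/l) • φ (1 - l, l) + ((l-1)/l) • x₀ = y₀ := by
        have e : y₀ = φ (0, 1) := by simp [hφ]
        have e' : x₀ = φ (1, 0) := by simp [hφ]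
        rw [e, e', ← map_smul, ← map_smul, ← map_add]
        congr 1
        ext
        · simp; field_simp; ring
        · simp [hne]
      rw [h2, gx, gy] at h1
      have : 0 < 1/l := div_pos one_pos (by linarith)
      have h3 : 1/l + (l-1)/l = 1 := by field_simp; ring
      nlinarith
  have hC1 : ∀ a b : ℝ, φ (a, b) ∈ C₁ → a + b ≤ 1 := by
    intro a b hab
    by_contra! h
    have h1 := hline (b / (a+b))
    have hne : a + b ≠ 0 := by linarith
    have h2 : φ (1 - b/(a+b), b/(a+b)) = (1/(a+b)) • φ (a, b) := by
      rw [← map_smul]; congr 1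
      ext
      · simp; field_simp; ring
      · simp; field_simp
    have hp : 0 < 1/(a+b) := div_pos one_pos (by linarith)
    rw [h2, gauge_smul_of_nonneg hp.le, smul_eq_mul] at h1
    have h3 : gauge D (φ (a,b)) ≤ 1 := gauge_le_one_of_mem (hCD (hC₁C hab))
    have h4 : 1/(a+b) < 1 := by rw [div_lt_one (by linarith)]; exact h
    nlinarith
  -- the slope
  let S : Set ℝ := {τ | ∀ p ∈ φ ⁻¹' C₁, p.1 + τ * p.2 ≤ 1}
  have h1S : (1:ℝ) ∈ S := by
    rintro ⟨a, b⟩ hp; simpa using hC1 a b hp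
  obtain ⟨ε, hε, hεC⟩ : ∃ ε : ℝ, 0 < ε ∧ φ (0, ε) ∈ C₁ := by
    have hc : Continuous (fun e : ℝ => φ (0, e)) := by fun_prop
    have h0 : φ (0, 0) = 0 := by simp [hφ]
    have : (fun e : ℝ => φ (0, e)) ⁻¹' C₁ ∈ nhds (0:ℝ) :=
      hc.continuousAt.preimage_mem_nhds (by rw [h0]; exact hC₁n)
    obtain ⟨r, hr, hrs⟩ := Metric.mem_nhds_iff.1 this
    refine ⟨r/2, by linarith, hrs ?_⟩
    simp [abs_of_pos hr]; linarith
  have hSb : BddAbove S := by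
    refine ⟨1/ε, fun τ hτ => ?_⟩
    have := hτ _ hεC
    rw [le_div_iff₀ hε]; simpa using this
  set τ := sSup S with hτ
  have hτ1 : 1 ≤ τ := le_csSup hSb h1S
  have hSclosed : IsClosed S := by
    have : S = ⋂ p ∈ φ ⁻¹' C₁, {τ : ℝ | p.1 + τ * p.2 ≤ 1} := by
      ext; simp [S]
    rw [this]
    exact isClosed_biInter fun p _ => isClosed_le (by fun_prop) continuous_const
  have hτS : τ ∈ S := hSclosed.csSup_mem ⟨1, h1S⟩ hSb
  obtain ⟨⟨a, b⟩, hab, hmax⟩ := hK.exists_isMaxOn (f := fun p : ℝ × ℝ => p.1 + τ * p.2)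
    ⟨_, hεC⟩ (by fun_prop)
  have hf1 : a + τ * b = 1 := by
    apply le_antisymm (hτS _ hab)
    by_contra! hlt
    obtain ⟨B, hB⟩ := hK.isBounded.exists_norm_le
    have hB0 : 0 ≤ B := (norm_nonneg _).trans (hB _ hab)
    set δ := (1 - (a + τ * b)) / (B + 1) with hδ
    have hδ0 : 0 < δ := div_pos (by linarith) (by linarith)
    have hδB : δ * (B + 1) = 1 - (a + τ * b) := by
      rw [hδ]; field_simp
    have : τ + δ ∈ S := by
      intro p hp
      have h1 : p.1 + τ * p.2 ≤ a + τ * b := hmax hp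
      have h2 : p.2 ≤ B := (le_abs_self _).trans ((norm_snd_le p).trans (hB p hp))
      nlinarith
    have := le_csSup hSb this
    linarith
  have hb : 0 < b := by
    have hb0 : b ≠ 0 := by
      rintro rfl
      have : a = 1 := by simpa using hf1
      subst this
      apply hx₀; apply hC₁C
      have : φ (1, 0) ∈ C₁ := hab
      simpa [hφ] using this
    have hbn : 0 ≤ b := by
      rcases hτ1.eq_or_lt with h | h
      · have ha : a = 1 - b := by rw [← h] at hf1; linarith
        have hz : φ (a, b) ∈ segment ℝ x₀ y₀ := by
          rw [hseg]
          refine ⟨?_, b, ?_⟩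
          · apply le_antisymm (gauge_le_one_of_mem (hCD (hC₁C hab)))
            rw [ha]; exact hline b
          · rw [hφ, ha]
        obtain ⟨s, t, hs, ht, hst, he⟩ := hz
        rw [← hφ] at he
        have := congrArg Prod.snd (hinj he)
        simp at this
        linarith
      · have := hC1 a b hab
        by_contra! hn
        nlinarith
    exact lt_of_le_of_ne hbn hb0.symm
  -- f ≤ 1 on the interior of D₁
  have hint : ∀ p : ℝ × ℝ, gauge D₁ (φ p) < 1 → p.1 + τ * p.2 ≤ 1 := by
    intro p hp
    have h1 : φ p ∈ interior D₁ := (gauge_lt_one_iff_mem_interior hD₁conv hD₁0).1 hp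
    have hne : (interior (convexHull ℝ ({x₀} ∪ C₁))).Nonempty :=
      ⟨0, interior_mono (fun x hx => subset_convexHull ℝ _ (Or.inr hx)) hC₁0⟩
    rw [hD₁def, (convex_convexHull ℝ _).interior_closure_eq_interior_of_nonempty_interior hne] at h1
    have h2 := interior_subset h1
    rw [Set.singleton_union, convexHull_insert ⟨_, hεC⟩, hC₁conv.convexHull_eq] at h2
    obtain ⟨x, hx, c, hc, s, t, hs, ht, hst, he⟩ := mem_convexJoin.1 h2
    rw [Set.mem_singleton_iff] at hx
    subst hx
    have ex : x = φ (1, 0) := by simp [hφ]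
    rcases ht.eq_or_lt with h | h
    · subst h
      have hs1 : s = 1 := by linarith
      rw [hs1, zero_smul, add_zero, one_smul, ex] at he
      rw [← hinj he]; simp
    · have ec : c = φ (t⁻¹ • (p - s • (1, 0))) := by
        rw [map_smul, map_sub, map_smul, ← ex, ← he, add_sub_cancel_left, smul_smul,
          inv_mul_cancel₀ h.ne', one_smul]
      rw [ec] at hc
      have := hτS _ hc
      simp at this
      have h5 : t * (t⁻¹ * (p.1 - s) + τ * (t⁻¹ * p.2)) ≤ t * 1 :=
        mul_le_mul_of_nonneg_left this ht
      have h6 : t * (t⁻¹ * (p.1 - s) + τ * (t⁻¹ * p.2)) = p.1 - s + τ * p.2 := by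
        field_simp
      linarith
  have hint' : ∀ p : ℝ × ℝ, p.1 + τ * p.2 = 1 → 1 ≤ gauge D₁ (φ p) := by
    intro p hp
    by_contra! h
    have g0 := gauge_nonneg (s := D₁) (φ p)
    set g := gauge D₁ (φ p) with hg
    have hr : 0 < 2 / (1 + g) := by positivity
    have h1 : gauge D₁ (φ ((2/(1+g)) • p)) < 1 := by
      rw [map_smul, gauge_smul_of_nonneg hr.le, ← hg, smul_eq_mul, div_mul_eq_mul_div,
        div_lt_one (by linarith)]
      linarith
    have h2 := hint _ h1
    simp only [Prod.smul_fst, Prod.smul_snd, smul_eq_mul] at h2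
    have h3 : 2/(1+g) * p.1 + τ * (2/(1+g) * p.2) = 2/(1+g) := by
      linear_combination (2/(1+g)) * hp
    rw [h3, div_le_one (by linarith)] at h2
    linarith
  have hzD : φ (a, b) ∈ D₁ := hCD₁ hab
  have ex : x₀ = φ (1, 0) := by simp [hφ]
  have ey : y₀ = φ (0, 1) := by simp [hφ]
  have hτb : 0 < τ * b := by positivity
  refine ⟨φ (a, b), ⟨hzD, hφH _⟩, ?_, (1/τ) • y₀, ?_, 1/(τ * b), by positivity, ?_⟩
  · rintro l ⟨hl0, hl1⟩
    apply le_antisymm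
    · exact gauge_le_one_of_mem (hD₁conv hx₀D₁ hzD (by linarith) hl0 (by ring))
    · have e : (1 - l) • x₀ + l • φ (a, b) = φ ((1 - l) • (1, 0) + l • (a, b)) := by
        rw [map_add, map_smul, map_smul, ← ex]
      rw [e]
      apply hint'
      simp
      linear_combination l * hf1
  · refine ⟨1 - 1/τ, 1/τ, ?_, by positivity, by ring, by simp⟩
    have : 1/τ ≤ 1 := by rw [div_le_one (by linarith)]; exact hτ1
    linarith
  · rw [ex, ey, ← map_smul, ← map_smul, ← map_smul, ← map_add]
    congr 1
    have ha : a = 1 - τ * b := by linarith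
    have hτ0 : τ ≠ 0 := by linarith
    have hb0 : b ≠ 0 := hb.ne'
    ext
    · simp only [Prod.smul_fst, Prod.fst_add, smul_eq_mul, ha]; field_simp; ring
    · simp only [Prod.smul_snd, Prod.snd_add, smul_eq_mul]; field_simp; ring
end

section
/- Let X be a two-dimensional real normed space, let x₀ ∈ X with x₀ ≠ 0, let H = {ξ x₀ : ξ ≤ 1}, and let y₀ ∈ X with y₀ ∉ H. Let L = {(1−ξ) x₀ + ξ y₀ : ξ ≥ 0}. Let x* be a continuous linear functional on X whose kernel is {ξ x₀ : ξ ∈ ℝ}, and let z₀ ∈ X satisfy z₀ ∉ closure(convexHull(L ∪ H)), x*(z₀) > 0, and x*(y₀) > 0. Then there exists ξ₀ ∈ [0, ∞) such that (1−ξ₀) x₀ + ξ₀ y₀ lies in the segment [0, z₀] = {t z₀ : t ∈ [0,1]}. -/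
/-- Let `X` be a two-dimensional real normed space, `x₀ ≠ 0`, `H = {ξ • x₀ : ξ ≤ 1}`,
`y₀ ∉ H`, `L = {(1 - ξ) • x₀ + ξ • y₀ : ξ ≥ 0}`. Let `x*` be a continuous linear
functional with kernel `{ξ • x₀ : ξ ∈ ℝ}` and let `z₀` satisfy
`z₀ ∉ closure (convexHull (L ∪ H))`, `x* z₀ > 0` and `x* y₀ > 0`. Then there is
`ξ₀ ≥ 0` with `(1 - ξ₀) • x₀ + ξ₀ • y₀ ∈ [0, z₀]`. -/
theorem exists_ray_point_in_segment
    (X : Type*) [NormedAddCommGroup X] [NormedSpace ℝ X]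
    (hdim : Module.finrank ℝ X = 2)
    (x₀ : X) (hx₀ : x₀ ≠ 0)
    (y₀ : X) (hy₀ : y₀ ∉ {v : X | ∃ ξ : ℝ, ξ ≤ 1 ∧ v = ξ • x₀})
    (x' : X →L[ℝ] ℝ)
    (hker : {v : X | x' v = 0} = {v : X | ∃ ξ : ℝ, v = ξ • x₀})
    (z₀ : X)
    (hz₀ : z₀ ∉ closure (convexHull ℝ
      ({v : X | ∃ ξ : ℝ, 0 ≤ ξ ∧ v = (1 - ξ) • x₀ + ξ • y₀} ∪
       {v : X | ∃ ξ : ℝ, ξ ≤ 1 ∧ v = ξ • x₀})))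
    (hz₀pos : 0 < x' z₀) (hy₀pos : 0 < x' y₀) :
    ∃ ξ₀ : ℝ, 0 ≤ ξ₀ ∧ (1 - ξ₀) • x₀ + ξ₀ • y₀ ∈ segment ℝ (0 : X) z₀ := by
  have hb : 0 < x' z₀ / x' y₀ := div_pos hz₀pos hy₀pos
  obtain ⟨b, hbdef⟩ : ∃ b, b = x' z₀ / x' y₀ := ⟨_, rfl⟩
  rw [← hbdef] at hb
  have hmem : z₀ - b • y₀ ∈ {v : X | x' v = 0} := by
    simp only [Set.mem_setOf_eq, map_sub, map_smul, smul_eq_mul, hbdef]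
    field_simp
    ring
  rw [hker] at hmem
  obtain ⟨a, ha⟩ := hmem
  have hz : z₀ = a • x₀ + b • y₀ := by rw [← ha]; abel
  have hab : 1 < a + b := by
    by_contra! h
    apply hz₀
    apply subset_closure
    have h1 := subset_convexHull ℝ
      ({v : X | ∃ ξ : ℝ, 0 ≤ ξ ∧ v = (1 - ξ) • x₀ + ξ • y₀} ∪
       {v : X | ∃ ξ : ℝ, ξ ≤ 1 ∧ v = ξ • x₀})
      (Or.inl ⟨2 * b, by positivity, rfl⟩)
    have h2 := subset_convexHull ℝ
      ({v : X | ∃ ξ : ℝ, 0 ≤ ξ ∧ v = (1 - ξ) • x₀ + ξ • y₀} ∪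
       {v : X | ∃ ξ : ℝ, ξ ≤ 1 ∧ v = ξ • x₀})
      (Or.inr ⟨2 * a + 2 * b - 1, by linarith, rfl⟩)
    have h3 := convex_convexHull ℝ _ h1 h2 (a := 1 / 2) (b := 1 / 2)
      (by norm_num) (by norm_num) (by norm_num)
    convert h3 using 1
    rw [hz]
    module
  have hpos : 0 < a + b := by linarith
  refine ⟨b / (a + b), by positivity, 1 - 1 / (a + b), 1 / (a + b), ?_, by positivity, by ring, ?_⟩
  · rw [sub_nonneg, div_le_one hpos]; exact hab.le
  · have e : 1 - b / (a + b) = 1 / (a + b) * a := by field_simp; ring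
    rw [e, hz, smul_zero, zero_add, smul_add, smul_smul, smul_smul]
    congr 2
    ring
end

section
/- Let X be a real Banach space, let C be a bounded closed convex subset of X with 0 ∈ interior C, and let μ_C be its Minkowski gauge. Let h : X → ℝ be a continuous convex function, x₀ ∈ X, e₀ ∈ X with μ_C(e₀) = 1, and α > 0. Suppose that every subgradient x* ∈ ∂h(x₀) satisfies ⟨x*, e₀⟩ = α, that ⟨x*, e⟩ ≤ α for every x* ∈ ∂h(x₀) and every e ∈ X with μ_C(e) = 1, and that μ_C is Gâteaux differentiable at e₀. Then ∂h(x₀) is a subsingleton (it contains at most one element). -/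
open Filter Topology

/-- Let `C` be a bounded closed convex subset of a real Banach space `X` with
`0 ∈ interior C` and Minkowski gauge `gauge C`. Let `h : X → ℝ` be continuous convex,
`x₀, e₀ ∈ X` with `gauge C e₀ = 1`, and `α > 0`. Suppose every subgradient `x* ∈ ∂h(x₀)`
satisfies `⟨x*, e₀⟩ = α` and `⟨x*, e⟩ ≤ α` whenever `gauge C e = 1`, and that `gauge C` is
Gâteaux differentiable at `e₀`. Then `∂h(x₀)` contains at most one element. -/
theorem subdifferential_subsingleton_of_gauge_gateaux
    (X : Type*) [NormedAddCommGroup X] [NormedSpace ℝ X] [CompleteSpace X]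
    (C : Set X) (hCbdd : Bornology.IsBounded C) (hCclosed : IsClosed C)
    (hCconv : Convex ℝ C) (hC0 : (0 : X) ∈ interior C)
    (h : X → ℝ) (hcont : Continuous h) (hconv : ConvexOn ℝ Set.univ h)
    (x₀ e₀ : X) (he₀ : gauge C e₀ = 1) (α : ℝ) (hα : 0 < α)
    (heq : ∀ x' : X →L[ℝ] ℝ, (∀ q : X, x' (q - x₀) ≤ h q - h x₀) → x' e₀ = α)
    (hle : ∀ x' : X →L[ℝ] ℝ, (∀ q : X, x' (q - x₀) ≤ h q - h x₀) →
      ∀ e : X, gauge C e = 1 → x' e ≤ α)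
    (hgat : GateauxDiffAt (gauge C) e₀) :
    {x' : X →L[ℝ] ℝ | ∀ q : X, x' (q - x₀) ≤ h q - h x₀}.Subsingleton := by
  obtain ⟨L, hL⟩ := hgat
  have hCn : C ∈ 𝓝 (0 : X) := mem_interior_iff_mem_nhds.1 hC0
  have habs : Absorbent ℝ C := absorbent_nhds_zero hCn
  have hvn : Bornology.IsVonNBounded ℝ C := (NormedSpace.isVonNBounded_iff ℝ).2 hCbdd
  have key : ∀ x' : X →L[ℝ] ℝ, (∀ q : X, x' (q - x₀) ≤ h q - h x₀) →
      ∀ e : X, x' e ≤ α * gauge C e := by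
    intro x' hx e
    by_cases he : e = 0
    · simp [he]
    have hp : 0 < gauge C e := (gauge_pos habs hvn).2 he
    have h1 : gauge C ((gauge C e)⁻¹ • e) = 1 := by
      rw [gauge_smul_of_nonneg (inv_nonneg.2 hp.le), smul_eq_mul, inv_mul_cancel₀ hp.ne']
    have h2 := hle x' hx _ h1
    rw [map_smul, smul_eq_mul, inv_mul_le_iff₀ hp] at h2
    linarith
  have key2 : ∀ x' : X →L[ℝ] ℝ, (∀ q : X, x' (q - x₀) ≤ h q - h x₀) →
      ∀ v : X, x' v ≤ α * L v := by
    intro x' hx v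
    have ht : Tendsto (fun t : ℝ => α * ((gauge C (e₀ + t • v) - gauge C e₀) / t))
        (𝓝[>] (0 : ℝ)) (𝓝 (α * L v)) :=
      ((hL v).mono_left (nhdsWithin_mono _ (fun t ht => ne_of_gt ht))).const_mul α
    refine ge_of_tendsto ht ?_
    filter_upwards [self_mem_nhdsWithin] with t ht
    have ht : 0 < t := ht
    have h1 := key x' hx (e₀ + t • v)
    rw [map_add, map_smul, smul_eq_mul, heq x' hx] at h1
    rw [he₀, ← mul_div_assoc, le_div_iff₀ ht]
    linarith
  have key3 : ∀ x' : X →L[ℝ] ℝ, (∀ q : X, x' (q - x₀) ≤ h q - h x₀) →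
      ∀ v : X, x' v = α * L v := by
    intro x' hx v
    have h1 := key2 x' hx v
    have h2 := key2 x' hx (-v)
    rw [map_neg, map_neg] at h2
    linarith
  intro a ha b hb
  ext v
  rw [key3 a ha v, key3 b hb v]
end

section
/- Let x₀ ∈ T C and let (y*, r) ∈ X* × ℝ be a subgradient of the Minkowski gauge μ of closure C at the point (x₀, f(x₀)), i.e. ⟨(y*, r), q − (x₀, f(x₀))⟩ ≤ μ(q) − μ(x₀, f(x₀)) for all q ∈ X × ℝ. Then r < 0. -/
/-- Let `C` be a bounded open convex subset of `X × ℝ` containing `(0,0)`, let `T` be the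
projection onto `X`, `f x = inf {r : (x, r) ∈ closure C}` and `μ = gauge (closure C)`.
If `x₀ ∈ T C` and `(y*, r)` is a subgradient of `μ` at `(x₀, f x₀)`, then `r < 0`. -/
theorem subgradient_second_coord_neg
    (X : Type*) [NormedAddCommGroup X] [NormedSpace ℝ X] [CompleteSpace X]
    (C : Set (X × ℝ)) (hCbdd : Bornology.IsBounded C) (hCopen : IsOpen C)
    (hCconv : Convex ℝ C) (hC0 : ((0, 0) : X × ℝ) ∈ C)
    (f : X → ℝ) (hf : ∀ x : X, f x = sInf {r : ℝ | (x, r) ∈ closure C})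
    (x₀ : X) (hx₀ : x₀ ∈ Prod.fst '' C)
    (y' : X →L[ℝ] ℝ) (r : ℝ)
    (hsub : ∀ q : X × ℝ, y' (q.1 - x₀) + r * (q.2 - f x₀) ≤
      gauge (closure C) q - gauge (closure C) (x₀, f x₀)) :
    r < 0 := by
  obtain ⟨⟨x, s⟩, hs, rfl⟩ := hx₀
  simp only at hsub
  have hcl : Bornology.IsBounded (closure C) := hCbdd.closure
  have hbdd : BddBelow {r : ℝ | (x, r) ∈ closure C} := by
    have h2 : Bornology.IsBounded (Prod.snd '' closure C) := hcl.image_snd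
    refine h2.bddBelow.mono ?_
    intro t ht
    exact ⟨(x, t), ht, rfl⟩
  have hlow : ∀ t : ℝ, (x, t) ∈ interior (closure C) → f x < t := by
    intro t ht
    have hc : Continuous (fun u : ℝ => ((x, u) : X × ℝ)) := by fun_prop
    have hn : {u : ℝ | (x, u) ∈ interior (closure C)} ∈ nhds t :=
      (isOpen_interior.preimage hc).mem_nhds ht
    obtain ⟨ε, hε, hb⟩ := Metric.mem_nhds_iff.1 hn
    have h1 : (x, t - ε / 2) ∈ interior (closure C) := by
      apply hb
      rw [Metric.mem_ball, Real.dist_eq, abs_lt]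
      constructor <;> linarith
    have h2 : f x ≤ t - ε / 2 := by
      rw [hf]
      have h4 : (x, t - ε / 2) ∈ closure C := interior_subset h1
      exact csInf_le hbdd h4
    linarith
  have hnhds : closure C ∈ nhds (0 : X × ℝ) :=
    Filter.mem_of_superset (hCopen.mem_nhds hC0) subset_closure
  have hsi : (x, s) ∈ interior (closure C) :=
    interior_maximal subset_closure hCopen hs
  have hg1 : gauge (closure C) (x, s) < 1 :=
    (gauge_lt_one_iff_mem_interior hCconv.closure hnhds).2 hsi
  have hg2 : 1 ≤ gauge (closure C) (x, f x) := by
    by_contra! h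
    exact lt_irrefl _ (hlow _ ((gauge_lt_one_iff_mem_interior hCconv.closure hnhds).1 h))
  have h := hsub (x, s)
  simp only [sub_self, map_zero, zero_add] at h
  have h3 := hlow s hsi
  by_contra! hr
  have := mul_nonneg hr (sub_nonneg.2 h3.le)
  linarith
end

section
/- Let x₀ ∈ T C and let x₀* ∈ X* be a subgradient of f at x₀ relative to T C, i.e. ⟨x₀*, x − x₀⟩ ≤ f(x) − f(x₀) for all x ∈ T C. Then c := ⟨x₀*, x₀⟩ − f(x₀) > 0, and the pair (c⁻¹ x₀*, −c⁻¹) is a subgradient of the Minkowski gauge μ of closure C at the point (x₀, f(x₀)), i.e. ⟨(c⁻¹ x₀*, −c⁻¹), q − (x₀, f(x₀))⟩ ≤ μ(q) − μ(x₀, f(x₀)) for all q ∈ X × ℝ. -/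
/-- Let `C` be a bounded open convex subset of `X × ℝ` containing `(0,0)`, let `T` be the
projection onto `X`, `f x = inf {r : (x, r) ∈ closure C}` and `μ = gauge (closure C)`.
Let `x₀ ∈ T C` and let `x₀*` be a subgradient of `f` at `x₀` relative to `T C`. Then
`c = ⟨x₀*, x₀⟩ - f x₀ > 0` and `(c⁻¹ x₀*, -c⁻¹)` is a subgradient of `μ` at
`(x₀, f x₀)`. -/
theorem subgradient_lift_to_gauge
    (X : Type*) [NormedAddCommGroup X] [NormedSpace ℝ X] [CompleteSpace X]
    (C : Set (X × ℝ)) (hCbdd : Bornology.IsBounded C) (hCopen : IsOpen C)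
    (hCconv : Convex ℝ C) (hC0 : ((0, 0) : X × ℝ) ∈ C)
    (f : X → ℝ) (hf : ∀ x : X, f x = sInf {r : ℝ | (x, r) ∈ closure C})
    (x₀ : X) (hx₀ : x₀ ∈ Prod.fst '' C)
    (x₀' : X →L[ℝ] ℝ)
    (hsub : ∀ x ∈ Prod.fst '' C, x₀' (x - x₀) ≤ f x - f x₀) :
    0 < x₀' x₀ - f x₀ ∧
    ∀ q : X × ℝ,
      (x₀' x₀ - f x₀)⁻¹ * x₀' (q.1 - x₀) + (-(x₀' x₀ - f x₀)⁻¹) * (q.2 - f x₀) ≤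
        gauge (closure C) q - gauge (closure C) (x₀, f x₀) := by
  have hbdd : ∀ x : X, BddBelow {r : ℝ | (x, r) ∈ closure C} := by
    intro x
    have h1 := (hCbdd.closure.image_snd).bddBelow
    refine h1.mono ?_
    intro r hr
    exact ⟨(x, r), hr, rfl⟩
  have hle : ∀ q ∈ closure C, f q.1 ≤ q.2 := by
    intro q hq
    rw [hf]
    exact csInf_le (hbdd _) hq
  have hmem : (x₀, f x₀) ∈ closure C := by
    have hcl : IsClosed {r : ℝ | (x₀, r) ∈ closure C} :=
      isClosed_closure.preimage (by fun_prop : Continuous fun r : ℝ => (x₀, r))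
    obtain ⟨⟨a, r⟩, hq, rfl⟩ := hx₀
    have := hcl.csInf_mem ⟨r, subset_closure hq⟩ (hbdd _)
    rw [hf]
    exact this
  have hf0 : f 0 < 0 := by
    have ho : IsOpen {r : ℝ | ((0 : X), r) ∈ C} :=
      hCopen.preimage (by fun_prop : Continuous fun r : ℝ => ((0 : X), r))
    obtain ⟨ε, hε, hb⟩ := Metric.isOpen_iff.1 ho 0 hC0
    have h1 : (-(ε / 2)) ∈ Metric.ball (0 : ℝ) ε := by
      rw [Metric.mem_ball, Real.dist_eq, sub_zero, abs_neg, abs_of_pos (by linarith)]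
      linarith
    have h2 := hle _ (subset_closure (hb h1))
    simp only at h2
    linarith
  have hc : 0 < x₀' x₀ - f x₀ := by
    have := hsub 0 ⟨_, hC0, rfl⟩
    simp only [zero_sub, map_neg] at this
    linarith
  refine ⟨hc, ?_⟩
  intro q
  set c := x₀' x₀ - f x₀ with hcdef
  have hC1 : ∀ p ∈ closure C, x₀' p.1 - p.2 ≤ c := by
    have hcl : IsClosed {p : X × ℝ | x₀' p.1 - p.2 ≤ c} :=
      isClosed_le (by fun_prop) continuous_const
    refine closure_minimal ?_ hcl
    intro p hp
    have h1 := hsub p.1 ⟨p, hp, rfl⟩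
    have h2 := hle p (subset_closure hp)
    rw [map_sub] at h1
    change x₀' p.1 - p.2 ≤ c
    linarith
  have hg1 : gauge (closure C) (x₀, f x₀) ≤ 1 := gauge_le_one_of_mem hmem
  have habs : Absorbent ℝ (closure C) :=
    absorbent_nhds_zero (Filter.mem_of_superset (hCopen.mem_nhds hC0) subset_closure)
  have hg2 : c⁻¹ * (x₀' q.1 - q.2) ≤ gauge (closure C) q := by
    refine le_csInf habs.gauge_set_nonempty ?_
    rintro r ⟨hr, p, hp, rfl⟩
    have h1 := hC1 p hp
    have h2 : x₀' (r • p).1 - (r • p).2 = r * (x₀' p.1 - p.2) := by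
      simp [mul_sub]
    simp only [h2]
    rw [inv_mul_le_iff₀ hc, mul_comm c]
    exact mul_le_mul_of_nonneg_left h1 (le_of_lt hr)
  have h3 : c⁻¹ * x₀' (q.1 - x₀) + (-c⁻¹) * (q.2 - f x₀)
      = c⁻¹ * (x₀' q.1 - q.2) - c⁻¹ * c := by
    rw [map_sub, hcdef]; ring
  rw [h3, inv_mul_cancel₀ hc.ne']
  linarith
end
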